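/- Let Ω ⊂ ℝ² be a bounded, simply connected domain with smooth boundary and let p ∈ [2, ∞). There exists a constant C > 0 depending only on p and Ω such that the following holds for all sufficiently small t > 0: if Φ ∈ C¹(Ω̄, ℝ²) satisfies det∇Φ > 0 on Ω and (∇Φ)ᵀ(∇Φ) = I + t²B for some bounded measurable B : Ω → ℝ^{2×2}_sym, then there exist R ∈ SO(2) and w ∈ W^{1,p}(Ω, ℝ²) such that ∇Φ = R + t² ∇w on Ω and ‖∇w‖_{L^p(Ω)} ≤ C ‖B‖_{L^p(Ω)}. -/

import Mathlib

open MeasureTheory Matrix Topology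

noncomputable section

abbrev V2 := Fin 2 → ℝ
abbrev Mat2 := Matrix (Fin 2) (Fin 2) ℝ

/-- Partial derivative `∂ᵢ f`. -/
def pd (i : Fin 2) (f : V2 → ℝ) (x : V2) : ℝ := fderiv ℝ f x (Pi.single i 1)

/-- Gradient of a scalar function. -/
def grad (f : V2 → ℝ) (x : V2) : V2 := fun i => pd i f x

/-- `∇v ⊗ ∇v`. -/
def gradOuter (v : V2 → ℝ) (x : V2) : Mat2 := Matrix.of fun i j => pd i v x * pd j v x

/-- Derivative matrix `(∇w)ᵢⱼ = ∂ⱼwᵢ`. -/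
def Dm (w : V2 → V2) (x : V2) : Mat2 := Matrix.of fun i j => fderiv ℝ w x (Pi.single j 1) i

/-- Symmetrised gradient `sym ∇w = (∇w + (∇w)ᵀ)/2`. -/
def symGrad (w : V2 → V2) (x : V2) : Mat2 := (1/2 : ℝ) • (Dm w x + (Dm w x)ᵀ)

/-- Frobenius norm of a matrix. -/
def frob (M : Mat2) : ℝ := Real.sqrt (∑ i, ∑ j, (M i j)^2)

/-- Euclidean norm on ℝ². -/
def norm2 (y : V2) : ℝ := Real.sqrt (∑ i, (y i)^2)

/-- Supremum norm over `Ω` of a matrix field. -/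
def supM (Ω : Set V2) (M : V2 → Mat2) : ℝ := ⨆ x : Ω, frob (M x)

/-- Supremum norm over `Ω` of a vector field. -/
def supV (Ω : Set V2) (f : V2 → V2) : ℝ := ⨆ x : Ω, norm2 (f x)

/-- `L^p` norm over `Ω` of a matrix field. -/
def lpM (p : ℝ) (Ω : Set V2) (M : V2 → Mat2) : ℝ := (∫ x in Ω, frob (M x) ^ p) ^ (1/p)

/-- `f ∈ C^k(Ω̄)`: `f` is `C^k` on an open neighbourhood of the closure of `Ω`. -/
def CkCl (k : ℕ∞) (Ω : Set V2) {F : Type*} [NormedAddCommGroup F] [NormedSpace ℝ F]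
    (f : V2 → F) : Prop :=
  ∃ U : Set V2, IsOpen U ∧ closure Ω ⊆ U ∧ ContDiffOn ℝ k f U

/-- `A ∈ C^{0,β}(Ω̄)`: `A` is `β`-Hölder continuous on the closure of `Ω`. -/
def HolderCl (β : ℝ) (Ω : Set V2) (A : V2 → Mat2) : Prop :=
  ∃ C : ℝ, ∀ x ∈ closure Ω, ∀ y ∈ closure Ω, frob (A x - A y) ≤ C * norm2 (x - y) ^ β

/-- `f ∈ C^{1,α}(Ω̄)`: continuously differentiable with `α`-Hölder gradient. -/
def C1Holder (α : ℝ) (Ω : Set V2) {F : Type*} [NormedAddCommGroup F] [NormedSpace ℝ F]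
    (f : V2 → F) : Prop :=
  ContinuousOn f (closure Ω) ∧ DifferentiableOn ℝ f Ω ∧
    ∃ C : ℝ, ∀ x ∈ Ω, ∀ y ∈ Ω, ‖fderiv ℝ f x - fderiv ℝ f y‖ ≤ C * norm2 (x - y) ^ α

/-- `Ω` has smooth boundary: it is the sublevel set of a smooth function with
nonvanishing gradient on the boundary. -/
def HasSmoothBoundary (Ω : Set V2) : Prop :=
  ∃ ρ : V2 → ℝ, ContDiff ℝ (⊤ : ℕ∞) ρ ∧ Ω = ρ ⁻¹' Set.Iio 0 ∧
    ∀ x ∈ frontier Ω, fderiv ℝ ρ x ≠ 0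

/-- The rotation group `SO(2)`. -/
def SO2 : Set Mat2 := {R | Rᵀ * R = 1 ∧ R.det = 1}

/-- `(∇Φ)ᵀ(∇Φ)` for a planar map `Φ : ℝ² → ℝ²`. -/
def pullback2 (Φ : V2 → V2) (x : V2) : Mat2 :=
  Matrix.of fun i j => ∑ k, fderiv ℝ Φ x (Pi.single i 1) k * fderiv ℝ Φ x (Pi.single j 1) k

namespace RPD
open Set Metric
open scoped ENNReal

/-! ### Dyadic cells -/

/-- Integer label of the dyadic cell of generation `j`. -/
def lab (o : V2) (s : ℝ) (j : ℕ) (x : V2) : Fin 2 → ℤ := fun i => ⌊(x i - o i) / s * 2 ^ j⌋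

/-- Dyadic cell of generation `j` containing `x`. -/
def cell (o : V2) (s : ℝ) (j : ℕ) (x : V2) : Set V2 := {y | lab o s j y = lab o s j x}

lemma mem_cell_self (o : V2) (s : ℝ) (j : ℕ) (x : V2) : x ∈ cell o s j x := rfl

lemma cell_eq_of_mem {o : V2} {s : ℝ} {j : ℕ} {x y : V2} (h : y ∈ cell o s j x) :
    cell o s j y = cell o s j x := by
  ext z
  have h' : lab o s j y = lab o s j x := h
  simp only [cell, mem_ofPred_eq, h']

lemma lab_succ (o : V2) (s : ℝ) (j : ℕ) (x : V2) (i : Fin 2) :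
    lab o s j x i = lab o s (j + 1) x i / 2 := by
  have h := Int.floor_div_natCast ((x i - o i) / s * 2 ^ (j + 1)) 2
  simp only [lab]
  push_cast at h
  rw [← h]
  congr 1
  rw [pow_succ]; ring

lemma cell_anti (o : V2) (s : ℝ) {j k : ℕ} (h : j ≤ k) (x : V2) :
    cell o s k x ⊆ cell o s j x := by
  induction k, h using Nat.le_induction with
  | base => exact subset_rfl
  | succ k hk ih =>
    refine Subset.trans ?_ ih
    intro y hy
    have hy' : lab o s (k + 1) y = lab o s (k + 1) x := hy
    show lab o s k y = lab o s k x
    ext i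
    rw [lab_succ o s k y, lab_succ o s k x, hy']

lemma cell_eq_pi (o : V2) {s : ℝ} (hs : 0 < s) (j : ℕ) (x : V2) :
    cell o s j x = Set.pi univ (fun i => Ico (o i + lab o s j x i * (s / 2 ^ j))
      (o i + (lab o s j x i + 1) * (s / 2 ^ j))) := by
  ext y
  simp only [cell, mem_ofPred_eq, mem_pi, mem_univ, true_imp_iff, mem_Ico, funext_iff]
  refine forall_congr' fun i => ?_
  rw [show lab o s j y i = ⌊(y i - o i) / s * 2 ^ j⌋ from rfl, Int.floor_eq_iff]
  have h2 : (0 : ℝ) < 2 ^ j := by positivity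
  have e : y i = o i + ((y i - o i) / s * 2 ^ j) * (s / 2 ^ j) := by field_simp; ring
  have hp : 0 < s / 2 ^ j := by positivity
  constructor
  · rintro ⟨h1, h3⟩
    constructor
    · rw [e]; gcongr
    · rw [e]; gcongr
  · rintro ⟨h1, h3⟩
    rw [e] at h1 h3
    constructor
    · exact le_of_mul_le_mul_right (by linarith) hp
    · exact lt_of_mul_lt_mul_right (by linarith) hp.le

lemma measurableSet_cell (o : V2) {s : ℝ} (hs : 0 < s) (j : ℕ) (x : V2) :
    MeasurableSet (cell o s j x) := by
  rw [cell_eq_pi o hs]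
  exact MeasurableSet.univ_pi fun i => measurableSet_Ico

lemma volume_cell (o : V2) {s : ℝ} (hs : 0 < s) (j : ℕ) (x : V2) :
    volume (cell o s j x) = ENNReal.ofReal ((s / 2 ^ j) ^ 2) := by
  rw [cell_eq_pi o hs, Real.volume_pi_Ico]
  have : ∀ i, (o i + ((lab o s j x i : ℝ) + 1) * (s / 2 ^ j)) -
    (o i + lab o s j x i * (s / 2 ^ j)) = s / 2 ^ j := fun i => by ring
  simp only [this]
  rw [Finset.prod_const, ENNReal.ofReal_pow (by positivity)]
  simp

lemma cell_subset_closedBall (o : V2) {s : ℝ} (hs : 0 < s) (j : ℕ) (x : V2) :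
    cell o s j x ⊆ closedBall x (s / 2 ^ j) := by
  intro y hy
  have hx := mem_cell_self o s j x
  rw [cell_eq_pi o hs] at hy hx
  rw [mem_closedBall, dist_pi_le_iff (by positivity)]
  intro i
  have h1 := hy i (mem_univ _)
  have h2 := hx i (mem_univ _)
  rw [mem_Ico] at h1 h2
  rw [Real.dist_eq, abs_le]
  constructor <;> linarith

/-- Stopping-time decomposition into cells. -/
lemma stopping (o : V2) {s : ℝ} (hs : 0 < s) (k : ℕ) (x₀ : V2) (P : Set V2 → Prop)
    (μ ν : Measure V2)
    (h : ∀ x ∈ cell o s k x₀, ∀ j, k ≤ j → P (cell o s j x) →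
      (∀ i, k ≤ i → i < j → ¬ P (cell o s i x)) → μ (cell o s j x) ≤ ν (cell o s j x)) :
    μ {x ∈ cell o s k x₀ | ∃ j, k ≤ j ∧ P (cell o s j x)} ≤
      ν {x ∈ cell o s k x₀ | ∃ j, k ≤ j ∧ P (cell o s j x)} := by
  classical
  set E : ℕ × (Fin 2 → ℤ) → Set V2 := fun q => {x | x ∈ cell o s k x₀ ∧ lab o s q.1 x = q.2 ∧
    k ≤ q.1 ∧ P (cell o s q.1 x) ∧ ∀ i, k ≤ i → i < q.1 → ¬ P (cell o s i x)} with hE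
  have hEq : ∀ q x, x ∈ E q → E q = cell o s q.1 x := by
    intro q x hx
    obtain ⟨h1, h2, h3, h4, h5⟩ := hx
    ext y
    constructor
    · rintro ⟨-, g2, -⟩
      show lab o s q.1 y = lab o s q.1 x
      rw [g2, h2]
    · intro hy
      have hc : ∀ i, i ≤ q.1 → cell o s i y = cell o s i x := fun i hi =>
        cell_eq_of_mem (cell_anti o s hi x hy)
      refine ⟨?_, ?_, h3, ?_, ?_⟩
      · rw [← cell_eq_of_mem h1]; exact cell_anti o s h3 x hy
      · rw [← h2]; exact hy
      · rw [hc _ le_rfl]; exact h4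
      · intro i hi hi'
        rw [hc _ hi'.le]; exact h5 i hi hi'
  have hmeas : ∀ q, MeasurableSet (E q) := by
    intro q
    rcases (E q).eq_empty_or_nonempty with h0 | ⟨x, hx⟩
    · rw [h0]; exact MeasurableSet.empty
    · rw [hEq q x hx]; exact measurableSet_cell o hs _ _
  have hle : ∀ q, μ (E q) ≤ ν (E q) := by
    intro q
    rcases (E q).eq_empty_or_nonempty with h0 | ⟨x, hx⟩
    · rw [h0]; simp
    · rw [hEq q x hx]; exact h x hx.1 _ hx.2.2.1 hx.2.2.2.1 hx.2.2.2.2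
  have hdisj : Pairwise (Function.onFun Disjoint E) := by
    intro q r hqr
    rw [Function.onFun, Set.disjoint_left]
    rintro x ⟨-, h2, h3, h4, h5⟩ ⟨-, g2, g3, g4, g5⟩
    have : q.1 = r.1 := by
      rcases lt_trichotomy q.1 r.1 with hl | he | hl
      · exact absurd h4 (g5 _ h3 hl)
      · exact he
      · exact absurd g4 (h5 _ g3 hl)
    apply hqr
    refine Prod.ext this ?_
    rw [← h2, ← g2, this]
  have hun : {x ∈ cell o s k x₀ | ∃ j, k ≤ j ∧ P (cell o s j x)} = ⋃ q, E q := by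
    ext x
    simp only [mem_ofPred_eq, mem_iUnion]
    constructor
    · rintro ⟨h1, h2⟩
      refine ⟨(Nat.find h2, lab o s (Nat.find h2) x), h1, rfl, (Nat.find_spec h2).1,
        (Nat.find_spec h2).2, ?_⟩
      intro i hi hi' hP
      exact Nat.find_min h2 hi' ⟨hi, hP⟩
    · rintro ⟨q, h1, h2, h3, h4, -⟩
      exact ⟨h1, q.1, h3, h4⟩
  rw [hun, measure_iUnion hdisj hmeas, measure_iUnion hdisj hmeas]
  exact ENNReal.tsum_le_tsum hle

/-- Dyadic weak (1,1) estimate. -/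
lemma dyadic_weak (o : V2) {s : ℝ} (hs : 0 < s) (k : ℕ) (x₀ : V2) (u : V2 → ℝ≥0∞) (L : ℝ≥0∞) :
    L * volume {x ∈ cell o s k x₀ | ∃ j, k ≤ j ∧
      L * volume (cell o s j x) < ∫⁻ y in cell o s j x, u y} ≤ ∫⁻ y in cell o s k x₀, u y := by
  have := stopping o hs k x₀ (fun A => L * volume A < ∫⁻ y in A, u y) (L • volume)
    (volume.withDensity u) (by
      intro x _ j _ hP _
      rw [withDensity_apply _ (measurableSet_cell o hs j x)]
      exact hP.le)
  calc _ ≤ _ := this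
    _ ≤ (volume.withDensity u) (cell o s k x₀) := measure_mono (fun x hx => hx.1)
    _ = _ := withDensity_apply _ (measurableSet_cell o hs k x₀)

end RPD

namespace RPD
open Set Metric
open scoped ENNReal

/-- Layer cake formula for finite `ℝ≥0∞`-valued functions. -/
lemma layercake {α : Type*} [MeasurableSpace α] (μ : Measure α) (Y : α → ℝ≥0∞)
    (hY : Measurable Y) (hfin : ∀ x, Y x ≠ ∞) {p : ℝ} (hp : 0 < p) :
    ∫⁻ x, Y x ^ p ∂μ = ENNReal.ofReal p *
      ∫⁻ t in Ioi (0 : ℝ), μ {x | ENNReal.ofReal t < Y x} * ENNReal.ofReal (t ^ (p - 1)) := by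
  have := lintegral_rpow_eq_lintegral_meas_lt_mul μ (f := fun x => (Y x).toReal)
    (Filter.Eventually.of_forall fun x => ENNReal.toReal_nonneg) hY.ennreal_toReal.aemeasurable hp
  rw [← (lintegral_congr fun x => ?_ : ∫⁻ x, ENNReal.ofReal ((Y x).toReal ^ p) ∂μ = _), this]
  · congr 1
    refine setLIntegral_congr_fun measurableSet_Ioi fun t ht => ?_
    congr 2
    ext x
    exact (ENNReal.ofReal_lt_iff_lt_toReal (le_of_lt ht) (hfin x)).symm
  · rw [← ENNReal.ofReal_rpow_of_nonneg ENNReal.toReal_nonneg hp.le, ENNReal.ofReal_toReal (hfin x)]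

/-- Volume of a closed sup-norm ball. -/
lemma vol_cb (x : V2) {r : ℝ} (hr : 0 ≤ r) :
    volume (closedBall x r) = ENNReal.ofReal ((2 * r) ^ 2) := by
  rw [Real.volume_pi_closedBall x hr]; simp

/-- The (centred, countable) maximal function. -/
def Mx (r : ℕ → ℝ) (h : V2 → ℝ≥0∞) (x : V2) : ℝ≥0∞ :=
  ⨆ j, (∫⁻ y in closedBall x (r j), h y) / volume (closedBall x (r j))

lemma measurable_lintegral_cb (r : ℝ) (h : V2 → ℝ≥0∞) (hh : Measurable h) :
    Measurable fun x => ∫⁻ y in closedBall x r, h y := by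
  have : ∀ x, ∫⁻ y in closedBall x r, h y =
      ∫⁻ y, ({q : V2 × V2 | dist q.2 q.1 ≤ r}.indicator (fun q => h q.2)) (x, y) := by
    intro x
    rw [← lintegral_indicator measurableSet_closedBall]
    rfl
  simp only [this]
  apply Measurable.lintegral_prod_right'
  apply (hh.comp measurable_snd).indicator
  exact measurableSet_le (measurable_snd.dist measurable_fst) measurable_const

lemma measurable_Mx (r : ℕ → ℝ) (hr : ∀ j, 0 ≤ r j) (h : V2 → ℝ≥0∞) (hh : Measurable h) :
    Measurable (Mx r h) := by
  refine Measurable.iSup fun j => ?_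
  simp only [vol_cb _ (hr j)]
  exact (measurable_lintegral_cb (r j) h hh).div_const _

/-- Weak (1,1) estimate for the maximal function. -/
lemma Mx_weak (r : ℕ → ℝ) (R : ℝ) (hr : ∀ j, 0 < r j) (hR : ∀ j, r j ≤ R) (h : V2 → ℝ≥0∞)
    (t : ℝ≥0∞) : t * volume {x | t < Mx r h x} ≤ 16 * ∫⁻ y, h y := by
  set I : Set (V2 × ℕ) := {q | t * volume (closedBall q.1 (r q.2)) <
    ∫⁻ y in closedBall q.1 (r q.2), h y} with hI
  obtain ⟨u, huI, hdisj, hcov⟩ := Vitali.exists_disjoint_subfamily_covering_enlargement_closedBall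
    I (fun q => q.1) (fun q => r q.2) R (fun a _ => hR _) 4 (by norm_num)
  have hcount : u.Countable := by
    apply hdisj.countable_of_nonempty_interior
    intro q _
    exact ⟨q.1, ball_subset_interior_closedBall (mem_ball_self (hr _))⟩
  have hsub : {x | t < Mx r h x} ⊆ ⋃ b ∈ u, closedBall b.1 (4 * r b.2) := by
    intro x hx
    have hx' : t < Mx r h x := hx
    rw [Mx, lt_iSup_iff] at hx'
    obtain ⟨j, hj⟩ := hx'
    have hq : (x, j) ∈ I := by
      have := (ENNReal.lt_div_iff_mul_lt (Or.inl ?_) (Or.inl ?_)).1 hj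
      · exact this
      · rw [vol_cb _ (hr j).le]; have := hr j; simp; positivity
      · rw [vol_cb _ (hr j).le]; simp
    obtain ⟨b, hb, hsb⟩ := hcov _ hq
    exact mem_biUnion hb (hsb (mem_closedBall_self (hr j).le))
  calc t * volume {x | t < Mx r h x} ≤ t * ∑' b : u, volume (closedBall b.1.1 (4 * r b.1.2)) := by
        gcongr
        exact (measure_mono hsub).trans (measure_biUnion_le _ hcount _)
    _ = 16 * ∑' b : u, t * volume (closedBall b.1.1 (r b.1.2)) := by
        rw [← ENNReal.tsum_mul_left, ← ENNReal.tsum_mul_left]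
        congr 1; ext b
        have := hr b.1.2
        rw [vol_cb _ this.le, vol_cb _ (by positivity), show (2 * (4 * r b.1.2)) ^ 2 =
          16 * (2 * r b.1.2) ^ 2 by ring, ENNReal.ofReal_mul (by norm_num)]
        norm_num
        ring
    _ ≤ 16 * ∑' b : u, ∫⁻ y in closedBall b.1.1 (r b.1.2), h y := by
        gcongr with b
        exact (huI b.2).le
    _ = 16 * ∫⁻ y in ⋃ b ∈ u, closedBall b.1 (r b.2), h y := by
        rw [lintegral_biUnion hcount (fun _ _ => measurableSet_closedBall) hdisj]
    _ ≤ 16 * ∫⁻ y, h y := by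
        gcongr
        exact Measure.restrict_le_self

lemma Mx_split (r : ℕ → ℝ) (hr : ∀ j, 0 < r j) (h : V2 → ℝ≥0∞) (hh : Measurable h) (t : ℝ≥0∞)
    (x : V2) : Mx r h x ≤ Mx r ({y | t < h y}.indicator h) x + t := by
  refine iSup_le fun j => ?_
  have hv0 : volume (closedBall x (r j)) ≠ 0 := by
    rw [vol_cb _ (hr j).le]; have := hr j; simp; positivity
  have hvt : volume (closedBall x (r j)) ≠ ∞ := by rw [vol_cb _ (hr j).le]; simp
  refine le_trans ?_ (add_le_add_left (le_iSup (fun j => (∫⁻ y in closedBall x (r j),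
    {y | t < h y}.indicator h y) / volume (closedBall x (r j))) j) t)
  rw [ENNReal.div_le_iff hv0 hvt, add_mul, ENNReal.div_mul_cancel hv0 hvt, ← setLIntegral_const,
    ← lintegral_add_right _ measurable_const]
  refine lintegral_mono fun y => ?_
  by_cases hy : t < h y
  · rw [indicator_of_mem (by exact hy)]; exact le_self_add
  · exact (not_lt.1 hy).trans le_add_self

/-- Strong `(q,q)` estimate for the maximal function. -/
lemma Mx_strong (r : ℕ → ℝ) (R : ℝ) (hr : ∀ j, 0 < r j) (hR : ∀ j, r j ≤ R) {q : ℝ} (hq : 1 < q)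
    (h : V2 → ℝ≥0∞) (hh : Measurable h) (hfin : ∀ x, h x ≠ ∞) (hMfin : ∀ x, Mx r h x ≠ ∞) :
    ∫⁻ x, Mx r h x ^ q ≤ (2 : ℝ≥0∞) ^ q * (ENNReal.ofReal q * (16 * (ENNReal.ofReal (q - 1))⁻¹)) *
      ∫⁻ x, h x ^ q := by
  have hMm := measurable_Mx r (fun j => (hr j).le) h hh
  have h1 : ∫⁻ x, (Mx r h x / 2) ^ q ≤ ENNReal.ofReal q *
      (16 * (ENNReal.ofReal (q - 1))⁻¹) * ∫⁻ x, h x ^ q := by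
    rw [layercake volume (fun x => Mx r h x / 2) (hMm.div_const _)
      (fun x => ENNReal.div_ne_top (hMfin x) (by norm_num)) (by linarith), mul_assoc]
    gcongr
    set ν := volume.withDensity h with hν
    have h2 : ∫⁻ x, h x ^ q = ∫⁻ x, h x ^ (q - 1) ∂ν := by
      rw [hν, lintegral_withDensity_eq_lintegral_mul _ hh (hh.pow_const _)]
      refine lintegral_congr fun x => ?_
      rw [Pi.mul_apply]
      conv_rhs => rw [← ENNReal.rpow_one (h x)]
      rw [ENNReal.rpow_one, mul_comm]
      by_cases h0 : h x = 0
      · rw [h0, ENNReal.zero_rpow_of_pos (by linarith), mul_zero]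
      · conv_rhs => rw [← ENNReal.rpow_one (h x)]
        conv_rhs => rw [ENNReal.rpow_one]
        conv_rhs => enter [2]; rw [← ENNReal.rpow_one (h x)]
        rw [← ENNReal.rpow_add _ _ h0 (hfin x)]
        congr 1; ring
    rw [h2, layercake ν h hh hfin (by linarith : 0 < q - 1), ← mul_assoc, mul_assoc 16,
      ENNReal.inv_mul_cancel (by simp; linarith) (by simp), mul_one,
      ← lintegral_const_mul' _ _ (by norm_num)]
    refine lintegral_mono_ae ?_
    filter_upwards [ae_restrict_mem measurableSet_Ioi] with t ht
    have ht0 : 0 < t := ht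
    have hsub : {x | ENNReal.ofReal t < Mx r h x / 2} ⊆
        {x | ENNReal.ofReal t < Mx r ({y | ENNReal.ofReal t < h y}.indicator h) x} := by
      intro x hx
      have hx' : ENNReal.ofReal t < Mx r h x / 2 := hx
      rw [ENNReal.lt_div_iff_mul_lt (by simp) (by simp), mul_two] at hx'
      have := hx'.trans_le (Mx_split r hr h hh (ENNReal.ofReal t) x)
      exact lt_of_add_lt_add_right this
    have hw := Mx_weak r R hr hR ({y | ENNReal.ofReal t < h y}.indicator h) (ENNReal.ofReal t)
    rw [lintegral_indicator (measurableSet_lt measurable_const hh),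
      ← withDensity_apply _ (measurableSet_lt measurable_const hh)] at hw
    have e : ENNReal.ofReal (t ^ (q - 1)) = ENNReal.ofReal t * ENNReal.ofReal (t ^ (q - 1 - 1)) := by
      rw [← ENNReal.ofReal_mul ht0.le]
      congr 1
      rw [Real.rpow_sub_one ht0.ne' (q - 1)]
      field_simp
    calc _ ≤ volume {x | ENNReal.ofReal t < Mx r ({y | ENNReal.ofReal t < h y}.indicator h) x} *
          ENNReal.ofReal (t ^ (q - 1)) := by gcongr
      _ = (ENNReal.ofReal t * volume {x | ENNReal.ofReal t <
          Mx r ({y | ENNReal.ofReal t < h y}.indicator h) x}) * ENNReal.ofReal (t ^ (q - 1 - 1)) := by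
          rw [e]; ring
      _ ≤ (16 * ν {y | ENNReal.ofReal t < h y}) * ENNReal.ofReal (t ^ (q - 1 - 1)) := by gcongr
      _ = _ := by ring
  calc ∫⁻ x, Mx r h x ^ q = ∫⁻ x, 2 ^ q * (Mx r h x / 2) ^ q := by
        refine lintegral_congr fun x => ?_
        rw [← ENNReal.mul_rpow_of_nonneg _ _ (by linarith), ENNReal.mul_div_cancel (by simp) (by simp)]
    _ = 2 ^ q * ∫⁻ x, (Mx r h x / 2) ^ q := by
        rw [lintegral_const_mul' _ _ (by simp)]
    _ ≤ _ := by rw [mul_assoc]; gcongr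

end RPD

namespace RPD
open Set Metric
open scoped ENNReal

/-- Dyadic maximal function. -/
def Xd (o : V2) (s : ℝ) (u : V2 → ℝ≥0∞) (x : V2) : ℝ≥0∞ :=
  ⨆ j, (∫⁻ y in cell o s j x, u y) / volume (cell o s j x)

lemma vol_cell_ne_zero (o : V2) {s : ℝ} (hs : 0 < s) (j : ℕ) (x : V2) :
    volume (cell o s j x) ≠ 0 := by
  rw [volume_cell o hs]; simp; positivity

lemma vol_cell_ne_top (o : V2) {s : ℝ} (hs : 0 < s) (j : ℕ) (x : V2) :
    volume (cell o s j x) ≠ ∞ := by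
  rw [volume_cell o hs]; simp

lemma measurable_lab (o : V2) (s : ℝ) (j : ℕ) : Measurable (lab o s j) := by
  refine measurable_pi_iff.2 fun i => ?_
  apply Int.measurable_floor.comp
  fun_prop

lemma measurable_Xd (o : V2) {s : ℝ} (_hs : 0 < s) (u : V2 → ℝ≥0∞) : Measurable (Xd o s u) := by
  refine Measurable.iSup fun j => ?_
  have : (fun x => (∫⁻ y in cell o s j x, u y) / volume (cell o s j x)) =
      (fun a : Fin 2 → ℤ => (∫⁻ y in {y | lab o s j y = a}, u y) / volume {y | lab o s j y = a}) ∘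
        (lab o s j) := rfl
  rw [this]
  exact (measurable_of_countable _).comp (measurable_lab o s j)

lemma lt_Xd_iff (o : V2) {s : ℝ} (hs : 0 < s) (u : V2 → ℝ≥0∞) (L : ℝ≥0∞) (x : V2) :
    L < Xd o s u x ↔ ∃ j, L * volume (cell o s j x) < ∫⁻ y in cell o s j x, u y := by
  rw [Xd, lt_iSup_iff]
  refine exists_congr fun j => ?_
  rw [ENNReal.lt_div_iff_mul_lt (Or.inl (vol_cell_ne_zero o hs j x))
    (Or.inl (vol_cell_ne_top o hs j x))]

lemma vol_cell_succ (o : V2) {s : ℝ} (hs : 0 < s) (j : ℕ) (x : V2) :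
    volume (cell o s j x) = 4 * volume (cell o s (j + 1) x) := by
  rw [volume_cell o hs, volume_cell o hs, show (4 : ℝ≥0∞) = ENNReal.ofReal 4 by norm_num,
    ← ENNReal.ofReal_mul (by norm_num)]
  congr 1
  rw [pow_succ 2 j]; field_simp; norm_num

/-- Good-`λ` inequality. -/
lemma good_lambda (o : V2) {s : ℝ} (hs : 0 < s) (x₀ : V2) (f : V2 → ℂ) (hf : Measurable f)
    (G : V2 → ℝ≥0∞) (c γ : ℝ≥0∞) (hcγ : c * γ ≤ 1) (m₀ : ℂ)
    (hm₀ : ∀ y ∈ cell o s 0 x₀, ∫⁻ z in cell o s 0 x₀, ‖f z - m₀‖ₑ ≤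
      c * G y * volume (cell o s 0 x₀))
    (hosc : ∀ x ∈ cell o s 0 x₀, ∀ j, ∃ m : ℂ, ∀ y ∈ cell o s j x,
      ∫⁻ z in cell o s j x, ‖f z - m‖ₑ ≤ c * G y * volume (cell o s j x))
    (L : ℝ≥0∞) (hL0 : L ≠ 0) (hLt : L ≠ ∞) :
    volume {x ∈ cell o s 0 x₀ | 4 * L < Xd o s (fun z => ‖f z - m₀‖ₑ) x} ≤
      2 * (c * γ) * volume {x ∈ cell o s 0 x₀ | L < Xd o s (fun z => ‖f z - m₀‖ₑ) x} +
        volume {x ∈ cell o s 0 x₀ | γ * L < G x} := by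
  set u : V2 → ℝ≥0∞ := fun z => ‖f z - m₀‖ₑ with hu
  set E4 := {x ∈ cell o s 0 x₀ | 4 * L < Xd o s u x} with hE4
  set E1 := {x ∈ cell o s 0 x₀ | L < Xd o s u x} with hE1
  set T := {x | G x ≤ γ * L} with hT
  have hE1' : E1 = {x ∈ cell o s 0 x₀ | ∃ j, 0 ≤ j ∧
      L * volume (cell o s j x) < ∫⁻ y in cell o s j x, u y} := by
    ext x
    simp only [hE1, mem_ofPred_eq, lt_Xd_iff o hs, zero_le, true_and]
  have hE4m : MeasurableSet E4 :=
    (measurableSet_cell o hs 0 x₀).inter (measurableSet_lt measurable_const (measurable_Xd o hs u))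
  have hcγL : c * (γ * L) ≤ L := by
    rw [← mul_assoc]; exact mul_le_of_le_one_left' hcγ
  have main : volume (E4 ∩ T) ≤ 2 * (c * γ) * volume E1 := by
    have hst := stopping o hs 0 x₀ (fun A => L * volume A < ∫⁻ y in A, u y)
      (volume.restrict (toMeasurable volume (E4 ∩ T))) ((2 * (c * γ)) • volume) ?_
    · rw [← hE1'] at hst
      calc volume (E4 ∩ T) ≤ (volume.restrict (toMeasurable volume (E4 ∩ T))) E1 := by
            rw [Measure.restrict_apply' (measurableSet_toMeasurable _ _)]
            apply measure_mono
            intro x hx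
            refine ⟨⟨hx.1.1, ?_⟩, subset_toMeasurable _ _ hx⟩
            have h4 := hx.1.2
            refine lt_of_le_of_lt ?_ h4
            exact le_mul_of_one_le_left' (by norm_num)
        _ ≤ _ := hst
    · intro x hx j _ hP hmin
      rw [Measure.restrict_apply (measurableSet_cell o hs j x), Set.inter_comm,
        Measure.measure_toMeasurable_inter_of_sFinite (measurableSet_cell o hs j x),
        Measure.smul_apply, smul_eq_mul]
      by_cases hne : (E4 ∩ T ∩ cell o s j x) = ∅
      · rw [hne]; simp
      obtain ⟨y, ⟨hyE, hyT⟩, hyc⟩ := nonempty_iff_ne_empty.2 hne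
      have hyT' : G y ≤ γ * L := hyT
      cases j with
      | zero =>
        exfalso
        have hcx : cell o s 0 x = cell o s 0 x₀ := cell_eq_of_mem hx
        rw [hcx] at hP hyc
        have := hm₀ y hyc
        have h2 : c * G y * volume (cell o s 0 x₀) ≤ L * volume (cell o s 0 x₀) := by
          gcongr
          exact (mul_le_mul_right hyT' c).trans hcγL
        exact absurd (hP.trans_le (this.trans h2)) (lt_irrefl _)
      | succ i =>
        obtain ⟨m, hm⟩ := hosc x hx i
        have hyp := cell_anti o s (Nat.le_succ i) x hyc
        have hmy := hm y hyp
        have hnot := hmin i (Nat.zero_le _) (Nat.lt_succ_self i)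
        rw [not_lt] at hnot
        have hv0 := vol_cell_ne_zero o hs i x
        have hvt := vol_cell_ne_top o hs i x
        have hmy1 : ∫⁻ z in cell o s i x, ‖f z - m‖ₑ ≤ c * (γ * L) * volume (cell o s i x) :=
          hmy.trans (by gcongr)
        have hmm : ‖m - m₀‖ₑ ≤ 2 * L := by
          have : ‖m - m₀‖ₑ * volume (cell o s i x) ≤ (2 * L) * volume (cell o s i x) := by
            calc ‖m - m₀‖ₑ * volume (cell o s i x) = ∫⁻ z in cell o s i x, ‖m - m₀‖ₑ := by
                  rw [setLIntegral_const]
              _ ≤ ∫⁻ z in cell o s i x, (‖f z - m‖ₑ + u z) := by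
                  refine lintegral_mono fun z => ?_
                  have : m - m₀ = (f z - m₀) - (f z - m) := by ring
                  rw [this, add_comm]
                  exact enorm_sub_le
              _ = (∫⁻ z in cell o s i x, ‖f z - m‖ₑ) + ∫⁻ z in cell o s i x, u z :=
                  lintegral_add_left (hf.sub_const m).enorm _
              _ ≤ L * volume (cell o s i x) + L * volume (cell o s i x) := by
                  refine add_le_add (hmy1.trans ?_) hnot
                  gcongr
              _ = _ := by ring
          exact (ENNReal.mul_le_mul_iff_left hv0 hvt).1 this
        have hsub : E4 ∩ T ∩ cell o s (i + 1) x ⊆ {z ∈ cell o s (i + 1) x | ∃ k, i + 1 ≤ k ∧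
            (2 * L) * volume (cell o s k z) < ∫⁻ y in cell o s k z, ‖f y - m‖ₑ} := by
          rintro z ⟨⟨hzE, -⟩, hzc⟩
          refine ⟨hzc, ?_⟩
          obtain ⟨k, hk⟩ := (lt_Xd_iff o hs u (4 * L) z).1 hzE.2
          have hkt := vol_cell_ne_top o hs k z
          have hk1 : L * volume (cell o s k z) < ∫⁻ y in cell o s k z, u y := by
            refine lt_of_le_of_lt ?_ hk
            gcongr
            exact le_mul_of_one_le_left' (by norm_num)
          refine ⟨k, ?_, ?_⟩
          · by_contra hlt
            push Not at hlt
            have hcz : cell o s k z = cell o s k x :=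
              cell_eq_of_mem (cell_anti o s hlt.le x hzc)
            rw [hcz] at hk1
            exact hmin k (Nat.zero_le _) hlt hk1
          · have h5 : ∫⁻ y in cell o s k z, u y ≤
                (∫⁻ y in cell o s k z, ‖f y - m‖ₑ) + 2 * L * volume (cell o s k z) := by
              calc ∫⁻ y in cell o s k z, u y ≤ ∫⁻ y in cell o s k z, (‖f y - m‖ₑ + ‖m - m₀‖ₑ) := by
                    refine lintegral_mono fun y => ?_
                    have : f y - m₀ = (f y - m) + (m - m₀) := by ring
                    simp only [hu]
                    rw [this]
                    exact enorm_add_le _ _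
                _ = (∫⁻ y in cell o s k z, ‖f y - m‖ₑ) + ‖m - m₀‖ₑ * volume (cell o s k z) := by
                    rw [lintegral_add_right _ measurable_const, setLIntegral_const]
                _ ≤ _ := by gcongr
            have h6 := hk.trans_le h5
            rw [show 4 * L * volume (cell o s k z) = 2 * L * volume (cell o s k z) +
              2 * L * volume (cell o s k z) by ring] at h6
            exact lt_of_add_lt_add_right h6
        have hweak := dyadic_weak o hs (i + 1) x (fun y => ‖f y - m‖ₑ) (2 * L)
        have h7 : (2 * L) * volume (E4 ∩ T ∩ cell o s (i + 1) x) ≤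
            (2 * L) * (2 * (c * γ) * volume (cell o s (i + 1) x)) := by
          calc (2 * L) * volume (E4 ∩ T ∩ cell o s (i + 1) x)
              ≤ ∫⁻ y in cell o s (i + 1) x, ‖f y - m‖ₑ := (by gcongr : _ ≤ _).trans hweak
            _ ≤ ∫⁻ y in cell o s i x, ‖f y - m‖ₑ :=
                lintegral_mono_set (cell_anti o s (Nat.le_succ i) x)
            _ ≤ c * (γ * L) * volume (cell o s i x) := hmy1
            _ = _ := by rw [vol_cell_succ o hs i x]; ring
        exact (ENNReal.mul_le_mul_iff_right (by simpa using hL0)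
          (ENNReal.mul_ne_top (by simp) hLt)).1 h7
  calc volume E4 ≤ volume (E4 ∩ T) + volume (E4 \ T) := measure_le_inter_add_sdiff _ _ _
    _ ≤ _ := by
      gcongr
      rintro x ⟨hx, hxT⟩
      exact ⟨hx.1, not_le.1 hxT⟩

lemma le_Xd (o : V2) {s : ℝ} (hs : 0 < s) (u : V2 → ℝ≥0∞) (x : V2) (hu : ContinuousAt u x) :
    u x ≤ Xd o s u x := by
  refine le_of_forall_lt fun a ha => ?_
  obtain ⟨b, hab, hb⟩ := exists_between ha
  have h1 : ∀ᶠ y in 𝓝 x, b < u y := hu.eventually (lt_mem_nhds hb)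
  obtain ⟨ε, hε, hball⟩ := Metric.eventually_nhds_iff_ball.1 h1
  obtain ⟨j, hj⟩ : ∃ j : ℕ, s / 2 ^ j < ε := by
    obtain ⟨j, hj⟩ := pow_unbounded_of_one_lt (s / ε) (by norm_num : (1 : ℝ) < 2)
    refine ⟨j, ?_⟩
    rw [div_lt_iff₀ (by positivity)]
    rw [div_lt_iff₀ hε] at hj
    linarith
  refine hab.trans_le (le_trans ?_ (le_iSup _ j))
  rw [ENNReal.le_div_iff_mul_le (Or.inl (vol_cell_ne_zero o hs j x))
    (Or.inl (vol_cell_ne_top o hs j x)), ← setLIntegral_const]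
  refine setLIntegral_mono' (measurableSet_cell o hs j x) fun y hy => (hball y ?_).le
  exact (mem_closedBall.1 (cell_subset_closedBall o hs j x hy)).trans_lt hj

/-- Dyadic Fefferman–Stein type inequality. -/
lemma fefferman_stein {p : ℝ} (hp : 0 < p) (c : ℝ≥0∞) (hct : c ≠ ∞) :
    ∃ C : ℝ≥0∞, C ≠ ∞ ∧ ∀ (o : V2) (s : ℝ) (x₀ : V2) (f : V2 → ℂ)
    (G : V2 → ℝ≥0∞) (m₀ : ℂ), 0 < s → Measurable f → Measurable G → (∀ x, G x ≠ ∞) →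
    (∃ K : ℝ, ∀ x, ‖f x‖ ≤ K) → (∀ x ∈ cell o s 0 x₀, ContinuousAt f x) →
    (∀ y ∈ cell o s 0 x₀, ∫⁻ z in cell o s 0 x₀, ‖f z - m₀‖ₑ ≤
      c * G y * volume (cell o s 0 x₀)) →
    (∀ x ∈ cell o s 0 x₀, ∀ j, ∃ m : ℂ, ∀ y ∈ cell o s j x,
      ∫⁻ z in cell o s j x, ‖f z - m‖ₑ ≤ c * G y * volume (cell o s j x)) →
    ∫⁻ x in cell o s 0 x₀, ‖f x - m₀‖ₑ ^ p ≤ C * ∫⁻ x in cell o s 0 x₀, G x ^ p := by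
  -- choose γ
  set η : ℝ≥0∞ := ((4 : ℝ≥0∞) ^ p)⁻¹ / 2 with hη
  have h4p0 : (4 : ℝ≥0∞) ^ p ≠ 0 := by simp
  have h4pt : (4 : ℝ≥0∞) ^ p ≠ ∞ := by simp
  have hη0 : η ≠ 0 := by simp [hη, hp.le]
  have hηt : η ≠ ∞ := by
    rw [hη]; exact ENNReal.div_ne_top (ENNReal.inv_ne_top.2 h4p0) (by simp)
  have hη1 : η ≤ 1 := by
    rw [hη]
    refine ENNReal.div_le_of_le_mul ?_
    rw [one_mul]
    refine (ENNReal.inv_le_one.2 (ENNReal.one_le_rpow (by norm_num) hp)).trans (by norm_num)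
  set γ : ℝ≥0∞ := η / (2 * (c + 1)) with hγ
  have hc1 : 2 * (c + 1) ≠ 0 := by simp
  have hc1t : 2 * (c + 1) ≠ ∞ := ENNReal.mul_ne_top (by simp) (by simp [hct])
  have hγ0 : γ ≠ 0 := by rw [hγ]; exact ENNReal.div_ne_zero.2 ⟨hη0, hc1t⟩
  have hγt : γ ≠ ∞ := ENNReal.div_ne_top hηt hc1
  have h2cγ : 2 * (c * γ) ≤ η := by
    calc 2 * (c * γ) ≤ (2 * (c + 1)) * γ := by rw [mul_assoc]; gcongr; exact le_self_add
      _ = η := by rw [hγ, ENNReal.mul_div_cancel hc1 hc1t]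
  have hcγ : c * γ ≤ 1 := by
    refine le_trans ?_ (h2cγ.trans hη1)
    exact le_mul_of_one_le_left' (by norm_num)
  refine ⟨η⁻¹ * γ⁻¹ ^ p, ENNReal.mul_ne_top (ENNReal.inv_ne_top.2 hη0)
    (ENNReal.rpow_ne_top_of_nonneg hp.le (ENNReal.inv_ne_top.2 hγ0)), ?_⟩
  intro o s x₀ f G m₀ hs hf hG hGfin ⟨K, hK⟩ hcont hm₀ hosc
  set u : V2 → ℝ≥0∞ := fun z => ‖f z - m₀‖ₑ with hu
  set Q := cell o s 0 x₀ with hQ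
  set X := Xd o s u with hX
  have hXm : Measurable X := measurable_Xd o hs u
  have hub : ∀ z, u z ≤ ENNReal.ofReal (K + ‖m₀‖) := by
    intro z
    rw [hu]; simp only
    rw [← ofReal_norm]
    exact ENNReal.ofReal_le_ofReal ((norm_sub_le _ _).trans (by gcongr; exact hK z))
  have hXb : ∀ x, X x ≤ ENNReal.ofReal (K + ‖m₀‖) := by
    intro x
    refine iSup_le fun j => ?_
    rw [ENNReal.div_le_iff (vol_cell_ne_zero o hs j x) (vol_cell_ne_top o hs j x),
      ← setLIntegral_const]
    exact lintegral_mono fun z => hub z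
  have hXfin : ∀ x, X x ≠ ∞ := fun x => ne_top_of_le_ne_top ENNReal.ofReal_ne_top (hXb x)
  have hQm : MeasurableSet Q := measurableSet_cell o hs 0 x₀
  have key : ∫⁻ x in Q, (X x / 4) ^ p ≤
      (η * ∫⁻ x in Q, X x ^ p) + ∫⁻ x in Q, (G x / γ) ^ p := by
    rw [layercake (volume.restrict Q) (fun x => X x / 4) (hXm.div_const _)
      (fun x => ENNReal.div_ne_top (hXfin x) (by norm_num)) hp,
      layercake (volume.restrict Q) X hXm hXfin hp,
      layercake (volume.restrict Q) (fun x => G x / γ) (hG.div_const _)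
      (fun x => ENNReal.div_ne_top (hGfin x) hγ0) hp]
    rw [mul_left_comm, ← mul_add]
    gcongr
    rw [← lintegral_const_mul' _ _ hηt]
    have hmeas : Measurable fun t : ℝ => (volume.restrict Q) {x | ENNReal.ofReal t < G x / γ} *
        ENNReal.ofReal (t ^ (p - 1)) := by
      refine Measurable.mul ?_ (by fun_prop)
      refine Antitone.measurable fun a b hab => measure_mono fun x hx => ?_
      exact (ENNReal.ofReal_le_ofReal hab).trans_lt hx
    rw [← lintegral_add_right _ hmeas]
    refine lintegral_mono_ae ?_
    filter_upwards [ae_restrict_mem measurableSet_Ioi] with t ht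
    have ht0 : 0 < t := ht
    rw [← mul_assoc, ← add_mul]
    gcongr
    have := good_lambda o hs x₀ f hf G c γ hcγ m₀ hm₀ hosc (ENNReal.ofReal t)
      (by simpa using ht0) (by simp)
    rw [Measure.restrict_apply' hQm, Measure.restrict_apply' hQm, Measure.restrict_apply' hQm]
    have e1 : {x | ENNReal.ofReal t < X x / 4} ∩ Q = {x ∈ Q | 4 * ENNReal.ofReal t < X x} := by
      ext x
      simp only [mem_inter_iff, mem_ofPred_eq]
      rw [ENNReal.lt_div_iff_mul_lt (by simp) (by simp), mul_comm, and_comm]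
    have e2 : {x | ENNReal.ofReal t < X x} ∩ Q = {x ∈ Q | ENNReal.ofReal t < X x} := by
      ext x; simp only [mem_inter_iff, mem_ofPred_eq, and_comm]
    have e3 : {x | ENNReal.ofReal t < G x / γ} ∩ Q = {x ∈ Q | γ * ENNReal.ofReal t < G x} := by
      ext x
      simp only [mem_inter_iff, mem_ofPred_eq]
      rw [ENNReal.lt_div_iff_mul_lt (by simp [hγ0]) (by simp [hγt]), mul_comm, and_comm]
    rw [e1, e2, e3]
    refine this.trans ?_
    gcongr
  have hIfin : ∫⁻ x in Q, X x ^ p ≠ ∞ := by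
    refine ne_top_of_le_ne_top ?_ (setLIntegral_mono' hQm (g := fun _ =>
      ENNReal.ofReal (K + ‖m₀‖) ^ p) fun x _ => by gcongr; exact hXb x)
    rw [setLIntegral_const]
    exact ENNReal.mul_ne_top (by simp [hp.le]) (vol_cell_ne_top o hs 0 x₀)
  have e4 : ∫⁻ x in Q, (X x / 4) ^ p = 2 * η * ∫⁻ x in Q, X x ^ p := by
    rw [← lintegral_const_mul' _ _ (ENNReal.mul_ne_top (by simp) hηt)]
    refine lintegral_congr fun x => ?_
    rw [ENNReal.div_rpow_of_nonneg _ _ hp.le, hη, ENNReal.mul_div_cancel (by simp) (by simp),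
      div_eq_mul_inv, mul_comm]
  have e5 : ∫⁻ x in Q, (G x / γ) ^ p = γ⁻¹ ^ p * ∫⁻ x in Q, G x ^ p := by
    rw [← lintegral_const_mul' _ _ (ENNReal.rpow_ne_top_of_nonneg hp.le (ENNReal.inv_ne_top.2 hγ0))]
    refine lintegral_congr fun x => ?_
    rw [div_eq_mul_inv, ENNReal.mul_rpow_of_nonneg _ _ hp.le, mul_comm]
  rw [e4, e5, two_mul, add_mul] at key
  have key2 : η * ∫⁻ x in Q, X x ^ p ≤ γ⁻¹ ^ p * ∫⁻ x in Q, G x ^ p :=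
    (ENNReal.add_le_add_iff_left (ENNReal.mul_ne_top hηt hIfin)).1 key
  calc ∫⁻ x in Q, u x ^ p ≤ ∫⁻ x in Q, X x ^ p := by
        refine setLIntegral_mono' hQm fun x hx => ?_
        gcongr
        refine le_Xd o hs u x ?_
        exact ((hcont x hx).sub continuousAt_const).enorm
    _ = η⁻¹ * (η * ∫⁻ x in Q, X x ^ p) := by
        rw [← mul_assoc, ENNReal.inv_mul_cancel hη0 hηt, one_mul]
    _ ≤ η⁻¹ * (γ⁻¹ ^ p * ∫⁻ x in Q, G x ^ p) := by gcongr
    _ = _ := by rw [mul_assoc]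

end RPD

namespace RPD
open Set Metric
open scoped ENNReal

/-- Admissible pairs. -/
structure Adm (Λ : ℝ) (C₁ : ℝ≥0∞) (Ω : Set V2) (f : V2 → ℂ) (d : V2 → ℝ≥0∞) : Prop where
  mf : Measurable f
  bf : ∃ K : ℝ, ∀ x, ‖f x‖ ≤ K
  cf : ContinuousOn f Ω
  md : Measurable d
  bd : ∃ K : ℝ≥0∞, K ≠ ∞ ∧ ∀ x, d x ≤ K
  osc : ∀ x r, 0 < r → closedBall x (Λ * r) ⊆ Ω → ∃ m : ℂ, ‖m‖ = 1 ∧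
    ∫⁻ z in closedBall x r, ‖f z - m‖ₑ ^ (2 : ℝ) ≤
      C₁ * ∫⁻ z in closedBall x (Λ * r), d z ^ (2 : ℝ)

lemma cauchy_schwarz {α : Type*} [MeasurableSpace α] (μ : Measure α) (u : α → ℝ≥0∞)
    (hu : Measurable u) :
    ∫⁻ x, u x ∂μ ≤ (∫⁻ x, u x ^ (2 : ℝ) ∂μ) ^ (1 / 2 : ℝ) * (μ univ) ^ (1 / 2 : ℝ) := by
  have := ENNReal.lintegral_mul_le_Lp_mul_Lq μ (p := 2) (q := 2)
    (by constructor <;> norm_num) hu.aemeasurable (aemeasurable_const (b := (1 : ℝ≥0∞)))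
  simpa using this

lemma Mx_bound (r : ℕ → ℝ) (h : V2 → ℝ≥0∞) (K : ℝ≥0∞) (hK : ∀ x, h x ≤ K)
    (x : V2) : Mx r h x ≤ K := by
  refine iSup_le fun j => ?_
  refine ENNReal.div_le_of_le_mul ?_
  rw [← setLIntegral_const]
  exact lintegral_mono fun y => hK y

/-- Interior `L^p` oscillation estimate. -/
lemma interior_Lp {p : ℝ} (hp : 2 ≤ p) {Λ : ℝ} (hΛ : 1 ≤ Λ) {C₁ : ℝ≥0∞} (hC₁ : C₁ ≠ ∞) :
    ∃ C : ℝ≥0∞, C ≠ ∞ ∧ ∀ (Ω : Set V2) (f : V2 → ℂ) (d : V2 → ℝ≥0∞), IsOpen Ω →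
      Adm Λ C₁ Ω f d → ∀ x r, 0 < r → closedBall x ((8 * Λ + 4) * r) ⊆ Ω → ∃ m : ℂ, ‖m‖ = 1 ∧
    ∫⁻ z in closedBall x r, ‖f z - m‖ₑ ^ p ≤
      C * ∫⁻ z in closedBall x ((8 * Λ + 4) * r), d z ^ p := by
  rcases hp.eq_or_lt with rfl | hp2
  · refine ⟨C₁, hC₁, fun Ω f d _ hA x r hr hsub => ?_⟩
    have hss : closedBall x (Λ * r) ⊆ closedBall x ((8 * Λ + 4) * r) :=
      closedBall_subset_closedBall (by nlinarith)
    obtain ⟨m, hm, h⟩ := hA.osc x r hr (hss.trans hsub)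
    refine ⟨m, hm, h.trans ?_⟩
    gcongr
  have hp0 : 0 < p := by linarith
  set c : ℝ≥0∞ := (C₁ * ENNReal.ofReal (4 * (Λ + 1) ^ 2)) ^ (1 / 2 : ℝ) with hc
  have hct : c ≠ ∞ := ENNReal.rpow_ne_top_of_nonneg (by norm_num)
    (ENNReal.mul_ne_top hC₁ ENNReal.ofReal_ne_top)
  obtain ⟨C, hC, hFS⟩ := fefferman_stein hp0 c hct
  set q := p / 2 with hq
  have hq1 : 1 < q := by rw [hq]; linarith
  refine ⟨C * ((2 : ℝ≥0∞) ^ q * (ENNReal.ofReal q * (16 * (ENNReal.ofReal (q - 1))⁻¹))), ?_, ?_⟩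
  · refine ENNReal.mul_ne_top hC (ENNReal.mul_ne_top ?_ (ENNReal.mul_ne_top ENNReal.ofReal_ne_top
      (ENNReal.mul_ne_top (by simp) ?_)))
    · exact ENNReal.rpow_ne_top_of_nonneg (by linarith) (by simp)
    · simpa using hq1
  intro Ω f d hΩ hA x r hr hsub
  set B := closedBall x ((8 * Λ + 4) * r) with hB
  set s := 4 * r with hs
  have hs0 : 0 < s := by positivity
  set o : V2 := fun i => x i - 2 * r with ho
  set h : V2 → ℝ≥0∞ := B.indicator (fun z => d z ^ (2 : ℝ)) with hh
  set ρ : ℕ → ℝ := fun j => (Λ + 1) * (s / 2 ^ j) with hρ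
  have hρ0 : ∀ j, 0 < ρ j := fun j => by simp only [hρ]; positivity
  have hρR : ∀ j, ρ j ≤ (Λ + 1) * s := fun j => by
    simp only [hρ]
    gcongr
    exact div_le_self hs0.le (one_le_pow₀ (by norm_num))
  have hhm : Measurable h := (hA.md.pow_const _).indicator measurableSet_closedBall
  obtain ⟨K, hK, hdK⟩ := hA.bd
  have hhb : ∀ z, h z ≤ K ^ (2 : ℝ) := by
    intro z
    refine (indicator_le_self _ _ z).trans ?_
    gcongr
    exact hdK z
  have hKt : K ^ (2 : ℝ) ≠ ∞ := ENNReal.rpow_ne_top_of_nonneg (by norm_num) hK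
  have hMb := Mx_bound ρ h _ hhb
  set G : V2 → ℝ≥0∞ := fun z => Mx ρ h z ^ (1 / 2 : ℝ) with hG
  have hcell : cell o s 0 x = univ.pi fun i => Ico (x i - 2 * r) (x i + 2 * r) := by
    have hl : ∀ i, lab o s 0 x i = 0 := by
      intro i
      simp only [lab, ho, hs, pow_zero, mul_one]
      rw [show (x i - (x i - 2 * r)) / (4 * r) = 1 / 2 by field_simp; ring]
      norm_num
    rw [cell_eq_pi o hs0]
    simp only [hl]
    congr 1
    ext i
    simp [ho, hs]
    intros
    constructor <;> intro <;> linarith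
  have hball_cell : closedBall x r ⊆ cell o s 0 x := by
    intro y hy
    rw [hcell]
    intro i _
    have h1 := (dist_le_pi_dist y x i).trans (mem_closedBall.1 hy)
    rw [Real.dist_eq, abs_le] at h1
    constructor <;> linarith
  have hcell_ball : cell o s 0 x ⊆ closedBall x (2 * r) := by
    intro y hy
    rw [hcell] at hy
    rw [mem_closedBall, dist_pi_le_iff (by positivity)]
    intro i
    have := hy i (mem_univ _)
    rw [mem_Ico] at this
    rw [Real.dist_eq, abs_le]
    constructor <;> linarith
  have hsj : ∀ j : ℕ, 0 < s / 2 ^ j ∧ s / 2 ^ j ≤ s := fun j =>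
    ⟨by positivity, div_le_self hs0.le (one_le_pow₀ (by norm_num))⟩
  have hosc : ∀ z ∈ cell o s 0 x, ∀ j, ∃ m : ℂ, ‖m‖ = 1 ∧ ∀ y ∈ cell o s j z,
      ∫⁻ z in cell o s j z, ‖f z - m‖ₑ ≤ c * G y * volume (cell o s j z) := by
    intro z hz j
    have hzd := mem_closedBall.1 (hcell_ball hz)
    obtain ⟨hsj0, hsj1⟩ := hsj j
    have hsB : closedBall z (Λ * (s / 2 ^ j)) ⊆ B := by
      apply closedBall_subset_closedBall'
      have : Λ * (s / 2 ^ j) ≤ Λ * s := by gcongr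
      nlinarith
    obtain ⟨m, hm, hm2⟩ := hA.osc z (s / 2 ^ j) hsj0 (hsB.trans hsub)
    refine ⟨m, hm, fun y hy => ?_⟩
    have hyd := mem_closedBall.1 (cell_subset_closedBall o hs0 j z hy)
    have hb1 : ∫⁻ z in closedBall z (Λ * (s / 2 ^ j)), d z ^ (2 : ℝ) ≤
        Mx ρ h y * (ENNReal.ofReal (4 * (Λ + 1) ^ 2) * volume (cell o s j z)) := by
      calc ∫⁻ z in closedBall z (Λ * (s / 2 ^ j)), d z ^ (2 : ℝ)
          = ∫⁻ z in closedBall z (Λ * (s / 2 ^ j)), h z := by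
            refine setLIntegral_congr_fun measurableSet_closedBall fun w hw => ?_
            simp only [hh]
            rw [indicator_of_mem (hsB hw)]
        _ ≤ ∫⁻ z in closedBall y (ρ j), h z := by
            refine lintegral_mono_set ?_
            apply closedBall_subset_closedBall'
            rw [dist_comm]
            simp only [hρ]; linarith
        _ ≤ Mx ρ h y * volume (closedBall y (ρ j)) := by
            rw [← ENNReal.div_le_iff]
            · exact le_iSup (fun j => (∫⁻ z in closedBall y (ρ j), h z) /
                volume (closedBall y (ρ j))) j
            · rw [vol_cb _ (hρ0 j).le]
              have := hρ0 j
              simp; positivity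
            · rw [vol_cb _ (hρ0 j).le]; simp
        _ = _ := by
            rw [vol_cb _ (hρ0 j).le, volume_cell o hs0, ← ENNReal.ofReal_mul (by positivity)]
            congr 2
            simp only [hρ]; ring
    calc ∫⁻ z in cell o s j z, ‖f z - m‖ₑ
        ≤ (∫⁻ w in cell o s j z, ‖f w - m‖ₑ ^ (2 : ℝ)) ^ (1 / 2 : ℝ) *
          (volume (cell o s j z)) ^ (1 / 2 : ℝ) := by
          have := cauchy_schwarz (volume.restrict (cell o s j z)) (fun w => ‖f w - m‖ₑ)
            (hA.mf.sub_const m).enorm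
          simpa using this
      _ ≤ (C₁ * (Mx ρ h y * (ENNReal.ofReal (4 * (Λ + 1) ^ 2) * volume (cell o s j z)))) ^
          (1 / 2 : ℝ) * (volume (cell o s j z)) ^ (1 / 2 : ℝ) := by
          gcongr
          refine le_trans (lintegral_mono_set (cell_subset_closedBall o hs0 j z)) (hm2.trans ?_)
          gcongr
      _ = c * G y * volume (cell o s j z) := by
          rw [show C₁ * (Mx ρ h y * (ENNReal.ofReal (4 * (Λ + 1) ^ 2) * volume (cell o s j z))) =
            (C₁ * ENNReal.ofReal (4 * (Λ + 1) ^ 2)) * Mx ρ h y * volume (cell o s j z) by ring,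
            ENNReal.mul_rpow_of_nonneg _ _ (by norm_num), ENNReal.mul_rpow_of_nonneg _ _ (by norm_num),
            mul_assoc, ← ENNReal.rpow_add_of_nonneg _ _ (by norm_num) (by norm_num)]
          rw [show (1 / 2 + 1 / 2 : ℝ) = 1 by norm_num, ENNReal.rpow_one]
  obtain ⟨m₀, hm₀, hm₀'⟩ := hosc x (mem_cell_self o s 0 x) 0
  refine ⟨m₀, hm₀, ?_⟩
  have hfs := hFS o s x f G m₀ hs0 hA.mf
    ((measurable_Mx ρ (fun j => (hρ0 j).le) h hhm).pow_const _)
    (fun z => ENNReal.rpow_ne_top_of_nonneg (by norm_num) (ne_top_of_le_ne_top hKt (hMb z)))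
    hA.bf (fun z hz => hA.cf.continuousAt (hΩ.mem_nhds (hsub
      (closedBall_subset_closedBall (by nlinarith) (hcell_ball hz))))) hm₀'
    (fun z hz j => let ⟨m, _, hm⟩ := hosc z hz j; ⟨m, hm⟩)
  calc ∫⁻ z in closedBall x r, ‖f z - m₀‖ₑ ^ p ≤ ∫⁻ z in cell o s 0 x, ‖f z - m₀‖ₑ ^ p :=
        lintegral_mono_set hball_cell
    _ ≤ C * ∫⁻ z in cell o s 0 x, G z ^ p := hfs
    _ ≤ C * ∫⁻ z, Mx ρ h z ^ q := by
        refine mul_le_mul' le_rfl ?_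
        refine le_trans (setLIntegral_le_lintegral _ _) (le_of_eq (lintegral_congr fun z => ?_))
        simp only [hG]
        rw [← ENNReal.rpow_mul]
        congr 1
        rw [hq]; ring
    _ ≤ C * (_ * ∫⁻ z, h z ^ q) := by
        gcongr
        exact Mx_strong ρ _ hρ0 hρR hq1 h hhm (fun z => ne_top_of_le_ne_top hKt (hhb z))
          (fun z => ne_top_of_le_ne_top hKt (hMb z))
    _ = _ := by
        rw [← mul_assoc]
        congr 1
        rw [← lintegral_indicator measurableSet_closedBall]
        refine lintegral_congr fun z => ?_
        simp only [hh]
        by_cases hz : z ∈ B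
        · rw [indicator_of_mem hz, indicator_of_mem hz, ← ENNReal.rpow_mul]
          congr 1
          rw [hq]; ring
        · rw [indicator_of_notMem hz, indicator_of_notMem hz, ENNReal.zero_rpow_of_pos (by linarith)]

end RPD

namespace RPD
open Set Metric
open scoped ENNReal

/-- Admissible pairs at exponent `p`. -/
structure AdmP (p Λ : ℝ) (C₂ : ℝ≥0∞) (Ω : Set V2) (f : V2 → ℂ) (d : V2 → ℝ≥0∞) : Prop where
  mf : Measurable f
  bf : ∃ K : ℝ, ∀ x, ‖f x‖ ≤ K
  md : Measurable d
  osc : ∀ x r, 0 < r → closedBall x (Λ * r) ⊆ Ω → ∃ m : ℂ, ‖m‖ = 1 ∧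
    ∫⁻ z in closedBall x r, ‖f z - m‖ₑ ^ p ≤ C₂ * ∫⁻ z in closedBall x (Λ * r), d z ^ p

lemma tri_p {p : ℝ} (hp : 1 ≤ p) (a b c : ℂ) :
    ‖a - b‖ₑ ^ p ≤ (2 : ℝ≥0∞) ^ (p - 1) * (‖a - c‖ₑ ^ p + ‖b - c‖ₑ ^ p) := by
  refine le_trans ?_ (ENNReal.rpow_add_le_mul_rpow_add_rpow _ _ hp)
  gcongr
  have : a - b = (a - c) - (b - c) := by ring
  rw [this]; exact enorm_sub_le

/-- The triple set used in the averaging argument. -/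
def trip (W : Set V2) (D : V2 → ℝ) (κ : ℝ) : Set (V2 × V2 × V2) :=
  {q | q.1 ∈ W ∧ dist q.2.1 q.1 ≤ κ * D q.1 ∧ dist q.2.2 q.1 ≤ κ * D q.1}

/-- The kernel. -/
def Kf (p : ℝ) (W : Set V2) (D : V2 → ℝ) (κ : ℝ) (f : V2 → ℂ) (q : V2 × V2 × V2) : ℝ≥0∞ :=
  (trip W D κ).indicator
    (fun q => (ENNReal.ofReal (D q.1) ^ 4)⁻¹ * ‖f q.2.1 - f q.2.2‖ₑ ^ p) q

def FF (p : ℝ) (W : Set V2) (D : V2 → ℝ) (κ : ℝ) (f : V2 → ℂ) (x : V2) : ℝ≥0∞ :=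
  ∫⁻ z, ∫⁻ y, Kf p W D κ f (z, x, y)

lemma measurableSet_trip {W : Set V2} (hW : MeasurableSet W) {D : V2 → ℝ} (hD : Measurable D)
    (κ : ℝ) : MeasurableSet (trip W D κ) := by
  refine MeasurableSet.inter (measurable_fst hW) (MeasurableSet.inter
    (s₁ := {q : V2 × V2 × V2 | dist q.2.1 q.1 ≤ κ * D q.1})
    (s₂ := {q : V2 × V2 × V2 | dist q.2.2 q.1 ≤ κ * D q.1}) ?_ ?_)
  · exact measurableSet_le (by fun_prop) (by fun_prop)
  · exact measurableSet_le (by fun_prop) (by fun_prop)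

lemma measurable_Kf (p : ℝ) {W : Set V2} (hW : MeasurableSet W) {D : V2 → ℝ} (hD : Measurable D)
    (κ : ℝ) {f : V2 → ℂ} (hf : Measurable f) : Measurable (Kf p W D κ f) := by
  refine Measurable.indicator ?_ (measurableSet_trip hW hD κ)
  have h1 : Measurable fun q : V2 × V2 × V2 => ‖f q.2.1 - f q.2.2‖ₑ :=
    (Measurable.sub (hf.comp (by fun_prop)) (hf.comp (by fun_prop))).enorm
  have h2 : Measurable fun q : V2 × V2 × V2 => ENNReal.ofReal (D q.1) :=
    (hD.comp measurable_fst).ennreal_ofReal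
  exact (h2.pow_const 4).inv.mul (h1.pow_const p)

lemma measurable_Kf2 (p : ℝ) {W : Set V2} (hW : MeasurableSet W) {D : V2 → ℝ} (hD : Measurable D)
    (κ : ℝ) {f : V2 → ℂ} (hf : Measurable f) :
    Measurable (fun q : V2 × V2 => ∫⁻ y, Kf p W D κ f (q.2, q.1, y)) := by
  have : Measurable fun r : (V2 × V2) × V2 => Kf p W D κ f (r.1.2, r.1.1, r.2) :=
    (measurable_Kf p hW hD κ hf).comp (by fun_prop)
  exact this.lintegral_prod_right'

lemma measurable_FF (p : ℝ) {W : Set V2} (hW : MeasurableSet W) {D : V2 → ℝ} (hD : Measurable D)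
    (κ : ℝ) {f : V2 → ℂ} (hf : Measurable f) : Measurable (FF p W D κ f) :=
  (measurable_Kf2 p hW hD κ hf).lintegral_prod_right'

lemma FF_inner {p : ℝ} (hp : 1 ≤ p) {W : Set V2} {D : V2 → ℝ} {κ : ℝ} {f : V2 → ℂ} (hf : Measurable f) (z : V2) (hDz : 0 < D z) (m : ℂ) :
    ∫⁻ x, ∫⁻ y, Kf p W D κ f (z, x, y) ≤ (ENNReal.ofReal (D z) ^ 4)⁻¹ *
      ((2 : ℝ≥0∞) ^ p * volume (closedBall z (κ * D z)) *
        ∫⁻ x in closedBall z (κ * D z), ‖f x - m‖ₑ ^ p) := by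
  set B := closedBall z (κ * D z) with hB
  have hBt : volume B ≠ ∞ := measure_closedBall_lt_top.ne
  have hD4 : (ENNReal.ofReal (D z) ^ 4)⁻¹ ≠ ∞ := by
    rw [ENNReal.inv_ne_top]; positivity
  set I := ∫⁻ x in B, ‖f x - m‖ₑ ^ p with hI
  have hfm : Measurable fun x => ‖f x - m‖ₑ ^ p := (hf.sub_const m).enorm.pow_const p
  calc ∫⁻ x, ∫⁻ y, Kf p W D κ f (z, x, y)
      ≤ ∫⁻ x, B.indicator (fun x => ∫⁻ y, B.indicator (fun y => (ENNReal.ofReal (D z) ^ 4)⁻¹ *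
          (2 ^ (p - 1) * (‖f x - m‖ₑ ^ p + ‖f y - m‖ₑ ^ p))) y) x := by
        refine lintegral_mono fun x => ?_
        by_cases hx : x ∈ B
        · rw [indicator_of_mem hx]
          refine lintegral_mono fun y => ?_
          by_cases hy : y ∈ B
          · rw [indicator_of_mem hy]
            refine (indicator_le_self _ _ _).trans ?_
            simp only
            gcongr
            exact tri_p hp _ _ _
          · rw [Kf, indicator_of_notMem]
            · simp
            · exact fun h => hy h.2.2
        · have : ∀ y, Kf p W D κ f (z, x, y) = 0 := fun y =>
            indicator_of_notMem (fun h => hx h.2.1) _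
          simp [this]
    _ = ∫⁻ x in B, ∫⁻ y in B, (ENNReal.ofReal (D z) ^ 4)⁻¹ *
          (2 ^ (p - 1) * (‖f x - m‖ₑ ^ p + ‖f y - m‖ₑ ^ p)) := by
        rw [lintegral_indicator measurableSet_closedBall]
        refine lintegral_congr fun x => ?_
        rw [lintegral_indicator measurableSet_closedBall]
    _ = (ENNReal.ofReal (D z) ^ 4)⁻¹ * (2 ^ (p - 1) * (I * volume B + I * volume B)) := by
        have h2t : (2 : ℝ≥0∞) ^ (p - 1) ≠ ∞ :=
          ENNReal.rpow_ne_top_of_nonneg (by linarith) (by simp)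
        have : ∀ x, ∫⁻ y in B, (ENNReal.ofReal (D z) ^ 4)⁻¹ *
          (2 ^ (p - 1) * (‖f x - m‖ₑ ^ p + ‖f y - m‖ₑ ^ p)) = (ENNReal.ofReal (D z) ^ 4)⁻¹ *
          (2 ^ (p - 1) * (‖f x - m‖ₑ ^ p * volume B + I)) := by
          intro x
          rw [lintegral_const_mul' _ _ hD4, lintegral_const_mul' _ _ h2t,
            lintegral_add_left measurable_const, setLIntegral_const]
        simp only [this]
        rw [lintegral_const_mul' _ _ hD4, lintegral_const_mul' _ _ h2t,
            lintegral_add_right _ measurable_const, setLIntegral_const,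
            lintegral_mul_const' _ _ hBt]
    _ = _ := by
        have : (2 : ℝ≥0∞) ^ p = 2 ^ (p - 1) * 2 := by
          conv_lhs => rw [show p = (p - 1) + 1 by ring,
            ENNReal.rpow_add_of_nonneg _ _ (by linarith) (by norm_num), ENNReal.rpow_one]
        rw [this]
        ring

/-- Integrated kernel estimate. -/
lemma FF_int {p : ℝ} (hp : 1 ≤ p) {Λ : ℝ} (hΛ : 1 ≤ Λ) {C₂ : ℝ≥0∞} (hC₂ : C₂ ≠ ∞)
    {κ : ℝ} (hκ : 0 < κ) : ∃ C : ℝ≥0∞, C ≠ ∞ ∧ ∀ (Ω W : Set V2) (D : V2 → ℝ), IsOpen Ω →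
    MeasurableSet W → Measurable D → (∀ z ∈ W, 0 < D z) →
    (∀ z ∈ W, ∀ y, dist y z ≤ Λ * (κ * D z) → y ∈ Ω ∧ D z ≤ 2 * D y ∧ D y ≤ 2 * D z) →
    ∀ f d, AdmP p Λ C₂ Ω f d →
    ∫⁻ x, FF p W D κ f x ≤ C * ∫⁻ x in Ω, d x ^ p := by
  refine ⟨(2 : ℝ≥0∞) ^ p * ENNReal.ofReal (4 * κ ^ 2) * C₂ * ENNReal.ofReal (64 * (Λ * κ) ^ 2),
    ?_, ?_⟩
  · refine ENNReal.mul_ne_top (ENNReal.mul_ne_top (ENNReal.mul_ne_top ?_ ENNReal.ofReal_ne_top)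
      hC₂) ENNReal.ofReal_ne_top
    exact ENNReal.rpow_ne_top_of_nonneg (by linarith) (by simp)
  intro Ω W D hΩ hW hD hD0 hgeo f d hA
  set c0 := (2 : ℝ≥0∞) ^ p * ENNReal.ofReal (4 * κ ^ 2) * C₂ with hc0
  have hc0t : c0 ≠ ∞ := by
    refine (ENNReal.mul_ne_top (ENNReal.mul_ne_top ?_ ENNReal.ofReal_ne_top) hC₂)
    exact ENNReal.rpow_ne_top_of_nonneg (by linarith) (by simp)
  set S : Set (V2 × V2) := {q | q.1 ∈ W ∧ dist q.2 q.1 ≤ Λ * (κ * D q.1)} with hS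
  have hSm : MeasurableSet S := by
    refine MeasurableSet.inter (measurable_fst hW)
      (s₂ := {q : V2 × V2 | dist q.2 q.1 ≤ Λ * (κ * D q.1)}) ?_
    exact measurableSet_le (by fun_prop) (by fun_prop)
  set k : V2 × V2 → ℝ≥0∞ := S.indicator fun q => (ENNReal.ofReal (D q.1) ^ 2)⁻¹ * d q.2 ^ p with hk
  have hkm : Measurable k := by
    refine Measurable.indicator ?_ hSm
    have h2 : Measurable fun q : V2 × V2 => ENNReal.ofReal (D q.1) :=
      (hD.comp measurable_fst).ennreal_ofReal
    exact (h2.pow_const 2).inv.mul ((hA.md.comp measurable_snd).pow_const p)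
  calc ∫⁻ x, FF p W D κ f x = ∫⁻ z, ∫⁻ x, ∫⁻ y, Kf p W D κ f (z, x, y) :=
        lintegral_lintegral_swap (measurable_Kf2 p hW hD κ hA.mf).aemeasurable
    _ ≤ ∫⁻ z, c0 * ∫⁻ y, k (z, y) := by
        refine lintegral_mono fun z => ?_
        simp only
        by_cases hz : z ∈ W
        · have hDz := hD0 z hz
          have hsub : closedBall z (Λ * (κ * D z)) ⊆ Ω := fun y hy => (hgeo z hz y hy).1
          obtain ⟨m, -, hm⟩ := hA.osc z (κ * D z) (by positivity) hsub
          refine (FF_inner hp hA.mf z hDz m).trans ?_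
          have e1 : ∫⁻ y, k (z, y) = (ENNReal.ofReal (D z) ^ 2)⁻¹ *
              ∫⁻ y in closedBall z (Λ * (κ * D z)), d y ^ p := by
            rw [← lintegral_const_mul' _ _ (by rw [ENNReal.inv_ne_top]; positivity),
              ← lintegral_indicator measurableSet_closedBall]
            refine lintegral_congr fun y => ?_
            by_cases hy : y ∈ closedBall z (Λ * (κ * D z))
            · rw [indicator_of_mem hy]
              simp only [hk]
              rw [indicator_of_mem (show (z, y) ∈ S from ⟨hz, hy⟩)]
            · rw [indicator_of_notMem hy]
              simp only [hk]
              rw [indicator_of_notMem]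
              exact fun h => hy h.2
          rw [e1, vol_cb z (by positivity)]
          calc _ ≤ (ENNReal.ofReal (D z) ^ 4)⁻¹ * (2 ^ p * ENNReal.ofReal ((2 * (κ * D z)) ^ 2) *
                (C₂ * ∫⁻ y in closedBall z (Λ * (κ * D z)), d y ^ p)) := by gcongr
            _ = _ := by
              rw [show (2 * (κ * D z)) ^ 2 = (4 * κ ^ 2) * (D z) ^ 2 by ring,
                ENNReal.ofReal_mul (by positivity), hc0, ENNReal.ofReal_pow hDz.le]
              have h4 : (ENNReal.ofReal (D z) ^ 4)⁻¹ * (ENNReal.ofReal (D z) ^ 2) =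
                  (ENNReal.ofReal (D z) ^ 2)⁻¹ := by
                rw [show 4 = 2 + 2 by norm_num, pow_add, ENNReal.mul_inv (by left; positivity)
                  (by left; exact ENNReal.pow_ne_top ENNReal.ofReal_ne_top), mul_assoc,
                  ENNReal.inv_mul_cancel (by positivity)
                  (ENNReal.pow_ne_top ENNReal.ofReal_ne_top), mul_one]
              rw [← h4]
              ring
        · have : ∀ x y, Kf p W D κ f (z, x, y) = 0 := fun x y =>
            indicator_of_notMem (fun h => hz h.1) _
          simp [this]
    _ = c0 * ∫⁻ y, ∫⁻ z, k (z, y) := by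
        rw [lintegral_const_mul' _ _ hc0t,
          lintegral_lintegral_swap (f := fun z y => k (z, y)) hkm.aemeasurable]
    _ ≤ c0 * ∫⁻ y, Ω.indicator (fun y => ENNReal.ofReal (64 * (Λ * κ) ^ 2) * d y ^ p) y := by
        gcongr with y
        by_cases hy : y ∈ Ω ∧ 0 < D y
        · obtain ⟨hy, hDy⟩ := hy
          rw [indicator_of_mem hy]
          calc ∫⁻ z, k (z, y) ≤ ∫⁻ z, (closedBall y (2 * Λ * κ * D y)).indicator
                (fun _ => 4 * (ENNReal.ofReal (D y) ^ 2)⁻¹ * d y ^ p) z := by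
                refine lintegral_mono fun z => ?_
                simp only [hk]
                by_cases hq : (z, y) ∈ S
                · rw [indicator_of_mem hq]
                  obtain ⟨hz, hd⟩ := hq
                  simp only at hz hd
                  obtain ⟨-, h1, h2⟩ := hgeo z hz y hd
                  rw [indicator_of_mem]
                  · simp only
                    gcongr
                    rw [← ENNReal.inv_le_inv, ENNReal.mul_inv (by simp) (by simp), inv_inv, inv_inv]
                    rw [ENNReal.inv_mul_le_iff (by simp) (by simp),
                      show (4 : ℝ≥0∞) = ENNReal.ofReal 2 ^ 2 by norm_num, ← mul_pow,
                      ← ENNReal.ofReal_mul (by norm_num)]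
                    gcongr
                  · rw [mem_closedBall, dist_comm]
                    refine hd.trans ?_
                    have := mul_le_mul_of_nonneg_left h1 (by positivity : 0 ≤ Λ * κ)
                    linarith
                · rw [indicator_of_notMem hq]; exact zero_le
            _ = _ := by
                rw [lintegral_indicator measurableSet_closedBall, setLIntegral_const,
                  vol_cb _ (by positivity),
                  show (2 * (2 * Λ * κ * D y)) ^ 2 = (16 * (Λ * κ) ^ 2) * D y ^ 2 by ring,
                  ENNReal.ofReal_mul (by positivity), ENNReal.ofReal_pow hDy.le]
                have h4 : (ENNReal.ofReal (D y) ^ 2)⁻¹ * (ENNReal.ofReal (D y) ^ 2) = 1 :=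
                  ENNReal.inv_mul_cancel (by positivity)
                    (ENNReal.pow_ne_top ENNReal.ofReal_ne_top)
                calc _ = 4 * ENNReal.ofReal (16 * (Λ * κ) ^ 2) * d y ^ p *
                    ((ENNReal.ofReal (D y) ^ 2)⁻¹ * (ENNReal.ofReal (D y) ^ 2)) := by ring
                  _ = _ := by
                    rw [h4, mul_one, show (4 : ℝ≥0∞) = ENNReal.ofReal 4 by norm_num,
                      ← ENNReal.ofReal_mul (by norm_num)]
                    congr 2; ring
        · have : ∀ z, k (z, y) = 0 := by
            intro z
            refine indicator_of_notMem (fun hq => hy ?_) _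
            obtain ⟨hz, hd⟩ := hq
            obtain ⟨h0, h1, h2⟩ := hgeo z hz y hd
            have := hD0 z hz
            exact ⟨h0, by linarith⟩
          simp [this]
    _ = _ := by
        rw [lintegral_indicator hΩ.measurableSet, lintegral_const_mul' _ _ ENNReal.ofReal_ne_top]
        ring

end RPD

namespace RPD
open Set Metric
open scoped ENNReal

lemma FF_point {p : ℝ} (hp : 1 ≤ p) {κ κ' : ℝ} (hκ : 0 < κ) (hκ' : 0 < κ') :
    ∃ C : ℝ≥0∞, C ≠ ∞ ∧ ∀ (W : Set V2) (D : V2 → ℝ) (f : V2 → ℂ) (x x' : V2),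
    MeasurableSet W → Measurable D → Measurable f → 0 < D x →
    (∀ z, dist z x ≤ κ' * D x → z ∈ W ∧ dist x z ≤ κ * D z ∧ dist x' z ≤ κ * D z ∧
      D x ≤ 2 * D z ∧ D z ≤ 2 * D x) →
    ‖f x - f x'‖ₑ ^ p ≤ C * (FF p W D κ f x + FF p W D κ f x') := by
  have h2t : (2 : ℝ≥0∞) ^ (p - 1) ≠ ∞ :=
    ENNReal.rpow_ne_top_of_nonneg (by linarith) (by simp)
  set b := ENNReal.ofReal (4 * κ ^ 2 * κ' ^ 2) with hb
  have hb0 : b ≠ 0 := by simp [hb]; positivity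
  have hbt : b ≠ ∞ := ENNReal.ofReal_ne_top
  refine ⟨b⁻¹ * 2 ^ (p - 1), ENNReal.mul_ne_top (ENNReal.inv_ne_top.2 hb0) h2t, ?_⟩
  intro W D f x x' hW hD hf hDx hgeo
  set a := ‖f x - f x'‖ₑ ^ p with ha
  set B' := closedBall x (κ' * D x) with hB'
  have key : ∀ z ∈ B', a * ENNReal.ofReal (κ ^ 2 * (D x ^ 2)⁻¹) ≤ 2 ^ (p - 1) *
      ((∫⁻ y, Kf p W D κ f (z, x, y)) + ∫⁻ y, Kf p W D κ f (z, x', y)) := by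
    intro z hz
    obtain ⟨hzW, h1, h2, h3, h4⟩ := hgeo z hz
    have hDz : 0 < D z := by linarith
    set B := closedBall z (κ * D z) with hB
    have hD4 : (ENNReal.ofReal (D z) ^ 4)⁻¹ ≠ ∞ := by rw [ENNReal.inv_ne_top]; positivity
    have e : ∀ w, dist w z ≤ κ * D z → ∫⁻ y, Kf p W D κ f (z, w, y) =
        (ENNReal.ofReal (D z) ^ 4)⁻¹ * ∫⁻ y in B, ‖f w - f y‖ₑ ^ p := by
      intro w hw
      rw [← lintegral_const_mul' _ _ hD4, ← lintegral_indicator measurableSet_closedBall]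
      refine lintegral_congr fun y => ?_
      by_cases hy : y ∈ B
      · rw [indicator_of_mem hy, Kf, indicator_of_mem (show (z, w, y) ∈ trip W D κ from ⟨hzW, hw, hy⟩)]
      · rw [indicator_of_notMem hy, Kf, indicator_of_notMem fun h => hy h.2.2]
    rw [e x h1, e x' h2]
    have h5 : a * volume B ≤ 2 ^ (p - 1) *
        ((∫⁻ y in B, ‖f x - f y‖ₑ ^ p) + ∫⁻ y in B, ‖f x' - f y‖ₑ ^ p) := by
      rw [← lintegral_add_left ((hf.const_sub (f x)).enorm.pow_const p),
        ← lintegral_const_mul' _ _ h2t, ← setLIntegral_const]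
      exact lintegral_mono fun y => tri_p hp _ _ _
    calc a * ENNReal.ofReal (κ ^ 2 * (D x ^ 2)⁻¹) ≤
          (ENNReal.ofReal (D z) ^ 4)⁻¹ * (a * volume B) := by
          rw [vol_cb z (by positivity), mul_left_comm, ← ENNReal.ofReal_pow hDz.le,
            ← ENNReal.ofReal_inv_of_pos (by positivity), ← ENNReal.ofReal_mul (by positivity)]
          refine mul_le_mul' le_rfl (ENNReal.ofReal_le_ofReal ?_)
          have : (D z ^ 4)⁻¹ * (2 * (κ * D z)) ^ 2 = κ ^ 2 * ((D z / 2) ^ 2)⁻¹ := by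
            field_simp
          rw [this]
          gcongr
          linarith
      _ ≤ (ENNReal.ofReal (D z) ^ 4)⁻¹ * (2 ^ (p - 1) *
        ((∫⁻ y in B, ‖f x - f y‖ₑ ^ p) + ∫⁻ y in B, ‖f x' - f y‖ₑ ^ p)) := by gcongr
      _ = _ := by ring
  have hm : ∀ w, Measurable fun z => ∫⁻ y, Kf p W D κ f (z, w, y) := fun w =>
    (measurable_Kf2 p hW hD κ hf).comp (g := fun q : V2 × V2 => ∫⁻ y, Kf p W D κ f (q.2, q.1, y))
      (f := fun z => (w, z)) (by fun_prop)
  have h6 : a * b ≤ 2 ^ (p - 1) * (FF p W D κ f x + FF p W D κ f x') := by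
    calc a * b = ∫⁻ z in B', a * ENNReal.ofReal (κ ^ 2 * (D x ^ 2)⁻¹) := by
          rw [setLIntegral_const, vol_cb x (by positivity), mul_assoc,
            ← ENNReal.ofReal_mul (by positivity), hb]
          congr 2
          field_simp; ring
      _ ≤ ∫⁻ z in B', 2 ^ (p - 1) *
        ((∫⁻ y, Kf p W D κ f (z, x, y)) + ∫⁻ y, Kf p W D κ f (z, x', y)) :=
          setLIntegral_mono' measurableSet_closedBall key
      _ ≤ ∫⁻ z, 2 ^ (p - 1) *
        ((∫⁻ y, Kf p W D κ f (z, x, y)) + ∫⁻ y, Kf p W D κ f (z, x', y)) :=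
          setLIntegral_le_lintegral _ _
      _ = _ := by
          rw [lintegral_const_mul' _ _ h2t, lintegral_add_left (hm x)]; rfl
  calc a = b⁻¹ * (a * b) := by
        rw [mul_comm a, ← mul_assoc, ENNReal.inv_mul_cancel hb0 hbt, one_mul]
    _ ≤ b⁻¹ * (2 ^ (p - 1) * (FF p W D κ f x + FF p W D κ f x')) := by gcongr
    _ = _ := by ring

/-- Absorption step: abstract boundary estimate. -/
lemma absorb {p : ℝ} (hp : 1 ≤ p) {Λ : ℝ} (hΛ : 1 ≤ Λ) {C₂ : ℝ≥0∞} (hC₂ : C₂ ≠ ∞)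
    {κ κ' : ℝ} (hκ : 0 < κ) (hκ' : 0 < κ') (Ω W U : Set V2) (D : V2 → ℝ) (T : V2 → V2)
    (hΩ : IsOpen Ω) (hW : MeasurableSet W) (hD : Measurable D) (hWD : ∀ z ∈ W, 0 < D z)
    (hgeoW : ∀ z ∈ W, ∀ y, dist y z ≤ Λ * (κ * D z) → y ∈ Ω ∧ D z ≤ 2 * D y ∧ D y ≤ 2 * D z)
    (hU : MeasurableSet U) (hUfin : volume U ≠ ∞) (hUD : ∀ x ∈ U, 0 < D x)
    (hgeoU : ∀ x ∈ U, ∀ z, dist z x ≤ κ' * D x → z ∈ W ∧ dist x z ≤ κ * D z ∧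
      dist (T x) z ≤ κ * D z ∧ D x ≤ 2 * D z ∧ D z ≤ 2 * D x)
    (hT : Measurable T)
    (x₁ : V2) (r₁ : ℝ) (hr₁ : 0 < r₁) (hball : closedBall x₁ (Λ * r₁) ⊆ Ω)
    (θ : ℝ≥0∞) (hθ : θ < 1)
    (hcv : ∀ F : V2 → ℝ≥0∞, Measurable F →
      ∫⁻ x in U, F (T x) ≤ θ * ((∫⁻ x in U, F x) + ∫⁻ x in closedBall x₁ r₁, F x)) :
    ∃ C : ℝ≥0∞, C ≠ ∞ ∧ ∀ f d, AdmP p Λ C₂ Ω f d → ∃ m : ℂ, ‖m‖ = 1 ∧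
      ∫⁻ x in U, ‖f x - m‖ₑ ^ p ≤ C * ∫⁻ x in Ω, d x ^ p := by
  have hp0 : 0 < p := by linarith
  obtain ⟨Ca, hCa, hFFint⟩ := FF_int hp hΛ hC₂ hκ
  obtain ⟨Cb, hCb, hpt⟩ := FF_point hp hκ hκ'
  have hp1 : 0 ≤ 1 / p := by positivity
  -- the constants
  set η := θ ^ (1 / p) with hη
  have hη1 : η < 1 := ENNReal.rpow_lt_one hθ (by positivity)
  have hηt : η ≠ ∞ := (hη1.trans_le le_top).ne
  set A : ℝ≥0∞ := (1 - η)⁻¹ * ((3 * Cb * Ca) ^ (1 / p) + C₂ ^ (1 / p)) with hA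
  have hAt : A ≠ ∞ := by
    refine ENNReal.mul_ne_top (ENNReal.inv_ne_top.2 (tsub_pos_of_lt hη1).ne')
      (ENNReal.add_ne_top.2 ⟨?_, ENNReal.rpow_ne_top_of_nonneg hp1 hC₂⟩)
    exact ENNReal.rpow_ne_top_of_nonneg hp1
      (ENNReal.mul_ne_top (ENNReal.mul_ne_top (by simp) hCb) hCa)
  refine ⟨A ^ p, ENNReal.rpow_ne_top_of_nonneg hp0.le hAt, ?_⟩
  intro f d hadm
  obtain ⟨m, hm1, hm⟩ := hadm.osc x₁ r₁ hr₁ hball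
  refine ⟨m, hm1, ?_⟩
  set I := ∫⁻ x in Ω, d x ^ p with hI
  set F := FF p W D κ f with hF
  have hFm : Measurable F := measurable_FF p hW hD κ hadm.mf
  have hFI : ∫⁻ x, F x ≤ Ca * I := hFFint Ω W D hΩ hW hD hWD hgeoW f d hadm
  have hN : ∫⁻ x in U, ‖f x - f (T x)‖ₑ ^ p ≤ 3 * Cb * Ca * I := by
    calc ∫⁻ x in U, ‖f x - f (T x)‖ₑ ^ p ≤ ∫⁻ x in U, Cb * (F x + F (T x)) :=
          setLIntegral_mono' hU fun x hx =>
            hpt W D f x (T x) hW hD hadm.mf (hUD x hx) (hgeoU x hx)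
      _ = Cb * ((∫⁻ x in U, F x) + ∫⁻ x in U, F (T x)) := by
          rw [lintegral_const_mul' _ _ hCb, lintegral_add_left hFm]
      _ ≤ Cb * ((∫⁻ x, F x) + 1 * ((∫⁻ x, F x) + ∫⁻ x, F x)) := by
          gcongr
          · exact Measure.restrict_le_self
          · refine (hcv F hFm).trans ?_
            gcongr
            · exact Measure.restrict_le_self
            · exact Measure.restrict_le_self
      _ = 3 * Cb * ∫⁻ x, F x := by ring
      _ ≤ 3 * Cb * (Ca * I) := by gcongr
      _ = _ := by ring
  set u : V2 → ℝ≥0∞ := fun x => ‖f x - m‖ₑ with hu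
  have hum : Measurable u := (hadm.mf.sub_const m).enorm
  set a := (∫⁻ x in U, u x ^ p) ^ (1 / p) with ha
  have hat : a ≠ ∞ := by
    refine ENNReal.rpow_ne_top_of_nonneg hp1 ?_
    obtain ⟨K, hK⟩ := hadm.bf
    refine ne_top_of_le_ne_top ?_ (setLIntegral_mono' hU (g := fun _ =>
      ENNReal.ofReal (K + ‖m‖) ^ p) fun x _ => ?_)
    · rw [setLIntegral_const]
      exact ENNReal.mul_ne_top (by simp [hp0.le]) hUfin
    · gcongr
      rw [hu]; simp only
      rw [← ofReal_norm]
      exact ENNReal.ofReal_le_ofReal ((norm_sub_le _ _).trans (by gcongr; exact hK x))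
  have h1 : a ≤ (3 * Cb * Ca * I) ^ (1 / p) + (∫⁻ x in U, u (T x) ^ p) ^ (1 / p) := by
    calc a ≤ (∫⁻ x in U, ((fun x => ‖f x - f (T x)‖ₑ) + fun x => u (T x)) x ^ p) ^ (1 / p) := by
          rw [ha]
          gcongr with x
          simp only [hu, Pi.add_apply]
          have : f x - m = (f x - f (T x)) + (f (T x) - m) := by ring
          rw [this]; exact enorm_add_le _ _
      _ ≤ _ := by
          refine (ENNReal.lintegral_Lp_add_le
            (hadm.mf.sub (hadm.mf.comp hT)).enorm.aemeasurable (hum.comp hT).aemeasurable hp).trans ?_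
          refine add_le_add ?_ le_rfl
          exact ENNReal.rpow_le_rpow hN hp1
  have h2 : (∫⁻ x in U, u (T x) ^ p) ^ (1 / p) ≤ η * a + (C₂ * I) ^ (1 / p) := by
    calc (∫⁻ x in U, u (T x) ^ p) ^ (1 / p) ≤
          (θ * ((∫⁻ x in U, u x ^ p) + ∫⁻ x in closedBall x₁ r₁, u x ^ p)) ^ (1 / p) := by
          gcongr
          exact hcv (fun x => u x ^ p) (hum.pow_const p)
      _ = η * ((∫⁻ x in U, u x ^ p) + ∫⁻ x in closedBall x₁ r₁, u x ^ p) ^ (1 / p) := by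
          rw [ENNReal.mul_rpow_of_nonneg _ _ hp1]
      _ ≤ η * (a + (C₂ * I) ^ (1 / p)) := by
          gcongr
          refine (ENNReal.rpow_add_le_add_rpow _ _ hp1 (by rw [div_le_one hp0]; exact hp)).trans ?_
          refine add_le_add le_rfl (ENNReal.rpow_le_rpow (hm.trans ?_) hp1)
          exact mul_le_mul' le_rfl (lintegral_mono_set hball)
      _ ≤ η * a + 1 * (C₂ * I) ^ (1 / p) := by
          rw [mul_add]; gcongr
      _ = _ := by rw [one_mul]
  have h3 : a ≤ A * I ^ (1 / p) := by
    have h4 : a ≤ η * a + ((3 * Cb * Ca) ^ (1 / p) + C₂ ^ (1 / p)) * I ^ (1 / p) := by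
      refine (h1.trans (add_le_add_right h2 _)).trans (le_of_eq ?_)
      rw [ENNReal.mul_rpow_of_nonneg _ _ hp1, ENNReal.mul_rpow_of_nonneg C₂ _ hp1]
      ring
    have h5 : (1 - η) * a ≤ ((3 * Cb * Ca) ^ (1 / p) + C₂ ^ (1 / p)) * I ^ (1 / p) := by
      rw [ENNReal.sub_mul (fun _ _ => hat), one_mul]
      exact tsub_le_iff_left.2 h4
    have h0 : (1 - η) ≠ 0 := (tsub_pos_of_lt hη1).ne'
    calc a = (1 - η)⁻¹ * ((1 - η) * a) := by
          rw [← mul_assoc, ENNReal.inv_mul_cancel h0 (by finiteness), one_mul]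
      _ ≤ (1 - η)⁻¹ * (((3 * Cb * Ca) ^ (1 / p) + C₂ ^ (1 / p)) * I ^ (1 / p)) := by gcongr
      _ = _ := by rw [hA, ← mul_assoc (1 - η)⁻¹]
  calc ∫⁻ x in U, u x ^ p = a ^ p := by
        rw [ha, ← ENNReal.rpow_mul, one_div_mul_cancel hp0.ne', ENNReal.rpow_one]
    _ ≤ (A * I ^ (1 / p)) ^ p := by gcongr
    _ = _ := by
        rw [ENNReal.mul_rpow_of_nonneg _ _ hp0.le, ← ENNReal.rpow_mul, one_div_mul_cancel hp0.ne',
          ENNReal.rpow_one]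

end RPD

namespace RPD
open Set Metric
open scoped ENNReal

lemma det_rank_one (ℓ : V2 →L[ℝ] ℝ) (e : V2) :
    (ContinuousLinearMap.id ℝ V2 - ℓ.smulRight e).det = 1 - ℓ e := by
  have : ((ContinuousLinearMap.id ℝ V2 - ℓ.smulRight e : V2 →L[ℝ] V2) : V2 →ₗ[ℝ] V2) =
      LinearMap.transvection (-(ℓ : V2 →ₗ[ℝ] ℝ)) e := by
    ext x i
    simp [LinearMap.transvection.apply]
    try ring
  rw [ContinuousLinearMap.det, this, LinearMap.transvection.det]
  simp; ring

lemma decr_along {ρ : V2 → ℝ} (hρ : Differentiable ℝ ρ) {x0 e : V2} {R0 c : ℝ}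
    (hc : ∀ x ∈ ball x0 R0, fderiv ℝ ρ x e ≤ -c) {x : V2} {s : ℝ} (hs : 0 ≤ s)
    (hx : x ∈ ball x0 R0) (hxs : x + s • e ∈ ball x0 R0) : ρ (x + s • e) ≤ ρ x - c * s := by
  have hd : ∀ u : ℝ, HasDerivAt (fun u : ℝ => ρ (x + u • e)) (fderiv ℝ ρ (x + u • e) e) u := by
    intro u
    have h1 : HasDerivAt (fun u : ℝ => x + u • e) e u := by
      simpa using ((hasDerivAt_id u).smul_const e).const_add x
    exact (hρ _).hasFDerivAt.comp_hasDerivAt u h1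
  have hin : ∀ u ∈ Icc 0 s, x + u • e ∈ ball x0 R0 := by
    intro u hu
    rcases hs.eq_or_lt with rfl | hs'
    · have : u = 0 := le_antisymm hu.2 hu.1
      simpa [this] using hx
    have hconv := (convex_ball x0 R0).add_smul_sub_mem hx hxs (t := u / s)
      ⟨by have := hu.1; positivity, (div_le_one hs').2 hu.2⟩
    convert hconv using 2
    rw [add_sub_cancel_left, smul_smul, div_mul_cancel₀ _ hs'.ne']
  have := (convex_Icc (0 : ℝ) s).image_sub_le_mul_sub_of_deriv_le
    (f := fun u : ℝ => ρ (x + u • e)) (C := -c)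
    (fun u _ => (hd u).continuousAt.continuousWithinAt)
    (fun u _ => (hd u).differentiableAt.differentiableWithinAt)
    (fun u hu => by
      rw [(hd u).deriv]
      exact hc _ (hin u (interior_subset hu)))
    0 (left_mem_Icc.2 hs) s (right_mem_Icc.2 hs) hs
  simp at this
  linarith

set_option maxHeartbeats 4000000 in
lemma boundary_piece {p : ℝ} (hp : 1 ≤ p) {Λ : ℝ} (hΛ : 1 ≤ Λ) {C₂ : ℝ≥0∞} (hC₂ : C₂ ≠ ∞)
    (Ω : Set V2) (hΩ : IsOpen Ω) (ρ : V2 → ℝ) (hρ : ContDiff ℝ 1 ρ) (hΩρ : Ω = ρ ⁻¹' Iio 0)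
    (x0 : V2) (hx0 : ρ x0 = 0) (hgrad : fderiv ℝ ρ x0 ≠ 0) :
    ∃ N : Set V2, IsOpen N ∧ x0 ∈ N ∧ ∃ C : ℝ≥0∞, C ≠ ∞ ∧ ∀ f d, AdmP p Λ C₂ Ω f d →
      ∃ m : ℂ, ‖m‖ = 1 ∧ ∫⁻ x in N ∩ Ω, ‖f x - m‖ₑ ^ p ≤ C * ∫⁻ x in Ω, d x ^ p := by
  have hρd : Differentiable ℝ ρ := hρ.differentiable (by norm_num)
  have hρc : Continuous (fderiv ℝ ρ) := hρ.continuous_fderiv (by norm_num)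
  have hmemΩ : ∀ x, x ∈ Ω ↔ ρ x < 0 := fun x => by rw [hΩρ]; rfl
  -- choose the direction
  obtain ⟨i, σ, hσ, hneg⟩ : ∃ (i : Fin 2) (σ : ℝ), (σ = 1 ∨ σ = -1) ∧
      fderiv ℝ ρ x0 (Pi.single i σ) < 0 := by
    by_contra hcon
    push Not at hcon
    apply hgrad
    have hz : ∀ i, fderiv ℝ ρ x0 (Pi.single i 1) = 0 := by
      intro i
      have h1 := hcon i 1 (Or.inl rfl)
      have h2 := hcon i (-1) (Or.inr rfl)
      have : (Pi.single i (-1) : V2) = - Pi.single i 1 := by rw [← Pi.single_neg]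
      rw [this, map_neg] at h2
      linarith
    ext v
    have hv : v = ∑ i, v i • (Pi.single i 1 : V2) := by
      ext j; simp [Finset.sum_apply, Pi.single_apply]
    rw [hv, map_sum]
    simp [hz]
  set e : V2 := Pi.single i σ with he
  have hei : e i = σ := by simp [he]
  have hej : ∀ j, j ≠ i → e j = 0 := fun j hj => by simp [he, hj]
  have hσa : |σ| = 1 := by rcases hσ with rfl | rfl <;> simp
  have hen : ‖e‖ = 1 := by
    rw [he, Pi.norm_single, Real.norm_eq_abs, hσa]
  set c := -(fderiv ℝ ρ x0 e) / 2 with hc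
  have hc0 : 0 < c := by rw [hc]; linarith
  set L := ‖fderiv ℝ ρ x0‖ + 1 + c with hL
  have hL0 : 0 < L := by positivity
  have hcL : c ≤ L := by rw [hL]; linarith [norm_nonneg (fderiv ℝ ρ x0)]
  obtain ⟨R0, hR0, hR⟩ : ∃ R0 > 0, ∀ x ∈ ball x0 R0, fderiv ℝ ρ x e ≤ -c ∧ ‖fderiv ℝ ρ x‖ ≤ L := by
    have h1 : ∀ᶠ x in 𝓝 x0, fderiv ℝ ρ x e < -c := by
      have hcont : Continuous fun x => fderiv ℝ ρ x e := hρc.clm_apply continuous_const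
      exact hcont.continuousAt.eventually (gt_mem_nhds (by rw [hc]; linarith))
    have h2 : ∀ᶠ x in 𝓝 x0, ‖fderiv ℝ ρ x‖ < L :=
      hρc.norm.continuousAt.eventually (gt_mem_nhds (by rw [hL]; linarith))
    obtain ⟨R0, hR0, h⟩ := Metric.eventually_nhds_iff_ball.1 (h1.and h2)
    exact ⟨R0, hR0, fun x hx => ⟨(h x hx).1.le, (h x hx).2.le⟩⟩
  have hLip : ∀ x ∈ ball x0 R0, ∀ y ∈ ball x0 R0, |ρ x - ρ y| ≤ L * dist x y := by
    intro x hx y hy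
    have := (convex_ball x0 R0).norm_image_sub_le_of_norm_fderiv_le (𝕜 := ℝ)
      (fun z _ => hρd z) (fun z hz => (hR z hz).2) hy hx
    rwa [Real.norm_eq_abs, ← dist_eq_norm] at this
  have hx0b : x0 ∈ ball x0 R0 := mem_ball_self hR0
  set κ := 1 / (2 * Λ * L) with hκ
  have hκ0 : 0 < κ := by rw [hκ]; positivity
  have hκL : Λ * κ * L = 1 / 2 := by rw [hκ]; field_simp
  have hκL' : κ * L ≤ 1 / 2 := by
    rw [← hκL]; nlinarith [mul_pos hκ0 hL0]
  set κ' := κ / 4 with hκ'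
  set lam := κ / 4 * (c / L) with hlam
  have hcL1 : c / L ≤ 1 := (div_le_one hL0).2 hcL
  have hlam0 : 0 < lam := by rw [hlam]; positivity
  have hlamκ : lam ≤ κ / 4 := by
    rw [hlam]; exact mul_le_of_le_one_right (by positivity) hcL1
  set δ := c / (2 * L * Λ) with hδ
  have hδ0 : 0 < δ := by rw [hδ]; positivity
  have hδ1 : δ ≤ 1 / 2 := by
    rw [hδ, div_le_iff₀ (by positivity)]; nlinarith
  have hΛδ : Λ * δ * L = c / 2 := by rw [hδ]; field_simp
  have hlamL : lam * L ≤ δ := by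
    rw [hlam, hδ, hκ]
    have : 1 / (2 * Λ * L) / 4 * (c / L) * L = c / (2 * L * Λ) / 4 := by field_simp
    rw [this]
    have : 0 ≤ c / (2 * L * Λ) := by positivity
    linarith
  set h := R0 / 8 with hh
  have hh0 : 0 < h := by rw [hh]; positivity
  set r := δ * h with hr
  have hr0 : 0 < r := by rw [hr]; positivity
  have hrh : r ≤ h / 2 := by rw [hr]; nlinarith
  set D : V2 → ℝ := fun x => -ρ x with hD
  set W : Set V2 := Ω ∩ ball x0 (R0 / 2) with hW
  set Box : Set V2 := univ.pi fun j => ball (x0 j) (if j = i then h else r) with hBox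
  have hBoxo : IsOpen Box := isOpen_set_pi finite_univ fun j _ => isOpen_ball
  set U := Box ∩ Ω with hU
  set T : V2 → V2 := fun x => x - (lam * ρ x) • e with hT
  have hTe : ∀ x, T x = x + (lam * D x) • e := fun x => by
    simp only [hT, hD]; rw [mul_neg, neg_smul, sub_eq_add_neg]
  have hBox_dist : ∀ x ∈ Box, dist x x0 ≤ h := by
    intro x hx
    rw [dist_pi_le_iff hh0.le]
    intro j
    have := hx j (mem_univ _)
    rw [mem_ball] at this
    split_ifs at this <;> linarith
  have hDle : ∀ x ∈ ball x0 R0, D x ≤ L * dist x x0 := by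
    intro x hx
    have := hLip x hx x0 hx0b
    rw [hx0, sub_zero] at this
    exact (neg_le_abs _).trans this
  have hball_of : ∀ x, dist x x0 ≤ 2 * h → x ∈ ball x0 R0 := fun x hx => by
    rw [mem_ball]; rw [hh] at hx; linarith
  have hDDs : ∀ x ∈ ball x0 R0, ∀ y ∈ ball x0 R0, |D x - D y| ≤ L * dist x y := by
    intro x hx y hy
    have := hLip x hx y hy
    rw [abs_sub_comm] at this
    have e1 : D x - D y = ρ y - ρ x := by simp only [hD]; ring
    rwa [e1]
  have hUfacts : ∀ x ∈ U, x ∈ ball x0 R0 ∧ 0 < D x ∧ D x ≤ L * h ∧ dist x x0 ≤ h := by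
    intro x hx
    have h1 := hBox_dist x hx.1
    have h2 : x ∈ ball x0 R0 := hball_of x (by linarith)
    refine ⟨h2, ?_, ?_, h1⟩
    · have := (hmemΩ x).1 hx.2; simp only [hD]; linarith
    · exact (hDle x h2).trans (by gcongr)
  have hTdist : ∀ x ∈ U, dist (T x) x = lam * D x := by
    intro x hx
    obtain ⟨-, h2, -, -⟩ := hUfacts x hx
    rw [hTe, dist_eq_norm, add_sub_cancel_left, norm_smul, hen, mul_one, Real.norm_eq_abs,
      abs_of_pos (by positivity)]
  have hTball : ∀ x ∈ U, T x ∈ ball x0 R0 := by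
    intro x hx
    obtain ⟨h1, h2, h3, h4⟩ := hUfacts x hx
    apply hball_of
    have h5 := dist_triangle (T x) x x0
    rw [hTdist x hx] at h5
    have : lam * D x ≤ lam * (L * h) := by gcongr
    nlinarith
  set x₁ := x0 + h • e with hx₁
  have hx₁d : dist x₁ x0 = h := by
    rw [hx₁, dist_eq_norm, add_sub_cancel_left, norm_smul, hen, mul_one, Real.norm_eq_abs,
      abs_of_pos hh0]
  have hTimg : T '' U ⊆ U ∪ closedBall x₁ r := by
    rintro _ ⟨x, hx, rfl⟩
    obtain ⟨h1, h2, h3, h4⟩ := hUfacts x hx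
    have hs0 : 0 < lam * D x := by positivity
    have hs1 : lam * D x ≤ r := by
      calc lam * D x ≤ lam * (L * h) := by gcongr
        _ = lam * L * h := by ring
        _ ≤ δ * h := by gcongr
    have hTΩ : T x ∈ Ω := by
      rw [hmemΩ, hTe]
      have h5 := decr_along hρd (fun x hx => (hR x hx).1) hs0.le h1
        (by rw [← hTe]; exact hTball x hx)
      have h6 := (hmemΩ x).1 hx.2
      have h7 := mul_pos hc0 hs0
      linarith only [h5, h6, h7]
    have hlat : ∀ j, j ≠ i → T x j = x j := fun j hj => by
      rw [hTe]; simp [hej j hj]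
    have hTi : T x i = x i + lam * D x * σ := by
      rw [hTe]; simp [hei]
    have hxi := hx.1 i (mem_univ _)
    rw [mem_ball, if_pos rfl, Real.dist_eq] at hxi
    by_cases hcase : |T x i - x0 i| < h
    · left
      refine ⟨fun j _ => ?_, hTΩ⟩
      by_cases hj : j = i
      · subst hj
        rw [mem_ball, if_pos rfl, Real.dist_eq]; exact hcase
      · have := hx.1 j (mem_univ _)
        rw [hlat j hj]; exact this
    · right
      rw [mem_closedBall, dist_pi_le_iff hr0.le]
      intro j
      by_cases hj : j = i
      · subst hj
        rw [Real.dist_eq, hx₁]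
        simp only [Pi.add_apply, Pi.smul_apply, hei, smul_eq_mul]
        rw [hTi] at hcase ⊢
        rw [abs_lt] at hxi hcase
        rw [abs_le]
        rcases hσ with hσ1 | hσ1 <;> rw [hσ1] at hcase ⊢ <;>
        · by_contra hcon
          apply hcase
          constructor <;>
          · by_contra h7
            apply hcon
            constructor <;> linarith
      · have := hx.1 j (mem_univ _)
        rw [mem_ball, if_neg hj] at this
        rw [hlat j hj, hx₁]
        simp only [Pi.add_apply, Pi.smul_apply, hej j hj, smul_zero, add_zero]
        exact this.le
  have hinj : InjOn T U := by
    intro x hx y hy hxy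
    by_contra hne
    have hd : 0 < dist x y := dist_pos.2 hne
    have h1 : x - y = (lam * (ρ x - ρ y)) • e := by
      have : x - (lam * ρ x) • e = y - (lam * ρ y) • e := hxy
      rw [mul_sub, sub_smul, sub_eq_sub_iff_add_eq_add]
      rw [sub_eq_sub_iff_add_eq_add] at this
      rw [this, add_comm]
    have h2 : dist x y ≤ lam * (L * dist x y) := by
      conv_lhs => rw [dist_eq_norm, h1, norm_smul, hen, mul_one, norm_mul, Real.norm_eq_abs,
        abs_of_pos hlam0]
      rw [Real.norm_eq_abs]
      have := hLip x (hUfacts x hx).1 y (hUfacts y hy).1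
      gcongr
    nlinarith
  have hUm : MeasurableSet U := hBoxo.measurableSet.inter hΩ.measurableSet
  have hTf : ∀ x, HasFDerivAt T (ContinuousLinearMap.id ℝ V2 -
      (lam • fderiv ℝ ρ x).smulRight e) x := by
    intro x
    exact (hasFDerivAt_id x).sub (((hρd x).hasFDerivAt.const_mul lam).smul_const e)
  set θ : ℝ≥0∞ := (ENNReal.ofReal (1 + lam * c))⁻¹ with hθ
  have hlc : 0 < lam * c := by positivity
  refine Exists.elim (absorb hp hΛ hC₂ hκ0 (by positivity : 0 < κ') Ω W U D T hΩ
    (hΩ.measurableSet.inter measurableSet_ball) hρ.continuous.neg.measurable ?_ ?_ hUm ?_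
    (fun x hx => (hUfacts x hx).2.1) ?_ ?_ x₁ r hr0 ?_ θ ?_ ?_) ?_
  rotate_right
  · rintro C ⟨hC, hmain⟩
    exact ⟨Box, hBoxo, fun j _ => by
      rw [mem_ball, dist_self]; split_ifs <;> assumption, C, hC, hmain⟩
  · intro z hz
    have := (hmemΩ z).1 hz.1; exact neg_pos.2 this
  · intro z hz y hy
    have hDz : 0 < D z := by have := (hmemΩ z).1 hz.1; simp only [hD]; linarith
    have hz2 := mem_ball.1 hz.2
    have hzb : z ∈ ball x0 R0 := ball_subset_ball (by linarith) hz.2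
    have h1 := hDle z hzb
    have h2 : Λ * (κ * D z) ≤ R0 / 4 := by
      calc Λ * (κ * D z) ≤ Λ * (κ * (L * (R0 / 2))) := by
            gcongr
            exact h1.trans (by gcongr)
        _ = Λ * κ * L * (R0 / 2) := by ring
        _ = R0 / 4 := by rw [hκL]; ring
    have hyb : y ∈ ball x0 R0 := by
      rw [mem_ball]
      have := dist_triangle y z x0
      linarith
    have h3 : |D y - D z| ≤ D z / 2 := by
      calc |D y - D z| ≤ L * dist y z := hDDs y hyb z hzb
        _ ≤ L * (Λ * (κ * D z)) := by gcongr
        _ = Λ * κ * L * D z := by ring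
        _ = D z / 2 := by rw [hκL]; ring
    rw [abs_le] at h3
    refine ⟨?_, by linarith, by linarith⟩
    rw [hmemΩ]
    have : 0 < D y := by linarith
    simp only [hD] at this; linarith
  · have : volume U ≤ volume (closedBall x0 h) :=
      measure_mono fun x hx => mem_closedBall.2 (hBox_dist x hx.1)
    exact (this.trans_lt measure_closedBall_lt_top).ne
  · intro x hx z hz
    obtain ⟨h1, h2, h3, h4⟩ := hUfacts x hx
    have hκh : κ' * D x ≤ h / 8 := by
      calc κ' * D x ≤ κ' * (L * h) := by gcongr
        _ = κ * L * h / 4 := by rw [hκ']; ring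
        _ ≤ (1 / 2) * h / 4 := by gcongr
        _ = _ := by ring
    have hzd : dist z x0 ≤ 2 * h := by
      have := dist_triangle z x x0
      linarith
    have hzb := hball_of z hzd
    have h5 : |D z - D x| ≤ D x / 8 := by
      calc |D z - D x| ≤ L * dist z x := hDDs z hzb x h1
        _ ≤ L * (κ' * D x) := by gcongr
        _ = κ * L * D x / 4 := by rw [hκ']; ring
        _ ≤ (1 / 2) * D x / 4 := by gcongr
        _ = _ := by ring
    rw [abs_le] at h5
    have hxz : D x ≤ 2 * D z := by linarith
    have hκx : κ * D x ≤ 2 * (κ * D z) := by nlinarith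
    have hzx : dist x z ≤ κ / 4 * D x := by rw [dist_comm]; exact hz
    refine ⟨⟨?_, ?_⟩, ?_, ?_, hxz, by linarith⟩
    · rw [hmemΩ]
      have : 0 < D z := by linarith
      simp only [hD] at this; linarith
    · rw [mem_ball]; rw [hh] at hzd; linarith
    · have := mul_pos hκ0 h2
      linarith
    · have h6 := dist_triangle (T x) x z
      rw [hTdist x hx] at h6
      have : lam * D x ≤ κ / 4 * D x := by gcongr
      linarith
  · exact (continuous_id.sub ((continuous_const.mul hρ.continuous).smul continuous_const)).measurable
  · intro y hy
    have h1 : Λ * r = (Λ * δ * L) * (h / L) := by rw [hr]; field_simp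
    rw [hΛδ] at h1
    have h2 : c * (h / L) ≤ h := by
      calc c * (h / L) = (c / L) * h := by ring
        _ ≤ 1 * h := by gcongr
        _ = h := one_mul h
    have hyd := mem_closedBall.1 hy
    have hx₁b : x₁ ∈ ball x0 R0 := hball_of _ (by rw [hx₁d]; linarith)
    have hyb : y ∈ ball x0 R0 := by
      apply hball_of
      have := dist_triangle y x₁ x0
      linarith
    have h3 := decr_along hρd (fun x hx => (hR x hx).1) hh0.le hx0b hx₁b
    rw [hx0, zero_sub] at h3
    have h4 := (abs_le.1 (hLip y hyb x₁ hx₁b)).2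
    have h5 : L * dist y x₁ ≤ c * h / 2 := by
      calc L * dist y x₁ ≤ L * (Λ * r) := by gcongr
        _ = c * h / 2 := by rw [h1]; field_simp
    rw [hmemΩ]
    have : ρ x₁ ≤ -(c * h) := h3
    have h7 := mul_pos hc0 hh0
    linarith only [h3, h4, h5, this, h7]
  · rw [hθ, ENNReal.inv_lt_one, ENNReal.one_lt_ofReal]; linarith
  · intro F hF
    have h1 : ENNReal.ofReal (1 + lam * c) * ∫⁻ x in U, F (T x) ≤
        (∫⁻ x in U, F x) + ∫⁻ x in closedBall x₁ r, F x := by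
      calc ENNReal.ofReal (1 + lam * c) * ∫⁻ x in U, F (T x)
          = ∫⁻ x in U, ENNReal.ofReal (1 + lam * c) * F (T x) := by
            rw [lintegral_const_mul' _ _ ENNReal.ofReal_ne_top]
        _ ≤ ∫⁻ x in U, ENNReal.ofReal |(ContinuousLinearMap.id ℝ V2 -
              (lam • fderiv ℝ ρ x).smulRight e).det| * F (T x) := by
            refine setLIntegral_mono' hUm fun x hx => ?_
            gcongr
            rw [det_rank_one]
            refine le_trans ?_ (le_abs_self _)
            have := (hR x (hUfacts x hx).1).1
            simp only [ContinuousLinearMap.smul_apply, smul_eq_mul]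
            nlinarith
        _ = ∫⁻ x in T '' U, F x :=
            (lintegral_image_eq_lintegral_abs_det_fderiv_mul volume hUm
              (fun x _ => (hTf x).hasFDerivWithinAt) hinj F).symm
        _ ≤ ∫⁻ x in U ∪ closedBall x₁ r, F x := lintegral_mono_set hTimg
        _ ≤ _ := lintegral_union_le _ _ _
    calc ∫⁻ x in U, F (T x) = θ * (ENNReal.ofReal (1 + lam * c) * ∫⁻ x in U, F (T x)) := by
          rw [hθ, ← mul_assoc, ENNReal.inv_mul_cancel (by simp; linarith) ENNReal.ofReal_ne_top,
            one_mul]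
      _ ≤ _ := by gcongr

end RPD

namespace RPD
open Set Metric
open scoped ENNReal

/-- The rigidity estimate on the subset `A`. -/
def GP (p Λ : ℝ) (C₂ : ℝ≥0∞) (Ω A : Set V2) : Prop :=
  ∃ C : ℝ≥0∞, C ≠ ∞ ∧ ∀ f d, AdmP p Λ C₂ Ω f d → ∃ m : ℂ, ‖m‖ = 1 ∧
    ∫⁻ x in A, ‖f x - m‖ₑ ^ p ≤ C * ∫⁻ x in Ω, d x ^ p

lemma GP_union {p Λ : ℝ} {C₂ : ℝ≥0∞} (hp : 1 ≤ p) {Ω A A' : Set V2} (hA' : volume A' ≠ ∞)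
    (hpos : volume (A ∩ A') ≠ 0) (h : GP p Λ C₂ Ω A) (h' : GP p Λ C₂ Ω A') :
    GP p Λ C₂ Ω (A ∪ A') := by
  obtain ⟨C, hC, h⟩ := h
  obtain ⟨C', hC', h'⟩ := h'
  set T : ℝ≥0∞ := (2 : ℝ≥0∞) ^ (p - 1) with hT
  have hTt : T ≠ ∞ := ENNReal.rpow_ne_top_of_nonneg (by linarith) (by simp)
  set v := volume (A ∩ A') with hv
  have hvt : v ≠ ∞ := ne_top_of_le_ne_top hA' (measure_mono inter_subset_right)
  refine ⟨C + T * (C' + volume A' * (v⁻¹ * (T * (C + C')))), ?_, fun f d hfd => ?_⟩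
  · have := ENNReal.inv_ne_top.2 hpos
    finiteness
  obtain ⟨m, hm, h⟩ := h f d hfd
  obtain ⟨m', hm', h'⟩ := h' f d hfd
  refine ⟨m, hm, ?_⟩
  set E := ∫⁻ x in Ω, d x ^ p with hE
  have hmf : ∀ c : ℂ, Measurable fun x => ‖f x - c‖ₑ ^ p := fun c =>
    (hfd.mf.sub_const c).enorm.pow_const p
  have key : v * ‖m' - m‖ₑ ^ p ≤ T * (C + C') * E := by
    calc v * ‖m' - m‖ₑ ^ p = ∫⁻ x in A ∩ A', ‖m' - m‖ₑ ^ p := by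
          rw [setLIntegral_const, mul_comm]
      _ ≤ ∫⁻ x in A ∩ A', T * (‖f x - m'‖ₑ ^ p + ‖f x - m‖ₑ ^ p) := by
          refine lintegral_mono fun x => ?_
          have := tri_p hp m' m (f x)
          rwa [← enorm_neg (m' - f x), ← enorm_neg (m - f x), neg_sub, neg_sub] at this
      _ = T * ((∫⁻ x in A ∩ A', ‖f x - m'‖ₑ ^ p) + ∫⁻ x in A ∩ A', ‖f x - m‖ₑ ^ p) := by
          rw [lintegral_const_mul' _ _ hTt, lintegral_add_left (hmf _)]
      _ ≤ T * (C' * E + C * E) := by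
          refine mul_le_mul' le_rfl (add_le_add ?_ ?_)
          · exact (lintegral_mono_set inter_subset_right).trans h'
          · exact (lintegral_mono_set inter_subset_left).trans h
      _ = _ := by ring
  have key2 : ‖m' - m‖ₑ ^ p ≤ v⁻¹ * (T * (C + C')) * E := by
    rw [mul_assoc]
    rw [← ENNReal.mul_le_iff_le_inv hpos hvt]; exact key
  calc ∫⁻ x in A ∪ A', ‖f x - m‖ₑ ^ p
      ≤ (∫⁻ x in A, ‖f x - m‖ₑ ^ p) + ∫⁻ x in A', ‖f x - m‖ₑ ^ p := lintegral_union_le _ _ _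
    _ ≤ C * E + ∫⁻ x in A', T * (‖f x - m'‖ₑ ^ p + ‖m' - m‖ₑ ^ p) := by
        refine add_le_add h (lintegral_mono fun x => ?_)
        have := tri_p hp (f x) m m'
        rwa [← enorm_neg (m - m'), neg_sub] at this
    _ = C * E + T * ((∫⁻ x in A', ‖f x - m'‖ₑ ^ p) + ‖m' - m‖ₑ ^ p * volume A') := by
        rw [lintegral_const_mul' _ _ hTt, lintegral_add_left (hmf _),
          setLIntegral_const]
    _ ≤ C * E + T * (C' * E + v⁻¹ * (T * (C + C')) * E * volume A') := by
        gcongr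
    _ = _ := by ring

lemma GP_whole {p Λ : ℝ} {C₂ : ℝ≥0∞} (hp : 1 ≤ p) {Ω : Set V2} (hΩ : IsOpen Ω)
    (hb : Bornology.IsBounded Ω) (hc : IsConnected Ω)
    (hloc : ∀ x ∈ closure Ω, ∃ N, IsOpen N ∧ x ∈ N ∧ GP p Λ C₂ Ω (N ∩ Ω)) :
    GP p Λ C₂ Ω Ω := by
  classical
  choose! N hNo hxN hNG using hloc
  have hvol : volume Ω ≠ ∞ := hb.measure_lt_top.ne
  obtain ⟨s, hcov⟩ := hb.isCompact_closure.elim_nhds_subcover' (fun x _ => N x)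
    (fun x hx => (hNo x hx).mem_nhds (hxN x hx))
  set A : Finset (closure Ω) → Set V2 := fun u => ⋃ x ∈ u, N x ∩ Ω with hA
  have hAo : ∀ u, IsOpen (A u) := fun u => isOpen_biUnion fun x _ => (hNo x x.2).inter hΩ
  have hAsub : ∀ u, A u ⊆ Ω := fun u => iUnion₂_subset fun x _ => inter_subset_right
  have hne : ∀ x : closure Ω, (N x ∩ Ω).Nonempty := fun x =>
    mem_closure_iff.1 x.2 _ (hNo x x.2) (hxN x x.2)
  have hcovA : Ω ⊆ A s := by
    intro y hy
    obtain ⟨x, hx, hy'⟩ := mem_iUnion₂.1 (hcov (subset_closure hy))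
    exact mem_iUnion₂.2 ⟨x, hx, hy', hy⟩
  set F := s.powerset.filter (fun u => u.Nonempty ∧ GP p Λ C₂ Ω (A u)) with hF
  have hsne : s.Nonempty := by
    obtain ⟨y, hy⟩ := hc.nonempty
    obtain ⟨x, hx, -⟩ := mem_iUnion₂.1 (hcovA hy)
    exact ⟨x, hx⟩
  have hFne : F.Nonempty := by
    obtain ⟨x, hx⟩ := hsne
    refine ⟨{x}, ?_⟩
    simp only [hF, Finset.mem_filter, Finset.mem_powerset, Finset.singleton_subset_iff]
    refine ⟨hx, by simp, ?_⟩
    have : A {x} = N x ∩ Ω := by simp only [hA]; exact Finset.set_biUnion_singleton _ _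
    rw [this]; exact hNG x x.2
  obtain ⟨u, huF, humax⟩ := F.exists_max_image (fun u => u.card) hFne
  simp only [hF, Finset.mem_filter, Finset.mem_powerset] at huF
  obtain ⟨hus, hune, huG⟩ := huF
  have hnone : ∀ x ∈ s \ u, ¬ (A u ∩ (N x ∩ Ω)).Nonempty := by
    intro x hx hnon
    rw [Finset.mem_sdiff] at hx
    have hin : insert x u ∈ F := by
      simp only [hF, Finset.mem_filter, Finset.mem_powerset]
      refine ⟨Finset.insert_subset hx.1 hus, by simp, ?_⟩
      have : A (insert x u) = A u ∪ (N x ∩ Ω) := by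
        simp only [hA, Finset.set_biUnion_insert]; rw [union_comm]
      rw [this]
      refine GP_union hp ?_ ?_ huG (hNG x x.2)
      · exact ne_top_of_le_ne_top hvol (measure_mono inter_subset_right)
      · exact (((hAo u).inter ((hNo x x.2).inter hΩ)).measure_pos volume hnon).ne'
    have := humax _ hin
    rw [Finset.card_insert_of_notMem hx.2] at this
    omega
  have hΩu : Ω ⊆ A u := by
    by_contra hcon
    obtain ⟨y, hy, hyu⟩ := not_subset.1 hcon
    obtain ⟨x, hx, hyx⟩ := mem_iUnion₂.1 (hcovA hy)
    have hxu : x ∉ u := fun h => hyu (mem_iUnion₂.2 ⟨x, h, hyx⟩)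
    obtain ⟨x₂, hx₂⟩ := hune
    obtain ⟨z, hz⟩ := hne x₂
    have := hc.isPreconnected (A u) (A (s \ u)) (hAo _) (hAo _) (by
      intro q hq
      obtain ⟨x', hx', hq'⟩ := mem_iUnion₂.1 (hcovA hq)
      by_cases h : x' ∈ u
      · exact Or.inl (mem_iUnion₂.2 ⟨x', h, hq'⟩)
      · exact Or.inr (mem_iUnion₂.2 ⟨x', by simp [hx', h], hq'⟩))
      ⟨z, hz.2, mem_iUnion₂.2 ⟨x₂, hx₂, hz⟩⟩
      ⟨y, hy, mem_iUnion₂.2 ⟨x, by simp [hx, hxu], hyx⟩⟩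
    obtain ⟨q, -, hq1, hq2⟩ := this
    obtain ⟨x', hx', hq'⟩ := mem_iUnion₂.1 hq2
    exact hnone x' hx' ⟨q, hq1, hq'⟩
  have : A u = Ω := (hAsub u).antisymm hΩu
  rwa [this] at huG

/-- Global rigidity from local rigidity. -/
lemma global_rigidity {p Λ : ℝ} {C₂ : ℝ≥0∞} (hp : 1 ≤ p) (hΛ : 1 ≤ Λ) (hC₂ : C₂ ≠ ∞)
    {Ω : Set V2} (hΩ : IsOpen Ω) (hb : Bornology.IsBounded Ω) (hc : IsConnected Ω)
    (hsm : HasSmoothBoundary Ω) : GP p Λ C₂ Ω Ω := by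
  obtain ⟨ρ, hρ, hΩρ, hgrad⟩ := hsm
  refine GP_whole hp hΩ hb hc fun x hx => ?_
  by_cases hxΩ : x ∈ Ω
  · obtain ⟨r, hr, hrΩ⟩ := Metric.isOpen_iff.1 hΩ x hxΩ
    have hΛ0 : 0 < Λ := by linarith
    have hr' : 0 < r / (2 * Λ) := by positivity
    refine ⟨ball x (r / (2 * Λ)), isOpen_ball, mem_ball_self hr', C₂, hC₂, fun f d hfd => ?_⟩
    have hsub : closedBall x (Λ * (r / (2 * Λ))) ⊆ Ω := by
      refine Subset.trans (closedBall_subset_ball ?_) hrΩ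
      have : Λ * (r / (2 * Λ)) = r / 2 := by field_simp
      linarith
    obtain ⟨m, hm, h⟩ := hfd.osc x _ hr' hsub
    refine ⟨m, hm, le_trans (lintegral_mono_set (inter_subset_left.trans ball_subset_closedBall))
      (h.trans ?_)⟩
    exact mul_le_mul' le_rfl (lintegral_mono_set hsub)
  · have hxf : x ∈ frontier Ω := by rw [hΩ.frontier_eq]; exact ⟨hx, hxΩ⟩
    have hρ1 : ContDiff ℝ 1 ρ := hρ.of_le (by exact_mod_cast le_top)
    have hle : ρ x ≤ 0 := by
      have : closure Ω ⊆ {y | ρ y ≤ 0} := by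
        refine closure_minimal ?_ (isClosed_le hρ.continuous continuous_const)
        rw [hΩρ]; intro y hy; exact le_of_lt (mem_Iio.1 (mem_preimage.1 hy))
      exact this hx
    have hge : 0 ≤ ρ x := by
      by_contra h; exact hxΩ (by rw [hΩρ]; exact not_le.1 h)
    exact boundary_piece hp hΛ hC₂ Ω hΩ ρ hρ1 hΩρ x (le_antisymm hle hge) (hgrad x hxf)

end RPD

namespace RPD
open Set Metric
open scoped ENNReal

/-- Wirtinger derivative `∂_z`. -/
def dz (u : ℂ → ℂ) (z : ℂ) : ℂ := (fderiv ℝ u z 1 - Complex.I * fderiv ℝ u z Complex.I) / 2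

/-- Wirtinger derivative `∂_{z̄}`. -/
def dzb (u : ℂ → ℂ) (z : ℂ) : ℂ := (fderiv ℝ u z 1 + Complex.I * fderiv ℝ u z Complex.I) / 2

lemma fderiv_dir (u : ℂ → ℂ) (z h : ℂ) :
    fderiv ℝ u z h = h.re * fderiv ℝ u z 1 + h.im * fderiv ℝ u z Complex.I := by
  have : h = h.re • (1 : ℂ) + h.im • Complex.I := by
    apply Complex.ext <;> simp
  conv_lhs => rw [this]
  rw [map_add, map_smul, map_smul, Complex.real_smul, Complex.real_smul]

lemma polar_dir (u : ℂ → ℂ) (z E : ℂ) (hE : ‖E‖ = 1) :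
    E⁻¹ * dzb u z = (1 / 2) * (fderiv ℝ u z E + Complex.I * fderiv ℝ u z (Complex.I * E)) := by
  have h1 : E⁻¹ = (starRingEnd ℂ) E := by
    rw [Complex.inv_def, Complex.normSq_eq_norm_sq, hE]; simp
  rw [h1, fderiv_dir u z E, fderiv_dir u z (Complex.I * E), dzb]
  have h2 : (starRingEnd ℂ) E = E.re - E.im * Complex.I := by
    apply Complex.ext <;> simp
  rw [h2]
  simp only [Complex.mul_re, Complex.I_re, Complex.I_im, Complex.mul_im]
  push_cast
  linear_combination (-(1/2) * (E.im : ℂ) * fderiv ℝ u z Complex.I) * Complex.I_sq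

lemma exists_zero_outside {F : Type*} [NormedAddCommGroup F] {u : ℂ → F}
    (hc : HasCompactSupport u) : ∃ R : ℝ, 0 < R ∧ ∀ z, R ≤ ‖z‖ → u z = 0 := by
  obtain ⟨R, hR, h⟩ := hc.isCompact.isBounded.exists_pos_norm_lt
  exact ⟨R, hR, fun z hz => image_eq_zero_of_notMem_tsupport fun hm => (h z hm).not_ge hz⟩

lemma integrable_polar {F : ℝ × ℝ → ℂ} (hF : Continuous F) {R : ℝ}
    (h0 : ∀ p : ℝ × ℝ, R ≤ p.1 → F p = 0) :
    IntegrableOn F (Ioi (0 : ℝ) ×ˢ Ioo (-Real.pi) Real.pi) (volume.prod volume) := by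
  have h1 : IntegrableOn F (Icc (0:ℝ) R ×ˢ Icc (-Real.pi) Real.pi) (volume.prod volume) :=
    hF.continuousOn.integrableOn_compact (isCompact_Icc.prod isCompact_Icc)
  refine IntegrableOn.of_forall_sdiff_eq_zero h1
    (measurableSet_Ioi.prod measurableSet_Ioo) ?_
  rintro ⟨r, θ⟩ ⟨⟨hr, hθ⟩, hn⟩
  apply h0
  by_contra hlt
  exact hn ⟨⟨le_of_lt hr, le_of_lt (not_le.1 hlt)⟩, Ioo_subset_Icc_self hθ⟩

lemma polar_symm (p : ℝ × ℝ) : Complex.polarCoord.symm p = p.1 * Complex.exp (p.2 * Complex.I) := by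
  rw [Complex.polarCoord_symm_apply, Complex.exp_mul_I]; push_cast; ring

/-- Cauchy-Pompeiu at the origin for compactly supported functions. -/
lemma pompeiu0 (u : ℂ → ℂ) (hu : ContDiff ℝ 1 u) (hc : HasCompactSupport u) :
    ∫ z, z⁻¹ * dzb u z = - Real.pi * u 0 := by
  obtain ⟨R, hR, hR0⟩ := exists_zero_outside hc
  obtain ⟨R', hR', hR0'⟩ := exists_zero_outside (hc.fderiv (𝕜 := ℝ))
  set Ex : ℝ → ℂ := fun θ => Complex.exp (θ * Complex.I) with hEx
  have hExc : Continuous Ex := by fun_prop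
  have hExn : ∀ θ, ‖Ex θ‖ = 1 := fun θ => Complex.norm_exp_ofReal_mul_I θ
  set A : ℝ × ℝ → ℂ := fun p => fderiv ℝ u (p.1 * Ex p.2) (Ex p.2) with hA
  set B : ℝ × ℝ → ℂ := fun p => fderiv ℝ u (p.1 * Ex p.2) (Complex.I * Ex p.2) with hB
  have hfc : Continuous (fderiv ℝ u) := hu.continuous_fderiv one_ne_zero
  have hAc : Continuous A := by
    apply Continuous.clm_apply
    · exact hfc.comp (by fun_prop)
    · fun_prop
  have hBc : Continuous B := by
    apply Continuous.clm_apply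
    · exact hfc.comp (by fun_prop)
    · fun_prop
  have hz : ∀ p : ℝ × ℝ, R' ≤ p.1 → fderiv ℝ u (p.1 * Ex p.2) = 0 := fun p hp => by
    apply hR0'
    rw [norm_mul, hExn, mul_one, Complex.norm_real]
    exact hp.trans (le_abs_self _)
  have hAi := integrable_polar hAc (R := R') (fun p hp => by simp only [hA, hz p hp]; simp)
  have hBi := integrable_polar hBc (R := R') (fun p hp => by simp only [hB, hz p hp]; simp)
  have hudiff : Differentiable ℝ u := hu.differentiable one_ne_zero
  have h1 : ∫ p in (Ioi (0 : ℝ) ×ˢ Ioo (-Real.pi) Real.pi), A p ∂(volume.prod volume)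
      = - (2 * Real.pi) * u 0 := by
    rw [← setIntegral_prod_swap, setIntegral_prod _ ?_]
    · have : ∀ θ : ℝ, ∫ r in Ioi (0:ℝ), A (r, θ) = - u 0 := by
        intro θ
        have hd : ∀ r ∈ Ici (0:ℝ), HasDerivAt (fun r : ℝ => u (r * Ex θ)) (A (r, θ)) r := by
          intro r _
          have h2 : HasDerivAt (fun r : ℝ => (r : ℂ) * Ex θ) (Ex θ) r := by
            simpa using (Complex.ofRealCLM.hasDerivAt (x := r)).mul_const (Ex θ)
          exact (hudiff _).hasFDerivAt.comp_hasDerivAt r h2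
        have ht : Filter.Tendsto (fun r : ℝ => u (r * Ex θ)) Filter.atTop (𝓝 0) := by
          refine tendsto_const_nhds.congr' ?_
          filter_upwards [Filter.eventually_ge_atTop R] with r hr
          symm; apply hR0
          rw [norm_mul, hExn, mul_one, Complex.norm_real]
          exact hr.trans (le_abs_self _)
        have hi : IntegrableOn (fun r => A (r, θ)) (Ioi 0) := by
          have : IntegrableOn (fun r => A (r, θ)) (Icc 0 R') :=
            (hAc.comp (by fun_prop)).continuousOn.integrableOn_compact isCompact_Icc
          refine IntegrableOn.of_forall_sdiff_eq_zero this measurableSet_Ioi ?_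
          rintro r ⟨hr, hn⟩
          have : R' ≤ r := by
            by_contra hlt; exact hn ⟨le_of_lt hr, le_of_lt (not_le.1 hlt)⟩
          simp only [hA]; rw [hz (r, θ) this]; simp
        rw [integral_Ioi_of_hasDerivAt_of_tendsto' hd hi ht]; simp
      simp only [Prod.swap_prod_mk, this]
      rw [setIntegral_const]
      simp only [Measure.real, Real.volume_Ioo]
      rw [ENNReal.toReal_ofReal (by linarith [Real.pi_pos]), Complex.real_smul]
      push_cast; ring
    · exact hAi.swap
  have h2 : ∫ p in (Ioi (0 : ℝ) ×ˢ Ioo (-Real.pi) Real.pi), B p ∂(volume.prod volume) = 0 := by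
    rw [setIntegral_prod _ hBi]
    have : ∀ r ∈ Ioi (0:ℝ), ∫ θ in Ioo (-Real.pi) Real.pi, B (r, θ) = 0 := by
      intro r hr
      have hr0 : (r : ℂ) ≠ 0 := by exact_mod_cast (ne_of_gt hr)
      have hd : ∀ θ : ℝ, HasDerivAt (fun θ : ℝ => (r : ℂ)⁻¹ * u (r * Ex θ)) (B (r, θ)) θ := by
        intro θ
        have h3 : HasDerivAt Ex (Ex θ * Complex.I) θ := by
          have : HasDerivAt (fun θ : ℝ => (θ : ℂ) * Complex.I) Complex.I θ := by
            simpa using (Complex.ofRealCLM.hasDerivAt (x := θ)).mul_const Complex.I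
          exact this.cexp
        have h4 := (hudiff (r * Ex θ)).hasFDerivAt.comp_hasDerivAt θ (h3.const_mul (r : ℂ))
        have h5 := h4.const_mul (r : ℂ)⁻¹
        refine HasDerivAt.congr_deriv h5 ?_
        have : (r : ℂ) * (Ex θ * Complex.I) = r • (Complex.I * Ex θ) := by
          rw [Complex.real_smul]; ring
        rw [this, map_smul, Complex.real_smul, ← mul_assoc, inv_mul_cancel₀ hr0, one_mul]
      rw [← integral_Ioc_eq_integral_Ioo, ← intervalIntegral.integral_of_le
        (by linarith [Real.pi_pos])]
      rw [intervalIntegral.integral_eq_sub_of_hasDerivAt (fun θ _ => hd θ)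
        ((hBc.comp (by fun_prop)).intervalIntegrable _ _)]
      have : Ex Real.pi = Ex (-Real.pi) := by
        simp only [hEx]; push_cast; rw [neg_mul, Complex.exp_neg, Complex.exp_pi_mul_I]; norm_num
      rw [this]; simp
    rw [setIntegral_congr_fun measurableSet_Ioi this]; simp
  rw [← Complex.integral_comp_polarCoord_symm]
  have h3 : ∫ p in polarCoord.target, p.1 • ((Complex.polarCoord.symm p)⁻¹ *
      dzb u (Complex.polarCoord.symm p)) = ∫ p in (Ioi (0 : ℝ) ×ˢ Ioo (-Real.pi) Real.pi),
        (1/2 : ℂ) * (A p + Complex.I * B p) := by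
    refine setIntegral_congr_fun (measurableSet_Ioi.prod measurableSet_Ioo) ?_
    rintro ⟨r, θ⟩ ⟨hr, -⟩
    have hr0 : (r : ℂ) ≠ 0 := by exact_mod_cast (ne_of_gt hr)
    simp only [polar_symm]
    rw [Complex.real_smul, mul_inv, mul_assoc, ← mul_assoc, mul_inv_cancel₀ hr0, one_mul]
    exact polar_dir u _ _ (hExn θ)
  have hAi' : IntegrableOn A (Ioi (0 : ℝ) ×ˢ Ioo (-Real.pi) Real.pi) volume := hAi
  have hBi' : IntegrableOn B (Ioi (0 : ℝ) ×ˢ Ioo (-Real.pi) Real.pi) volume := hBi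
  rw [h3, integral_const_mul, integral_add hAi' (hBi'.const_mul _), integral_const_mul]
  have h1' : ∫ p in (Ioi (0 : ℝ) ×ˢ Ioo (-Real.pi) Real.pi), A p = - (2 * Real.pi) * u 0 := h1
  have h2' : ∫ p in (Ioi (0 : ℝ) ×ˢ Ioo (-Real.pi) Real.pi), B p = 0 := h2
  rw [h1', h2']
  ring

end RPD

namespace RPD
open Set Metric
open scoped ENNReal

lemma ibp_real {P Q : ℂ → ℝ} (hP : ContDiff ℝ 2 P) (hQ : ContDiff ℝ 2 Q)
    (hPc : HasCompactSupport P) (a b : ℂ) :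
    ∫ z, fderiv ℝ P z a * fderiv ℝ Q z b = ∫ z, fderiv ℝ P z b * fderiv ℝ Q z a := by
  have hP1 : ContDiff ℝ 1 (fderiv ℝ P) := hP.fderiv_right (by norm_num)
  have hPa : ∀ c, ContDiff ℝ 1 (fun z => fderiv ℝ P z c) := fun c => hP1.clm_apply contDiff_const
  have hPac : ∀ c, HasCompactSupport (fun z => fderiv ℝ P z c) := fun c => hPc.fderiv_apply ℝ c
  have hQc : Continuous Q := hQ.continuous
  have hQ1 : ∀ c, Continuous fun z => fderiv ℝ Q z c := fun c =>
    (hQ.continuous_fderiv (by norm_num)).clm_apply continuous_const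
  have key : ∀ c e, ∫ z, fderiv ℝ P z c * fderiv ℝ Q z e =
      - ∫ z, fderiv ℝ (fderiv ℝ P) z e c * Q z := by
    intro c e
    rw [integral_mul_fderiv_eq_neg_fderiv_mul_of_integrable]
    · congr 2
      funext z
      have : HasFDerivAt (fun z => fderiv ℝ P z c) ((fderiv ℝ (fderiv ℝ P) z).flip c) z := by
        exact ((hP1.differentiable one_ne_zero z).hasFDerivAt.clm_apply
          (hasFDerivAt_const c z)).congr_fderiv (by ext; simp)
      rw [this.fderiv]; rfl
    · refine Continuous.integrable_of_hasCompactSupport ?_ ?_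
      · exact (((hPa c).continuous_fderiv one_ne_zero).clm_apply continuous_const).mul hQc
      · exact ((hPac c).fderiv_apply ℝ e).mul_right
    · refine Continuous.integrable_of_hasCompactSupport ?_ ?_
      · exact (hPa c).continuous.mul (hQ1 e)
      · exact (hPac c).mul_right
    · refine Continuous.integrable_of_hasCompactSupport ?_ ?_
      · exact (hPa c).continuous.mul hQc
      · exact (hPac c).mul_right
    · exact fun x _ => (hPa c).differentiable one_ne_zero x
    · exact fun x _ => hQ.differentiable (by norm_num) x
  rw [key a b, key b a]
  congr 2
  funext z
  congr 1
  have := (hP.contDiffAt (x := z)).isSymmSndFDerivAt (by simp)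
  exact this b a

lemma norm_dz_sub (u : ℂ → ℂ) (hu : Differentiable ℝ u) (z : ℂ) :
    ‖dz u z‖ ^ 2 - ‖dzb u z‖ ^ 2 =
      fderiv ℝ (fun z => (u z).re) z 1 * fderiv ℝ (fun z => (u z).im) z Complex.I -
      fderiv ℝ (fun z => (u z).re) z Complex.I * fderiv ℝ (fun z => (u z).im) z 1 := by
  have h1 : ∀ h, fderiv ℝ (fun z => (u z).re) z h = (fderiv ℝ u z h).re := fun h => by
    have : HasFDerivAt (fun z => (u z).re) (Complex.reCLM.comp (fderiv ℝ u z)) z :=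
      Complex.reCLM.hasFDerivAt.comp z (hu z).hasFDerivAt
    rw [this.fderiv]; rfl
  have h2 : ∀ h, fderiv ℝ (fun z => (u z).im) z h = (fderiv ℝ u z h).im := fun h => by
    have : HasFDerivAt (fun z => (u z).im) (Complex.imCLM.comp (fderiv ℝ u z)) z :=
      Complex.imCLM.hasFDerivAt.comp z (hu z).hasFDerivAt
    rw [this.fderiv]; rfl
  rw [h1, h1, h2, h2, dz, dzb, ← Complex.normSq_eq_norm_sq, ← Complex.normSq_eq_norm_sq,
    map_div₀, map_div₀]
  simp only [Complex.normSq_apply, Complex.sub_re, Complex.sub_im,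
    Complex.add_re, Complex.add_im, Complex.mul_re, Complex.mul_im, Complex.I_re, Complex.I_im,
    Complex.re_ofNat, Complex.im_ofNat]
  ring

lemma continuous_dz {u : ℂ → ℂ} (hu : ContDiff ℝ 1 u) : Continuous (dz u) := by
  have := hu.continuous_fderiv one_ne_zero
  unfold dz; fun_prop

lemma continuous_dzb {u : ℂ → ℂ} (hu : ContDiff ℝ 1 u) : Continuous (dzb u) := by
  have := hu.continuous_fderiv one_ne_zero
  unfold dzb; fun_prop

lemma hcs_of_zero {F : Type*} [NormedAddCommGroup F] {u : ℂ → F} (R : ℝ)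
    (h : ∀ z, R < ‖z‖ → u z = 0) : HasCompactSupport u :=
  HasCompactSupport.intro (isCompact_closedBall (0:ℂ) R) fun z hz => h z (by
    simpa using hz)

lemma dz_zero_of {u : ℂ → ℂ} {R : ℝ} (h : ∀ z, R < ‖z‖ → u z = 0) (z : ℂ) (hz : R < ‖z‖) :
    fderiv ℝ u z = 0 := by
  have : u =ᶠ[𝓝 z] fun _ => 0 := by
    filter_upwards [(isOpen_lt continuous_const continuous_norm).mem_nhds hz] with y hy
    exact h y hy
  rw [this.fderiv_eq]; simp

lemma int_dz_eq {v : ℂ → ℂ} (hv : ContDiff ℝ 2 v) {R : ℝ} (hR : ∀ z, R < ‖z‖ → v z = 0) :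
    ∫ z, ‖dz v z‖ ^ 2 = ∫ z, ‖dzb v z‖ ^ 2 := by
  have hv1 : ContDiff ℝ 1 v := hv.of_le (by norm_num)
  have hre : ContDiff ℝ 2 fun z => (v z).re := Complex.reCLM.contDiff.comp hv
  have him : ContDiff ℝ 2 fun z => (v z).im := Complex.imCLM.contDiff.comp hv
  have i1 : Integrable fun z => ‖dz v z‖ ^ 2 := by
    refine Continuous.integrable_of_hasCompactSupport ((continuous_dz hv1).norm.pow 2)
      (hcs_of_zero R fun z hz => ?_)
    simp [dz, dz_zero_of hR z hz]
  have i2 : Integrable fun z => ‖dzb v z‖ ^ 2 := by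
    refine Continuous.integrable_of_hasCompactSupport ((continuous_dzb hv1).norm.pow 2)
      (hcs_of_zero R fun z hz => ?_)
    simp [dzb, dz_zero_of hR z hz]
  rw [← sub_eq_zero, ← integral_sub i1 i2]
  have hrec : HasCompactSupport fun z => (v z).re := hcs_of_zero R fun z hz => by simp [hR z hz]
  have hcont : ∀ a b, Integrable fun z => fderiv ℝ (fun z => (v z).re) z a *
      fderiv ℝ (fun z => (v z).im) z b := by
    intro a b
    refine Continuous.integrable_of_hasCompactSupport ?_ (hrec.fderiv_apply ℝ a).mul_right
    exact ((hre.continuous_fderiv (by norm_num)).clm_apply continuous_const).mul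
      ((him.continuous_fderiv (by norm_num)).clm_apply continuous_const)
  calc ∫ z, (‖dz v z‖ ^ 2 - ‖dzb v z‖ ^ 2) = ∫ z, (fderiv ℝ (fun z => (v z).re) z 1 *
        fderiv ℝ (fun z => (v z).im) z Complex.I -
      fderiv ℝ (fun z => (v z).re) z Complex.I * fderiv ℝ (fun z => (v z).im) z 1) := by
        congr 1; funext z; exact norm_dz_sub v (hv.differentiable (by norm_num)) z
    _ = 0 := by
        rw [integral_sub (hcont _ _) (hcont _ _), ibp_real hre him hrec, sub_self]

/-- The Cauchy kernel. -/
def ck (z : ℂ) : ℂ := (Real.pi * z : ℂ)⁻¹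

lemma ck_norm (z : ℂ) : ‖ck z‖ = Real.pi⁻¹ * ‖z‖⁻¹ := by
  rw [ck, norm_inv, norm_mul, Complex.norm_real, Real.norm_of_nonneg Real.pi_pos.le, mul_inv]

lemma ck_li : LocallyIntegrable ck := by
  refine locallyIntegrable_of_norm_le_rpow (C := Real.pi⁻¹) (α := 1) ?_ ?_ ?_ ?_
  · rw [Complex.finrank_real_complex]; norm_num
  · rw [Complex.finrank_real_complex]; norm_num
  · refine Filter.Eventually.of_forall fun z => ?_
    rw [ck_norm, Real.rpow_neg_one]
  · unfold ck
    exact (by fun_prop : Measurable fun z : ℂ => (Real.pi * z : ℂ)⁻¹).aestronglyMeasurable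

/-- The Cauchy transform. -/
def CT (φ : ℂ → ℂ) : ℂ → ℂ := MeasureTheory.convolution ck φ (ContinuousLinearMap.mul ℝ ℂ) volume

lemma CT_contDiff {φ : ℂ → ℂ} (hφ : ContDiff ℝ 2 φ) (hc : HasCompactSupport φ) :
    ContDiff ℝ 2 (CT φ) :=
  hc.contDiff_convolution_right _ ck_li hφ

lemma CT_fderiv {φ : ℂ → ℂ} (hφ : ContDiff ℝ 2 φ) (hc : HasCompactSupport φ) (z h : ℂ) :
    fderiv ℝ (CT φ) z h = ∫ t, ck t * fderiv ℝ φ (z - t) h := by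
  have h1 := hc.hasFDerivAt_convolution_right (ContinuousLinearMap.mul ℝ ℂ) ck_li
    (hφ.of_le (by norm_num)) z
  have h2 : fderiv ℝ (CT φ) z = _ := h1.fderiv
  rw [h2, convolution_precompR_apply _ ck_li (hc.fderiv ℝ)
    (hφ.continuous_fderiv (by norm_num))]
  rfl

lemma CT_dzb {φ : ℂ → ℂ} (hφ : ContDiff ℝ 2 φ) (hc : HasCompactSupport φ) (z : ℂ) :
    dzb (CT φ) z = φ z := by
  have hi : ∀ h, Integrable fun t => ck t * fderiv ℝ φ (z - t) h := fun h =>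
    (hc.fderiv_apply ℝ h).convolutionExists_right (ContinuousLinearMap.mul ℝ ℂ) ck_li
      ((hφ.continuous_fderiv (by norm_num)).clm_apply continuous_const) z
  have hd : Differentiable ℝ φ := hφ.differentiable (by norm_num)
  set u : ℂ → ℂ := fun t => φ (z - t) with hu
  have hu1 : ContDiff ℝ 1 u := (hφ.of_le (by norm_num)).comp (contDiff_const.sub contDiff_id)
  have huc : HasCompactSupport u := hc.comp_homeomorph (Homeomorph.subLeft z)
  have hud : ∀ t h, fderiv ℝ u t h = - fderiv ℝ φ (z - t) h := by
    intro t h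
    have := (hd (z - t)).hasFDerivAt.comp t ((hasFDerivAt_id (𝕜 := ℝ) t).const_sub z)
    have h3 : fderiv ℝ u t = _ := this.fderiv
    rw [h3]; simp
  have hp := pompeiu0 u hu1 huc
  rw [dzb, CT_fderiv hφ hc, CT_fderiv hφ hc, ← integral_const_mul, ← integral_add (hi _)
    ((hi _).const_mul _), ← integral_div]
  have h0 : u 0 = φ z := by simp [hu]
  rw [h0] at hp
  have hpi : (Real.pi : ℂ) ≠ 0 := by exact_mod_cast Real.pi_pos.ne'
  have : φ z = - ((Real.pi : ℂ)⁻¹ * ∫ t, t⁻¹ * dzb u t) := by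
    rw [hp]; field_simp
  rw [this, ← integral_const_mul, ← integral_neg]
  congr 1
  funext t
  rw [dzb, hud, hud, ck, mul_inv]
  ring

lemma CT_bound {φ : ℂ → ℂ} (hφ : Continuous φ) (h9 : ∀ z, 9 < ‖z‖ → φ z = 0) (z : ℂ)
    (hz : 10 ≤ ‖z‖) : ‖CT φ z‖ ≤ ∫ t, ‖φ t‖ := by
  have hc : HasCompactSupport φ := hcs_of_zero 9 h9
  have hi : Integrable φ := hφ.integrable_of_hasCompactSupport hc
  calc ‖CT φ z‖ ≤ ∫ t, ‖ck t * φ (z - t)‖ := norm_integral_le_integral_norm _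
    _ ≤ ∫ t, ‖φ (z - t)‖ := by
        refine integral_mono_of_nonneg (Filter.Eventually.of_forall fun t => norm_nonneg _)
          (hi.comp_sub_left z).norm (Filter.Eventually.of_forall fun t => ?_)
        simp only [norm_mul]
        by_cases ht : 9 < ‖z - t‖
        · simp [h9 _ ht]
        · have h1 : 1 ≤ ‖t‖ := by
            have := norm_sub_norm_le z (z - t)
            rw [sub_sub_cancel] at this
            push Not at ht
            linarith
          have h2 : ‖ck t‖ ≤ 1 := by
            rw [ck_norm]
            have : Real.pi⁻¹ ≤ 1 := inv_le_one_of_one_le₀ (by linarith [Real.pi_gt_three])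
            have h4 : ‖t‖⁻¹ ≤ 1 := inv_le_one_of_one_le₀ h1
            exact mul_le_one₀ this (by positivity) h4
          calc _ ≤ 1 * ‖φ (z - t)‖ := by gcongr
            _ = _ := one_mul _
    _ = ∫ t, ‖φ t‖ := integral_sub_left_eq_self (fun t => ‖φ t‖) volume z

end RPD

namespace RPD
open Set Metric
open scoped ENNReal

lemma sq_int_le {S : Set ℂ} (hS : volume S ≠ ∞) (hS0 : 0 < volume.real S) {u : ℂ → ℝ}
    (hu : IntegrableOn u S) (hu2 : IntegrableOn (fun z => u z ^ 2) S) :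
    (∫ z in S, u z) ^ 2 ≤ volume.real S * ∫ z in S, u z ^ 2 := by
  set I := ∫ z in S, u z with hI
  set V := volume.real S with hV
  have hc : IntegrableOn (fun _ : ℂ => (I / V) ^ 2) S := integrableOn_const hS
  have h0 : 0 ≤ ∫ z in S, (u z - I / V) ^ 2 := integral_nonneg fun z => sq_nonneg _
  have h1 : ∫ z in S, (u z - I / V) ^ 2 = (∫ z in S, u z ^ 2) - 2 * (I / V) * I + V * (I / V) ^ 2 := by
    have : ∀ z, (u z - I / V) ^ 2 = (u z ^ 2 - 2 * (I / V) * u z) + (I / V) ^ 2 := fun z => by ring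
    simp only [this]
    have h2 : IntegrableOn (fun z => u z ^ 2 - 2 * (I / V) * u z) S := hu2.sub (hu.const_mul _)
    rw [integral_add h2 hc, integral_sub hu2 (hu.const_mul _), integral_const_mul,
      setIntegral_const, smul_eq_mul]
  have h2 : V * (I / V) ^ 2 = I ^ 2 / V := by field_simp
  have h3 : 2 * (I / V) * I = 2 * (I ^ 2 / V) := by ring
  rw [h1, h2, h3] at h0
  have h4 : I ^ 2 / V ≤ ∫ z in S, u z ^ 2 := by linarith
  rw [div_le_iff₀ hS0] at h4
  linarith

lemma vol_cbC (z : ℂ) (r : ℝ) (hr : 0 ≤ r) : volume.real (closedBall z r) = Real.pi * r ^ 2 := by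
  rw [Measure.real, Complex.volume_closedBall, ENNReal.toReal_mul, ENNReal.toReal_pow,
    ENNReal.toReal_ofReal hr]
  simp [NNReal.coe_real_pi]; ring

lemma vol_bC (z : ℂ) (r : ℝ) (hr : 0 ≤ r) : volume.real (ball z r) = Real.pi * r ^ 2 := by
  rw [Measure.real, Complex.volume_ball, ENNReal.toReal_mul, ENNReal.toReal_pow,
    ENNReal.toReal_ofReal hr]
  simp [NNReal.coe_real_pi]; ring

lemma intOn_cb {F : ℂ → ℝ} (hF : Continuous F) (z : ℂ) (r : ℝ) : IntegrableOn F (closedBall z r) :=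
  hF.continuousOn.integrableOn_compact (isCompact_closedBall z r)

lemma cauchy_L2 : ∃ C : ℝ, 0 ≤ C ∧ ∀ φ : ℂ → ℂ, ContDiff ℝ 2 φ → (∀ z, 9 < ‖z‖ → φ z = 0) →
    ∃ w : ℂ → ℂ, ContDiff ℝ 2 w ∧ (∀ z, dzb w z = φ z) ∧
      ∫ z in closedBall (0:ℂ) 9, ‖dz w z‖ ^ 2 ≤ C * ∫ z in closedBall (0:ℂ) 9, ‖φ z‖ ^ 2 := by
  let ζ : ContDiffBump (0 : ℂ) := ⟨10, 11, by norm_num, by norm_num⟩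
  set c : ℂ → ℂ := fun z => ((ζ z : ℝ) : ℂ) with hcdef
  have hcC : ContDiff ℝ 2 c := Complex.ofRealCLM.contDiff.comp ζ.contDiff
  have hc1 : ∀ z, ‖z‖ < 10 → c =ᶠ[𝓝 z] fun _ => 1 := by
    intro z hz
    filter_upwards [(isOpen_lt continuous_norm continuous_const).mem_nhds hz] with y hy
    have hyy : ‖y‖ < 10 := hy
    have : ζ y = 1 := ζ.one_of_mem_closedBall (by simpa [ζ] using hyy.le)
    simp [hcdef, this]
  have hc0 : ∀ z, 11 < ‖z‖ → c z = 0 := by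
    intro z hz
    have : ζ z = 0 := ζ.zero_of_le_dist (by simpa [ζ] using hz.le)
    simp [hcdef, this]
  obtain ⟨K, hK⟩ : ∃ K, ∀ z, ‖dzb c z‖ ≤ K := by
    refine (continuous_dzb (hcC.of_le (by norm_num))).bounded_above_of_compact_support ?_
    exact hcs_of_zero 11 fun z hz => by simp [dzb, dz_zero_of hc0 z hz]
  refine ⟨1 + K ^ 2 * (Real.pi * 11 ^ 2) * (Real.pi * 9 ^ 2), by positivity, fun φ hφ h9 => ?_⟩
  have hφc : HasCompactSupport φ := hcs_of_zero 9 h9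
  set w := CT φ with hw
  have hwC : ContDiff ℝ 2 w := CT_contDiff hφ hφc
  have hwd : Differentiable ℝ w := hwC.differentiable (by norm_num)
  have hcd : Differentiable ℝ c := hcC.differentiable (by norm_num)
  have hwb : ∀ z, dzb w z = φ z := CT_dzb hφ hφc
  refine ⟨w, hwC, hwb, ?_⟩
  set v : ℂ → ℂ := fun z => c z * w z with hv
  have hvC : ContDiff ℝ 2 v := hcC.mul hwC
  have hv0 : ∀ z, 11 < ‖z‖ → v z = 0 := fun z hz => by simp [hv, hc0 z hz]
  have hvd : ∀ z h, fderiv ℝ v z h = c z * fderiv ℝ w z h + w z * fderiv ℝ c z h := by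
    intro z h
    have : HasFDerivAt v _ z := (hcd z).hasFDerivAt.mul (hwd z).hasFDerivAt
    rw [this.fderiv]; simp
  have hvw : ∀ z, ‖z‖ < 10 → fderiv ℝ v z = fderiv ℝ w z := by
    intro z hz
    apply Filter.EventuallyEq.fderiv_eq
    filter_upwards [hc1 z hz] with y hy
    simp [hv, hy]
  set N := ∫ t, ‖φ t‖ with hN
  have hN0 : 0 ≤ N := integral_nonneg fun _ => norm_nonneg _
  have hiv : Integrable fun z => ‖dz v z‖ ^ 2 := by
    refine Continuous.integrable_of_hasCompactSupport
      ((continuous_dz (hvC.of_le (by norm_num))).norm.pow 2) (hcs_of_zero 11 fun z hz => ?_)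
    simp [dz, dz_zero_of hv0 z hz]
  have hiφ : Integrable fun z => ‖φ z‖ ^ 2 := by
    refine Continuous.integrable_of_hasCompactSupport (hφ.continuous.norm.pow 2)
      (hcs_of_zero 9 fun z hz => ?_)
    simp [h9 z hz]
  have hset : ∀ F : ℂ → ℝ, (∀ z, 9 < ‖z‖ → F z = 0) → ∫ z, F z = ∫ z in closedBall (0:ℂ) 9, F z := by
    intro F hF
    rw [setIntegral_eq_integral_of_forall_compl_eq_zero]
    intro z hz; exact hF z (by simpa using hz)
  have hpt : ∀ z, ‖dzb v z‖ ^ 2 ≤ ‖φ z‖ ^ 2 +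
      (closedBall (0:ℂ) 11).indicator (fun _ => (K * N) ^ 2) z := by
    intro z
    rcases lt_or_ge ‖z‖ 10 with hz | hz
    · have : dzb v z = φ z := by rw [dzb, hvw z hz, ← hwb z, dzb]
      rw [this]
      have : 0 ≤ (closedBall (0:ℂ) 11).indicator (fun _ => (K * N) ^ 2) z :=
        indicator_nonneg (fun _ _ => sq_nonneg _) z
      linarith
    · by_cases h11 : 11 < ‖z‖
      · have h1 : dzb v z = 0 := by simp [dzb, dz_zero_of hv0 z h11]
        have : 0 ≤ (closedBall (0:ℂ) 11).indicator (fun _ => (K * N) ^ 2) z :=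
          indicator_nonneg (fun _ _ => sq_nonneg _) z
        rw [h1, norm_zero]; have := sq_nonneg ‖φ z‖; norm_num; linarith
      · rw [indicator_of_mem (by simpa using h11)]
        have h1 : dzb v z = c z * dzb w z + w z * dzb c z := by
          rw [dzb, hvd, hvd, dzb, dzb]; ring
        have h2 : φ z = 0 := h9 z (by linarith)
        rw [h1, hwb, h2, mul_zero, zero_add, norm_zero, norm_mul]
        have h3 := CT_bound hφ.continuous h9 z hz
        have h4 : ‖w z‖ * ‖dzb c z‖ ≤ K * N := by
          rw [mul_comm K]
          exact mul_le_mul h3 (hK z) (norm_nonneg _) hN0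
        have : 0 ≤ ‖w z‖ * ‖dzb c z‖ := by positivity
        nlinarith
  have hNsq : N ^ 2 ≤ (Real.pi * 9 ^ 2) * ∫ z in closedBall (0:ℂ) 9, ‖φ z‖ ^ 2 := by
    rw [hN, hset _ (fun z hz => by simp [h9 z hz])]
    have hv9 := vol_cbC 0 9 (by norm_num)
    have := sq_int_le (S := closedBall (0:ℂ) 9) measure_closedBall_lt_top.ne
      (by rw [hv9]; positivity) (intOn_cb hφ.continuous.norm 0 9)
      (intOn_cb (hφ.continuous.norm.pow 2) 0 9)
    rwa [hv9] at this
  calc ∫ z in closedBall (0:ℂ) 9, ‖dz w z‖ ^ 2 = ∫ z in closedBall (0:ℂ) 9, ‖dz v z‖ ^ 2 := by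
        refine setIntegral_congr_fun measurableSet_closedBall fun z hz => ?_
        have : ‖z‖ < 10 := by
          have : ‖z‖ ≤ 9 := by simpa using hz
          linarith
        simp only [dz, hvw z this]
    _ ≤ ∫ z, ‖dz v z‖ ^ 2 := setIntegral_le_integral hiv
        (Filter.Eventually.of_forall fun z => sq_nonneg _)
    _ = ∫ z, ‖dzb v z‖ ^ 2 := int_dz_eq hvC hv0
    _ ≤ ∫ z, (‖φ z‖ ^ 2 + (closedBall (0:ℂ) 11).indicator (fun _ => (K * N) ^ 2) z) := by
        refine integral_mono_of_nonneg (Filter.Eventually.of_forall fun z => sq_nonneg _) ?_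
          (Filter.Eventually.of_forall hpt)
        refine hiφ.add ?_
        exact (integrable_indicator_iff measurableSet_closedBall).2
          (integrableOn_const measure_closedBall_lt_top.ne)
    _ = (∫ z, ‖φ z‖ ^ 2) + Real.pi * 11 ^ 2 * (K * N) ^ 2 := by
        rw [integral_add hiφ ((integrable_indicator_iff measurableSet_closedBall).2
          (integrableOn_const measure_closedBall_lt_top.ne)),
          integral_indicator measurableSet_closedBall, setIntegral_const, smul_eq_mul,
          vol_cbC 0 11 (by norm_num)]
    _ = (∫ z in closedBall (0:ℂ) 9, ‖φ z‖ ^ 2) + Real.pi * 11 ^ 2 * K ^ 2 * N ^ 2 := by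
        rw [hset _ (fun z hz => by simp [h9 z hz])]; ring
    _ ≤ (∫ z in closedBall (0:ℂ) 9, ‖φ z‖ ^ 2) + Real.pi * 11 ^ 2 * K ^ 2 *
        ((Real.pi * 9 ^ 2) * ∫ z in closedBall (0:ℂ) 9, ‖φ z‖ ^ 2) := by gcongr
    _ = _ := by ring

/-- Area mean value property. -/
lemma area_mean {H : ℂ → ℂ} (hH : Continuous H) (z : ℂ)
    (hd : DifferentiableOn ℂ H (ball z 1)) : ∫ t in ball z 1, H t = Real.pi * H z := by
  have h0 : ∫ t in ball z 1, H t = ∫ t, (ball (0:ℂ) 1).indicator (fun t => H (z + t)) t := by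
    rw [← integral_indicator measurableSet_ball, ← integral_add_left_eq_self _ z]
    congr 1; funext t
    simp only [indicator, mem_ball, dist_self_add_left, dist_zero_right]
  rw [h0, ← Complex.integral_comp_polarCoord_symm]
  set G : ℝ × ℝ → ℂ := fun p => (p.1 : ℂ) * H (z + p.1 * Complex.exp (p.2 * Complex.I)) with hG
  have hGc : Continuous G := by
    have : Continuous fun p : ℝ × ℝ => z + p.1 * Complex.exp (p.2 * Complex.I) := by fun_prop
    exact (Complex.continuous_ofReal.comp continuous_fst).mul (hH.comp this)
  have h1 : ∫ p in polarCoord.target, p.1 • (ball (0:ℂ) 1).indicator (fun t => H (z + t))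
      (Complex.polarCoord.symm p) = ∫ p in Ioo (0:ℝ) 1 ×ˢ Ioo (-Real.pi) Real.pi, G p := by
    rw [← integral_indicator (measurableSet_Ioo.prod measurableSet_Ioo),
      ← integral_indicator (polarCoord.open_target.measurableSet)]
    congr 1; funext ⟨r, θ⟩
    simp only [indicator, polarCoord_target, mem_prod, mem_Ioi, mem_Ioo, polar_symm, mem_ball,
      dist_zero_right, norm_mul, Complex.norm_exp_ofReal_mul_I, mul_one, Complex.norm_real,
      Real.norm_eq_abs]
    by_cases hr : 0 < r
    · by_cases hr1 : r < 1
      · by_cases hθ : -Real.pi < θ ∧ θ < Real.pi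
        · simp [hr, hr1, hθ, abs_of_pos hr, hG]
        · simp [hr, hr1, hθ]
      · simp [hr, hr1, abs_of_pos hr]
    · simp [hr]
  rw [h1]
  have hi : IntegrableOn G (Ioo (0:ℝ) 1 ×ˢ Ioo (-Real.pi) Real.pi) (volume.prod volume) :=
    (hGc.continuousOn.integrableOn_compact (isCompact_Icc.prod isCompact_Icc)).mono_set
      (prod_mono Ioo_subset_Icc_self Ioo_subset_Icc_self)
  have h2 : ∫ p in Ioo (0:ℝ) 1 ×ˢ Ioo (-Real.pi) Real.pi, G p =
      ∫ r in Ioo (0:ℝ) 1, ∫ θ in Ioo (-Real.pi) Real.pi, G (r, θ) := setIntegral_prod _ hi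
  rw [h2]
  have h3 : ∀ r ∈ Ioo (0:ℝ) 1, ∫ θ in Ioo (-Real.pi) Real.pi, G (r, θ) =
      ((2 * Real.pi * r : ℝ) : ℂ) * H z := by
    intro r hr
    have hm : Real.circleAverage H z r = H z := by
      apply DiffContOnCl.circleAverage
      rw [abs_of_pos hr.1]
      refine ⟨hd.mono (ball_subset_ball hr.2.le), hH.continuousOn⟩
    rw [Real.circleAverage_eq_integral_add (-Real.pi),
      intervalIntegral.integral_comp_add_right (fun θ => H (circleMap z r θ)), zero_add,
      show 2 * Real.pi + -Real.pi = Real.pi by ring,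
      intervalIntegral.integral_of_le (by linarith [Real.pi_pos]),
      integral_Ioc_eq_integral_Ioo] at hm
    simp only [hG, integral_const_mul]
    rw [← hm, Complex.real_smul]
    simp only [circleMap]
    have hpi : (Real.pi : ℂ) ≠ 0 := by exact_mod_cast Real.pi_pos.ne'
    push_cast
    generalize (∫ a in Ioo (-Real.pi) Real.pi, H (z + r * Complex.exp (a * Complex.I))) = J
    field_simp
  rw [setIntegral_congr_fun measurableSet_Ioo h3, integral_mul_const,
    integral_complex_ofReal, integral_const_mul, ← integral_Ioc_eq_integral_Ioo,
    ← intervalIntegral.integral_of_le (by norm_num), integral_id]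
  push_cast
  ring

end RPD

namespace RPD
open Set Metric
open scoped ENNReal

lemma holo_rigid {H : ℂ → ℂ} (hH : Continuous H) (hd : DifferentiableOn ℂ H (ball 0 8))
    {δ : ℝ} (hδ : 0 < δ) (hI : ∫ z in closedBall (0:ℂ) 8, (‖H z‖ - 1) ^ 2 ≤ δ ^ 2) :
    ∃ a : ℂ, ‖a‖ = 1 ∧ ∀ z ∈ closedBall (0:ℂ) 2, ‖H z - a‖ ≤ 27 * δ := by
  have hpi := Real.pi_gt_three
  have hcont : Continuous fun z => (‖H z‖ - 1) ^ 2 := by fun_prop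
  have hsub : ∀ S : Set ℂ, S ⊆ closedBall 0 8 → ∫ z in S, (‖H z‖ - 1) ^ 2 ≤ δ ^ 2 := fun S hS =>
    (setIntegral_mono_set (intOn_cb hcont 0 8) (Filter.Eventually.of_forall fun z => sq_nonneg _)
      (Filter.Eventually.of_forall hS)).trans hI
  have hup : ∀ z, ‖z‖ ≤ 7 → ‖H z‖ ≤ 1 + δ := by
    intro z hz
    have hb : ball z 1 ⊆ ball 0 8 := ball_subset_ball' (by simp; linarith)
    have hb' : ball z 1 ⊆ closedBall 0 8 := hb.trans ball_subset_closedBall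
    have h1 := area_mean hH z (hd.mono hb)
    have hic : ∀ F : ℂ → ℝ, Continuous F → IntegrableOn F (ball z 1) := fun F hF =>
      (intOn_cb hF z 1).mono_set ball_subset_closedBall
    have h2 : Real.pi * ‖H z‖ ≤ ∫ t in ball z 1, ‖H t‖ := by
      have := norm_integral_le_integral_norm (μ := volume.restrict (ball z 1)) H
      rw [h1, norm_mul, Complex.norm_real, Real.norm_of_nonneg Real.pi_pos.le] at this
      exact this
    have h3 : ∫ t in ball z 1, ‖H t‖ ≤ ∫ t in ball z 1, ((2 * δ)⁻¹ * (‖H t‖ - 1) ^ 2 +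
        (1 + δ / 2)) := by
      refine setIntegral_mono (hic _ (by fun_prop)) (hic _ (by fun_prop)) fun t => ?_
      have h5 : 0 ≤ (2 * δ)⁻¹ * ((‖H t‖ - 1) - δ) ^ 2 := by positivity
      have h6 : (2 * δ)⁻¹ * ((‖H t‖ - 1) - δ) ^ 2 =
        (2 * δ)⁻¹ * (‖H t‖ - 1) ^ 2 - (‖H t‖ - 1) + δ / 2 := by field_simp; ring
      show ‖H t‖ ≤ (2 * δ)⁻¹ * (‖H t‖ - 1) ^ 2 + (1 + δ / 2)
      linarith
    rw [integral_add (hic _ (by fun_prop)) (hic _ (by fun_prop)), integral_const_mul,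
      setIntegral_const, vol_bC z 1 (by norm_num), smul_eq_mul] at h3
    have h4 := hsub _ hb'
    have h5 : (2 * δ)⁻¹ * ∫ t in ball z 1, (‖H t‖ - 1) ^ 2 ≤ δ / 2 := by
      calc _ ≤ (2 * δ)⁻¹ * δ ^ 2 := by gcongr
        _ = δ / 2 := by field_simp
    have h6 : Real.pi * ‖H z‖ ≤ Real.pi * (1 + δ) := by nlinarith
    exact le_of_mul_le_mul_left h6 Real.pi_pos
  obtain ⟨z0, hz0, hlow⟩ : ∃ z0 ∈ closedBall (0:ℂ) 2, 1 - δ ≤ ‖H z0‖ := by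
    by_contra hcon
    push Not at hcon
    have h1 : ∫ z in closedBall (0:ℂ) 2, δ ^ 2 ≤ ∫ z in closedBall (0:ℂ) 2, (‖H z‖ - 1) ^ 2 := by
      refine setIntegral_mono_on (intOn_cb continuous_const 0 2) (intOn_cb hcont 0 2)
        measurableSet_closedBall fun z hz => ?_
      have := hcon z hz
      nlinarith
    rw [setIntegral_const, vol_cbC 0 2 (by norm_num), smul_eq_mul] at h1
    have h2 := hsub (closedBall 0 2) (closedBall_subset_closedBall (by norm_num))
    have : 0 < δ ^ 2 := by positivity
    nlinarith
  have hz0' : ‖z0‖ ≤ 2 := by simpa using hz0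
  obtain ⟨a, ha, haH⟩ : ∃ a : ℂ, ‖a‖ = 1 ∧ (starRingEnd ℂ) a * H z0 = (‖H z0‖ : ℂ) := by
    by_cases h0 : H z0 = 0
    · exact ⟨1, by simp, by simp [h0]⟩
    · have hn : (‖H z0‖ : ℂ) ≠ 0 := by exact_mod_cast (norm_ne_zero_iff.2 h0)
      refine ⟨H z0 / ‖H z0‖, ?_, ?_⟩
      · rw [norm_div, Complex.norm_real, norm_norm, div_self (norm_ne_zero_iff.2 h0)]
      · rw [map_div₀, Complex.conj_ofReal, div_mul_eq_mul_div, mul_comm, Complex.mul_conj,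
          Complex.normSq_eq_norm_sq, div_eq_iff hn]
        push_cast; ring
  refine ⟨a, ha, fun z hz => ?_⟩
  have hz2 : ‖z‖ ≤ 2 := by simpa using hz
  set G : ℂ → ℂ := fun t => (starRingEnd ℂ) a * H (z0 + t) - (1 + δ : ℝ) with hG
  have hca : ‖(starRingEnd ℂ) a‖ = 1 := by rw [RCLike.norm_conj, ha]
  have hGd : DifferentiableOn ℂ G (ball 0 5) := by
    refine DifferentiableOn.sub_const (DifferentiableOn.const_mul ?_ _) _
    refine hd.comp (by fun_prop) fun t ht => ?_
    have : ‖t‖ < 5 := by simpa using ht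
    have h2 := norm_add_le z0 t
    simp only [mem_ball, dist_zero_right]; linarith
  have hmaps : MapsTo G (ball 0 5) {z | z.re ≤ δ} := by
    intro t ht
    have h1 : ‖t‖ < 5 := by simpa using ht
    have h2 := norm_add_le z0 t
    have h3 := hup (z0 + t) (by linarith)
    have h4 := Complex.re_le_norm ((starRingEnd ℂ) a * H (z0 + t))
    rw [norm_mul, hca, one_mul] at h4
    show (G t).re ≤ δ
    simp only [hG, Complex.sub_re, Complex.ofReal_re]
    linarith
  have hn : ‖z - z0‖ ≤ 4 := (norm_sub_le _ _).trans (by linarith)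
  have hBC := Complex.borelCaratheodory hδ hGd hmaps (by norm_num)
    (show z - z0 ∈ ball (0:ℂ) 5 by simp; linarith)
  have hG0 : ‖G 0‖ ≤ 2 * δ := by
    have : G 0 = ((‖H z0‖ - (1 + δ) : ℝ) : ℂ) := by
      simp only [hG, add_zero, haH]; push_cast; ring
    rw [this, Complex.norm_real, Real.norm_eq_abs, abs_le]
    have := hup z0 (by linarith)
    constructor <;> linarith
  have hGz : ‖G (z - z0)‖ ≤ 26 * δ := by
    refine hBC.trans ?_
    have h5 : 0 < 5 - ‖z - z0‖ := by linarith
    rw [← add_div, div_le_iff₀ h5]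
    have h6 := norm_nonneg (z - z0)
    have h7 := norm_nonneg (G 0)
    nlinarith
  have hfin : H z - a = a * (G (z - z0) + (δ : ℂ)) := by
    have haa : a * (starRingEnd ℂ) a = 1 := by
      rw [Complex.mul_conj, Complex.normSq_eq_norm_sq, ha]; norm_num
    simp only [hG, add_sub_cancel]
    push_cast
    linear_combination (-H z) * haa
  rw [hfin, norm_mul, ha, one_mul]
  refine (norm_add_le _ _).trans ?_
  rw [Complex.norm_real, Real.norm_of_nonneg hδ.le]
  linarith

/-- The pointwise deviation. -/
def dev (Ψ : ℂ → ℂ) (z : ℂ) : ℝ := ‖dzb Ψ z‖ + |‖dz Ψ z‖ - 1|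

lemma smooth_rigid : ∃ C : ℝ, 0 ≤ C ∧ ∀ Ψ : ℂ → ℂ, ContDiff ℝ 3 Ψ → ∀ δ > (0:ℝ),
    ∃ a : ℂ, ‖a‖ = 1 ∧ ∫ z in closedBall (0:ℂ) 2, ‖dz Ψ z - a‖ ^ 2 ≤
      C * ((∫ z in closedBall (0:ℂ) 9, dev Ψ z ^ 2) + δ) := by
  obtain ⟨C0, hC0, hcau⟩ := cauchy_L2
  have hpi := Real.pi_pos
  refine ⟨2 * (729 * (2 * (1 + C0) + 1)) * (Real.pi * 4) + 2 * C0, by positivity,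
    fun Ψ hΨ δ hδ => ?_⟩
  let χ : ContDiffBump (0 : ℂ) := ⟨8, 9, by norm_num, by norm_num⟩
  have hΨ1 : ContDiff ℝ 1 Ψ := hΨ.of_le (by norm_num)
  have hdzbC : ContDiff ℝ 2 (dzb Ψ) := by
    have h : ContDiff ℝ 2 (fderiv ℝ Ψ) := hΨ.fderiv_right (by norm_num)
    unfold dzb
    exact ((h.clm_apply contDiff_const).add (contDiff_const.mul
      (h.clm_apply contDiff_const))).div_const 2
  set φ : ℂ → ℂ := fun z => ((χ z : ℝ) : ℂ) * dzb Ψ z with hφ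
  have hφC : ContDiff ℝ 2 φ := (Complex.ofRealCLM.contDiff.comp χ.contDiff).mul hdzbC
  have hφ9 : ∀ z, 9 < ‖z‖ → φ z = 0 := by
    intro z hz
    have : χ z = 0 := χ.zero_of_le_dist (by simpa [χ] using hz.le)
    simp [hφ, this]
  obtain ⟨w, hwC, hwb, hwL⟩ := hcau φ hφC hφ9
  have hw1 : ContDiff ℝ 1 w := hwC.of_le (by norm_num)
  set E := ∫ z in closedBall (0:ℂ) 9, dev Ψ z ^ 2 with hE
  have hdevc : Continuous (dev Ψ) := by
    have h1 := continuous_dz hΨ1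
    have h2 := continuous_dzb hΨ1
    unfold dev; fun_prop
  have hE0 : 0 ≤ E := integral_nonneg fun _ => sq_nonneg _
  have hφE : ∫ z in closedBall (0:ℂ) 9, ‖φ z‖ ^ 2 ≤ E := by
    refine setIntegral_mono (intOn_cb (hφC.continuous.norm.pow 2) 0 9)
      (intOn_cb (hdevc.pow 2) 0 9) fun z => ?_
    have h1 : ‖φ z‖ ≤ dev Ψ z := by
      simp only [hφ, norm_mul, Complex.norm_real, Real.norm_of_nonneg χ.nonneg, dev]
      have : χ z * ‖dzb Ψ z‖ ≤ 1 * ‖dzb Ψ z‖ := by gcongr; exact χ.le_one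
      have h2 := abs_nonneg (‖dz Ψ z‖ - 1)
      linarith
    exact pow_le_pow_left₀ (norm_nonneg _) h1 2
  have hwE : ∫ z in closedBall (0:ℂ) 9, ‖dz w z‖ ^ 2 ≤ C0 * E := hwL.trans (by gcongr)
  set h : ℂ → ℂ := fun z => Ψ z - w z with hh
  have hhC : ContDiff ℝ 1 h := hΨ1.sub hw1
  have hhd : Differentiable ℝ h := hhC.differentiable one_ne_zero
  have hfd : ∀ z, fderiv ℝ h z = fderiv ℝ Ψ z - fderiv ℝ w z := fun z =>
    fderiv_fun_sub (hΨ1.differentiable one_ne_zero z) (hw1.differentiable one_ne_zero z)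
  have hdzh : ∀ z, dz h z = dz Ψ z - dz w z := fun z => by
    simp only [dz, hfd, _root_.sub_apply]; ring
  have hdzbh : ∀ z ∈ ball (0:ℂ) 8, dzb h z = 0 := fun z hz => by
    have h1 : dzb h z = dzb Ψ z - dzb w z := by
      simp only [dzb, hfd, _root_.sub_apply]; ring
    have h2 : χ z = 1 := χ.one_of_mem_closedBall (ball_subset_closedBall hz)
    rw [h1, hwb]; simp [hφ, h2]
  have hdiff : DifferentiableOn ℂ h (ball 0 8) := by
    intro z hz
    apply DifferentiableAt.differentiableWithinAt
    rw [differentiableAt_complex_iff_differentiableAt_real]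
    refine ⟨hhd z, ?_⟩
    have := hdzbh z hz
    simp only [dzb] at this
    rw [smul_eq_mul]
    linear_combination (-2 * Complex.I) * this + (fderiv ℝ h z Complex.I) * Complex.I_sq
  have hderiv : ∀ z ∈ ball (0:ℂ) 8, dz h z = deriv h z := by
    intro z hz
    have h1 := (hdiff z hz).differentiableAt (isOpen_ball.mem_nhds hz)
    have h2 := h1.fderiv_restrictScalars ℝ
    have h3 : ∀ t, fderiv ℝ h z t = t * deriv h z := fun t => by
      rw [h2]; simp [fderiv_eq_smul_deriv]
    simp only [dz, h3]
    linear_combination (-(deriv h z) / 2) * Complex.I_sq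
  have hHd : DifferentiableOn ℂ (dz h) (ball 0 8) :=
    (hdiff.deriv isOpen_ball).congr hderiv
  have hHc : Continuous (dz h) := continuous_dz hhC
  have hdwc : Continuous (dz w) := continuous_dz hw1
  have hdΨc : Continuous (dz Ψ) := continuous_dz hΨ1
  set δ' := Real.sqrt (2 * (1 + C0) * E + δ) with hδ'
  have hpos : 0 < 2 * (1 + C0) * E + δ := by positivity
  have hδ'sq : δ' ^ 2 = 2 * (1 + C0) * E + δ := Real.sq_sqrt hpos.le
  obtain ⟨a, ha, hest⟩ := holo_rigid hHc hHd (Real.sqrt_pos.2 hpos) (by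
    rw [← hδ', hδ'sq]
    calc ∫ z in closedBall (0:ℂ) 8, (‖dz h z‖ - 1) ^ 2
        ≤ ∫ z in closedBall (0:ℂ) 9, (‖dz h z‖ - 1) ^ 2 :=
          setIntegral_mono_set (intOn_cb (by fun_prop) 0 9)
            (Filter.Eventually.of_forall fun z => sq_nonneg _)
            (Filter.Eventually.of_forall (closedBall_subset_closedBall (by norm_num)))
      _ ≤ ∫ z in closedBall (0:ℂ) 9, (2 * dev Ψ z ^ 2 + 2 * ‖dz w z‖ ^ 2) := by
          refine setIntegral_mono (intOn_cb (by fun_prop) 0 9) (intOn_cb (by fun_prop) 0 9)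
            fun z => ?_
          show (‖dz h z‖ - 1) ^ 2 ≤ 2 * dev Ψ z ^ 2 + 2 * ‖dz w z‖ ^ 2
          have h1 : |‖dz h z‖ - 1| ≤ dev Ψ z + ‖dz w z‖ := by
            have h2 : |‖dz h z‖ - ‖dz Ψ z‖| ≤ ‖dz w z‖ := by
              have := abs_norm_sub_norm_le (dz h z) (dz Ψ z)
              rwa [hdzh z, sub_sub_cancel_left, norm_neg, ← hdzh z] at this
            have h3 : |‖dz Ψ z‖ - 1| ≤ dev Ψ z := by
              unfold dev; linarith [norm_nonneg (dzb Ψ z)]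
            have h4 := abs_add_le (‖dz h z‖ - ‖dz Ψ z‖) (‖dz Ψ z‖ - 1)
            rw [sub_add_sub_cancel] at h4
            linarith
          rw [← sq_abs]
          have := pow_le_pow_left₀ (abs_nonneg _) h1 2
          nlinarith [sq_nonneg (dev Ψ z - ‖dz w z‖)]
      _ = 2 * E + 2 * ∫ z in closedBall (0:ℂ) 9, ‖dz w z‖ ^ 2 := by
          rw [integral_add (intOn_cb (by fun_prop) 0 9) (intOn_cb (by fun_prop) 0 9),
            integral_const_mul, integral_const_mul]
      _ ≤ _ := by linarith)
  rw [← hδ'] at hest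
  refine ⟨a, ha, ?_⟩
  calc ∫ z in closedBall (0:ℂ) 2, ‖dz Ψ z - a‖ ^ 2
      ≤ ∫ z in closedBall (0:ℂ) 2, (2 * (729 * δ' ^ 2) + 2 * ‖dz w z‖ ^ 2) := by
        refine setIntegral_mono_on (intOn_cb (by fun_prop) 0 2) (intOn_cb (by fun_prop) 0 2)
          measurableSet_closedBall fun z hz => ?_
        have h1 : ‖dz Ψ z - a‖ ≤ 27 * δ' + ‖dz w z‖ := by
          have : dz Ψ z - a = (dz h z - a) + dz w z := by rw [hdzh]; ring
          rw [this]
          exact (norm_add_le _ _).trans (by linarith [hest z hz])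
        have := pow_le_pow_left₀ (norm_nonneg _) h1 2
        nlinarith [sq_nonneg (27 * δ' - ‖dz w z‖)]
    _ = 2 * (729 * δ' ^ 2) * (Real.pi * 4) + 2 * ∫ z in closedBall (0:ℂ) 2, ‖dz w z‖ ^ 2 := by
        rw [integral_add (intOn_cb (by fun_prop) 0 2) (intOn_cb (by fun_prop) 0 2),
          setIntegral_const, integral_const_mul, vol_cbC 0 2 (by norm_num), smul_eq_mul]
        ring
    _ ≤ 2 * (729 * δ' ^ 2) * (Real.pi * 4) + 2 * (C0 * E) := by
        have : ∫ z in closedBall (0:ℂ) 2, ‖dz w z‖ ^ 2 ≤ ∫ z in closedBall (0:ℂ) 9, ‖dz w z‖ ^ 2 :=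
          setIntegral_mono_set (intOn_cb (by fun_prop) 0 9)
            (Filter.Eventually.of_forall fun z => sq_nonneg _)
            (Filter.Eventually.of_forall (closedBall_subset_closedBall (by norm_num)))
        linarith
    _ ≤ _ := by
        rw [hδ'sq]
        have h1 : 2 * (1 + C0) * E + δ ≤ (2 * (1 + C0) + 1) * (E + δ) := by
          nlinarith [mul_nonneg hC0 hδ.le]
        have h2 : 2 * (C0 * E) ≤ 2 * C0 * (E + δ) := by nlinarith [mul_nonneg hC0 hδ.le]
        calc _ ≤ 2 * (729 * ((2 * (1 + C0) + 1) * (E + δ))) * (Real.pi * 4) + 2 * C0 * (E + δ) := by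
              gcongr
          _ = _ := by ring

end RPD

namespace RPD
open Set Metric
open scoped ENNReal

lemma mollify {Ψ : ℂ → ℂ} (h1 : ContDiff ℝ 1 Ψ) (hc : HasCompactSupport Ψ) {ε : ℝ} (hε : 0 < ε) :
    ∃ Ψ' : ℂ → ℂ, ContDiff ℝ 3 Ψ' ∧ ∀ z, ‖fderiv ℝ Ψ' z - fderiv ℝ Ψ z‖ ≤ ε := by
  have hD : Continuous (fderiv ℝ Ψ) := h1.continuous_fderiv one_ne_zero
  have hu : UniformContinuous (fderiv ℝ Ψ) :=
    (hc.fderiv ℝ).uniformContinuous_of_continuous hD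
  obtain ⟨δ, hδ, hδ'⟩ := Metric.uniformContinuous_iff.1 hu ε hε
  let φ : ContDiffBump (0:ℂ) := ⟨δ / 2, δ, by positivity, by linarith⟩
  refine ⟨convolution (φ.normed volume) Ψ (ContinuousLinearMap.lsmul ℝ ℝ) volume, ?_, fun z => ?_⟩
  · exact HasCompactSupport.contDiff_convolution_left (n := 3) _ φ.hasCompactSupport_normed
      φ.contDiff_normed h1.continuous.locallyIntegrable
  · have h2 := (HasCompactSupport.hasFDerivAt_convolution_right (ContinuousLinearMap.lsmul ℝ ℝ)
      hc ((φ.continuous_normed (μ := volume)).locallyIntegrable (μ := volume)) h1 z).fderiv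
    rw [h2]
    have h3 : (ContinuousLinearMap.lsmul ℝ ℝ : ℝ →L[ℝ] ℂ →L[ℝ] ℂ).precompR ℂ =
        ContinuousLinearMap.lsmul ℝ ℝ := by
      ext; simp [ContinuousLinearMap.precompR]
    rw [h3, ← dist_eq_norm]
    exact φ.dist_normed_convolution_le hD.aestronglyMeasurable fun x hx => (hδ' hx).le

lemma c1_rigid : ∃ C : ℝ, 0 ≤ C ∧ ∀ Ψ : ℂ → ℂ, ContDiff ℝ 1 Ψ → HasCompactSupport Ψ →
    ∃ a : ℂ, ‖a‖ = 1 ∧ ∫ z in closedBall (0:ℂ) 2, ‖dz Ψ z - a‖ ^ 2 ≤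
      C * ∫ z in closedBall (0:ℂ) 9, dev Ψ z ^ 2 := by
  obtain ⟨C, hC, H⟩ := smooth_rigid
  refine ⟨4 * C, by positivity, fun Ψ h1 hc => ?_⟩
  have hdz := continuous_dz h1
  have hdzb := continuous_dzb h1
  have hdev : Continuous (dev Ψ) := by unfold dev; fun_prop
  have hcont : Continuous fun a : ℂ => ∫ z in closedBall (0:ℂ) 2, ‖dz Ψ z - a‖ ^ 2 :=
    continuous_parametric_integral_of_continuous
      (by unfold Function.uncurry; fun_prop) (isCompact_closedBall 0 2)
  obtain ⟨m, hm, hmin⟩ := (isCompact_sphere (0:ℂ) 1).exists_isMinOn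
    ⟨1, by simp⟩ hcont.continuousOn
  refine ⟨m, by simpa using hm, ?_⟩
  have hpi := Real.pi_pos
  set E := ∫ z in closedBall (0:ℂ) 9, dev Ψ z ^ 2 with hE
  set A := ∫ z in closedBall (0:ℂ) 2, ‖dz Ψ z - m‖ ^ 2 with hA
  set K := 2 * C * (8 * (Real.pi * 9 ^ 2) + 1) + 2 * (Real.pi * 2 ^ 2) with hK
  have hK0 : 0 < K := by positivity
  have key : ∀ ε : ℝ, 0 < ε → A ≤ 4 * C * E + K * ε ^ 2 := by
    intro ε hε
    obtain ⟨Ψ', h3, hcl⟩ := mollify h1 hc hε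
    obtain ⟨a, ha, hest⟩ := H Ψ' h3 (ε ^ 2) (by positivity)
    have h1' : ContDiff ℝ 1 Ψ' := h3.of_le (by norm_num)
    have hdz' := continuous_dz h1'
    have hdzb' := continuous_dzb h1'
    have hdev' : Continuous (dev Ψ') := by unfold dev; fun_prop
    have hb : ∀ z v, ‖v‖ = 1 → ‖fderiv ℝ Ψ' z v - fderiv ℝ Ψ z v‖ ≤ ε := fun z v hv => by
      have := (fderiv ℝ Ψ' z - fderiv ℝ Ψ z).le_opNorm v
      rw [hv, mul_one] at this
      exact this.trans (hcl z)
    have hI : ∀ z, ‖Complex.I * (fderiv ℝ Ψ' z Complex.I - fderiv ℝ Ψ z Complex.I)‖ ≤ ε := fun z => by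
      rw [norm_mul, Complex.norm_I, one_mul]; exact hb z _ Complex.norm_I
    have e1 : ∀ z, ‖dz Ψ' z - dz Ψ z‖ ≤ ε := fun z => by
      have : dz Ψ' z - dz Ψ z = ((fderiv ℝ Ψ' z 1 - fderiv ℝ Ψ z 1) -
        Complex.I * (fderiv ℝ Ψ' z Complex.I - fderiv ℝ Ψ z Complex.I)) / 2 := by
        simp only [dz]; ring
      rw [this, norm_div, Complex.norm_ofNat]
      have := norm_sub_le (fderiv ℝ Ψ' z 1 - fderiv ℝ Ψ z 1)
        (Complex.I * (fderiv ℝ Ψ' z Complex.I - fderiv ℝ Ψ z Complex.I))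
      linarith [hb z 1 (by simp), hI z]
    have e2 : ∀ z, ‖dzb Ψ' z - dzb Ψ z‖ ≤ ε := fun z => by
      have : dzb Ψ' z - dzb Ψ z = ((fderiv ℝ Ψ' z 1 - fderiv ℝ Ψ z 1) +
        Complex.I * (fderiv ℝ Ψ' z Complex.I - fderiv ℝ Ψ z Complex.I)) / 2 := by
        simp only [dzb]; ring
      rw [this, norm_div, Complex.norm_ofNat]
      have := norm_add_le (fderiv ℝ Ψ' z 1 - fderiv ℝ Ψ z 1)
        (Complex.I * (fderiv ℝ Ψ' z Complex.I - fderiv ℝ Ψ z Complex.I))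
      linarith [hb z 1 (by simp), hI z]
    have e3 : ∀ z, dev Ψ' z ≤ dev Ψ z + 2 * ε := fun z => by
      unfold dev
      have a1 := norm_sub_norm_le (dzb Ψ' z) (dzb Ψ z)
      have a2 := abs_norm_sub_norm_le (dz Ψ' z) (dz Ψ z)
      have a3 := abs_add_le (‖dz Ψ' z‖ - ‖dz Ψ z‖) (‖dz Ψ z‖ - 1)
      rw [sub_add_sub_cancel] at a3
      linarith [e1 z, e2 z]
    have e4 : ∫ z in closedBall (0:ℂ) 9, dev Ψ' z ^ 2 ≤ 2 * E + 8 * ε ^ 2 * (Real.pi * 9 ^ 2) := by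
      calc _ ≤ ∫ z in closedBall (0:ℂ) 9, (2 * dev Ψ z ^ 2 + 8 * ε ^ 2) := by
            refine setIntegral_mono (intOn_cb (by fun_prop) 0 9) (intOn_cb (by fun_prop) 0 9)
              fun z => ?_
            show dev Ψ' z ^ 2 ≤ 2 * dev Ψ z ^ 2 + 8 * ε ^ 2
            have h0 : 0 ≤ dev Ψ' z := by unfold dev; positivity
            have := pow_le_pow_left₀ h0 (e3 z) 2
            nlinarith [sq_nonneg (dev Ψ z - 2 * ε)]
        _ = _ := by
            rw [integral_add (intOn_cb (by fun_prop) 0 9) (intOn_cb (by fun_prop) 0 9),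
              setIntegral_const, integral_const_mul, vol_cbC 0 9 (by norm_num), smul_eq_mul]
            ring
    have e5 : ∫ z in closedBall (0:ℂ) 2, ‖dz Ψ z - a‖ ^ 2 ≤
        2 * (∫ z in closedBall (0:ℂ) 2, ‖dz Ψ' z - a‖ ^ 2) + 2 * ε ^ 2 * (Real.pi * 2 ^ 2) := by
      calc _ ≤ ∫ z in closedBall (0:ℂ) 2, (2 * ‖dz Ψ' z - a‖ ^ 2 + 2 * ε ^ 2) := by
            refine setIntegral_mono (intOn_cb (by fun_prop) 0 2) (intOn_cb (by fun_prop) 0 2)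
              fun z => ?_
            show ‖dz Ψ z - a‖ ^ 2 ≤ 2 * ‖dz Ψ' z - a‖ ^ 2 + 2 * ε ^ 2
            have h5 : ‖dz Ψ z - a‖ ≤ ‖dz Ψ' z - a‖ + ε := by
              have := norm_sub_le (dz Ψ' z - a) (dz Ψ' z - dz Ψ z)
              rw [show dz Ψ' z - a - (dz Ψ' z - dz Ψ z) = dz Ψ z - a by ring] at this
              linarith [e1 z]
            have := pow_le_pow_left₀ (norm_nonneg _) h5 2
            nlinarith [sq_nonneg (‖dz Ψ' z - a‖ - ε)]
        _ = _ := by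
            rw [integral_add (intOn_cb (by fun_prop) 0 2) (intOn_cb (by fun_prop) 0 2),
              setIntegral_const, integral_const_mul, vol_cbC 0 2 (by norm_num), smul_eq_mul]
            ring
    have e6 : A ≤ ∫ z in closedBall (0:ℂ) 2, ‖dz Ψ z - a‖ ^ 2 := hmin (by simpa using ha)
    have e7 := mul_le_mul_of_nonneg_left e4 hC
    rw [hK]
    nlinarith
  refine le_of_forall_pos_le_add fun η hη => ?_
  have := key (Real.sqrt (η / K)) (Real.sqrt_pos.2 (by positivity))
  rwa [Real.sq_sqrt (by positivity), mul_div_cancel₀ _ hK0.ne'] at this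

end RPD

namespace RPD
open Set Metric
open scoped ENNReal

def toC : (Fin 2 → ℝ) →L[ℝ] ℂ :=
  Complex.ofRealCLM.comp (ContinuousLinearMap.proj 0) +
    Complex.I • Complex.ofRealCLM.comp (ContinuousLinearMap.proj 1)

lemma toC_apply (v : Fin 2 → ℝ) : toC v = (v 0 : ℂ) + Complex.I * (v 1 : ℂ) := by
  simp [toC]

def toV : ℂ →L[ℝ] (Fin 2 → ℝ) :=
  ContinuousLinearMap.pi ![Complex.reCLM, Complex.imCLM]

lemma toV_apply (z : ℂ) : toV z = ![z.re, z.im] := by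
  ext i; fin_cases i <;> simp [toV]

lemma toV_one : toV 1 = Pi.single 0 1 := by
  rw [toV_apply]; ext i; fin_cases i <;> simp

lemma toV_I : toV Complex.I = Pi.single 1 1 := by
  rw [toV_apply]; ext i; fin_cases i <;> simp

def ff (Φ : (Fin 2 → ℝ) → (Fin 2 → ℝ)) (y : Fin 2 → ℝ) : ℂ :=
  (toC (fderiv ℝ Φ y (Pi.single 0 1)) - Complex.I * toC (fderiv ℝ Φ y (Pi.single 1 1))) / 2

def gg (Φ : (Fin 2 → ℝ) → (Fin 2 → ℝ)) (y : Fin 2 → ℝ) : ℂ :=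
  (toC (fderiv ℝ Φ y (Pi.single 0 1)) + Complex.I * toC (fderiv ℝ Φ y (Pi.single 1 1))) / 2

def dv (Φ : (Fin 2 → ℝ) → (Fin 2 → ℝ)) (y : Fin 2 → ℝ) : ℝ := ‖gg Φ y‖ + |‖ff Φ y‖ - 1|

lemma dv_nonneg (Φ : (Fin 2 → ℝ) → (Fin 2 → ℝ)) (y : Fin 2 → ℝ) : 0 ≤ dv Φ y := by
  unfold dv; positivity

lemma lint_sq {F : ℂ → ℝ} (hF : Continuous F) (h0 : ∀ z, 0 ≤ F z) (z : ℂ) (r : ℝ) :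
    ∫⁻ y in closedBall z r, ENNReal.ofReal (F y) ^ (2:ℝ) =
      ENNReal.ofReal (∫ y in closedBall z r, F y ^ 2) := by
  rw [ofReal_integral_eq_lintegral_ofReal (intOn_cb (by fun_prop) z r)
    (Filter.Eventually.of_forall fun y => sq_nonneg _)]
  refine lintegral_congr fun y => ?_
  rw [ENNReal.rpow_two, ENNReal.ofReal_pow (h0 y)]

lemma map_T (x : Fin 2 → ℝ) {r : ℝ} (hr : 0 < r) :
    Measure.map (fun z : ℂ => x + r • toV z) volume =
      ENNReal.ofReal |(r ^ 2)⁻¹| • (volume : Measure (Fin 2 → ℝ)) := by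
  have h1 : Measure.map (fun z : ℂ => toV z) volume = (volume : Measure (Fin 2 → ℝ)) := by
    have := Complex.volume_preserving_equiv_pi.map_eq
    rw [← this]; congr 1; funext z; rw [toV_apply]; rfl
  have h2 : (fun z : ℂ => x + r • toV z) = (fun y => x + y) ∘ (fun y => r • y) ∘ (fun z => toV z) := rfl
  rw [h2, ← Measure.map_map (by fun_prop) (by fun_prop),
    ← Measure.map_map (by fun_prop) (by fun_prop), h1, Measure.map_addHaar_smul _ hr.ne',
    Measure.map_smul, (measurePreserving_add_left volume x).map_eq]
  simp

lemma local_rigid_global : ∃ C : ℝ≥0∞, C ≠ ∞ ∧ ∀ F : (Fin 2 → ℝ) → (Fin 2 → ℝ), ContDiff ℝ 1 F →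
    HasCompactSupport F → ∀ x r, 0 < r → ∃ m : ℂ, ‖m‖ = 1 ∧
      ∫⁻ z in closedBall x r, ‖ff F z - m‖ₑ ^ (2:ℝ) ≤
        C * ∫⁻ z in closedBall x (9 * r), ENNReal.ofReal (dv F z) ^ (2:ℝ) := by
  obtain ⟨C, hC, H⟩ := c1_rigid
  refine ⟨ENNReal.ofReal C, ENNReal.ofReal_ne_top, fun F hF hc x r hr => ?_⟩
  let T : ℂ → (Fin 2 → ℝ) := fun z => x + r • toV z
  let Ψ : ℂ → ℂ := fun z => (r⁻¹ : ℝ) • toC (F (T z))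
  have hT : ContDiff ℝ 1 T := by fun_prop
  have hΨ : ContDiff ℝ 1 Ψ := by
    have : ContDiff ℝ 1 fun z => toC (F (T z)) := toC.contDiff.comp (hF.comp hT)
    exact this.const_smul _
  have hTd : ∀ z, HasFDerivAt T (r • toV) z := fun z =>
    ((toV.hasFDerivAt (x := z)).const_smul r).const_add x
  have hΨd : ∀ z v, fderiv ℝ Ψ z v = toC (fderiv ℝ F (T z) (toV v)) := by
    intro z v
    have h1 : HasFDerivAt F (fderiv ℝ F (T z)) (T z) :=
      ((hF.differentiable one_ne_zero) _).hasFDerivAt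
    have h2 := ((toC.hasFDerivAt (x := F (T z))).comp z (h1.comp z (hTd z))).const_smul r⁻¹
    have h3 : HasFDerivAt Ψ _ z := h2
    rw [h3.fderiv]
    simp [hr.ne']
  have hdz : ∀ z, dz Ψ z = ff F (T z) := fun z => by
    simp only [dz, ff, hΨd, toV_one, toV_I]
  have hdzb : ∀ z, dzb Ψ z = gg F (T z) := fun z => by
    simp only [dzb, gg, hΨd, toV_one, toV_I]
  have hdev : ∀ z, dev Ψ z = dv F (T z) := fun z => by simp only [dev, dv, hdz, hdzb]
  have hΨc : HasCompactSupport Ψ := by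
    obtain ⟨R, hR⟩ := hc.isBounded.subset_closedBall 0
    refine HasCompactSupport.of_support_subset_isCompact (isCompact_closedBall (0:ℂ) (2 * ((R + ‖x‖) / r))) ?_
    intro z hz
    have h1 : F (T z) ≠ 0 := fun h => hz (by simp [Ψ, h])
    have h2 : T z ∈ closedBall 0 R := hR (subset_tsupport _ h1)
    rw [mem_closedBall_zero_iff] at h2 ⊢
    have h3 : ‖r • toV z‖ ≤ R + ‖x‖ := by
      have := norm_sub_le (T z) x
      simp only [T, add_sub_cancel_left] at this
      exact this.trans (by gcongr)
    rw [norm_smul, Real.norm_of_nonneg hr.le] at h3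
    have h4 : ‖toV z‖ ≤ (R + ‖x‖) / r := by rw [le_div_iff₀ hr]; linarith
    have h5 : |z.re| ≤ ‖toV z‖ := by
      have := norm_le_pi_norm (toV z) 0; rw [toV_apply] at this ⊢; simpa using this
    have h6 : |z.im| ≤ ‖toV z‖ := by
      have := norm_le_pi_norm (toV z) 1; rw [toV_apply] at this ⊢; simpa using this
    have := Complex.norm_le_abs_re_add_abs_im z
    linarith
  obtain ⟨m, hm, hest⟩ := H Ψ hΨ hΨc
  refine ⟨m, hm, ?_⟩
  have cdz := continuous_dz hΨ
  have cdzb := continuous_dzb hΨ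
  have cdev : Continuous (dev Ψ) := by unfold dev; fun_prop
  have hFd : Continuous (fderiv ℝ F) := hF.continuous_fderiv one_ne_zero
  have cff : Continuous (ff F) := by unfold ff; fun_prop
  have cgg : Continuous (gg F) := by unfold gg; fun_prop
  have cdv : Continuous (dv F) := by unfold dv; fun_prop
  have hest2 : ∫⁻ z in closedBall (0:ℂ) 2, ‖dz Ψ z - m‖ₑ ^ (2:ℝ) ≤
      ENNReal.ofReal C * ∫⁻ z in closedBall (0:ℂ) 9, ENNReal.ofReal (dev Ψ z) ^ (2:ℝ) := by
    have h1 := lint_sq (F := fun z => ‖dz Ψ z - m‖) (by fun_prop) (fun z => norm_nonneg _) 0 2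
    simp only [ofReal_norm] at h1
    rw [h1, lint_sq cdev (fun z => by unfold dev; positivity), ← ENNReal.ofReal_mul hC]
    exact ENNReal.ofReal_le_ofReal hest
  have hTm : Measurable T := hT.continuous.measurable
  set c := ENNReal.ofReal |(r ^ 2)⁻¹| with hcdef
  have hc0 : c ≠ 0 := by
    rw [hcdef, Ne, ENNReal.ofReal_eq_zero, not_le]; positivity
  have hmap := map_T x hr
  have hl : c * ∫⁻ z in closedBall x r, ‖ff F z - m‖ₑ ^ (2:ℝ) =
      ∫⁻ z in T ⁻¹' closedBall x r, ‖dz Ψ z - m‖ₑ ^ (2:ℝ) := by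
    simp only [hdz]
    rw [← setLIntegral_map (f := fun y => ‖ff F y - m‖ₑ ^ (2:ℝ)) measurableSet_closedBall
      (by fun_prop) hTm, hmap, Measure.restrict_smul, lintegral_smul_measure, smul_eq_mul]
  have hr' : c * ∫⁻ z in closedBall x (9 * r), ENNReal.ofReal (dv F z) ^ (2:ℝ) =
      ∫⁻ z in T ⁻¹' closedBall x (9 * r), ENNReal.ofReal (dev Ψ z) ^ (2:ℝ) := by
    simp only [hdev]
    rw [← setLIntegral_map (f := fun y => ENNReal.ofReal (dv F y) ^ (2:ℝ)) measurableSet_closedBall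
      (by fun_prop) hTm, hmap, Measure.restrict_smul, lintegral_smul_measure, smul_eq_mul]
  have s1 : T ⁻¹' closedBall x r ⊆ closedBall (0:ℂ) 2 := by
    intro z hz
    simp only [T, mem_preimage, mem_closedBall, dist_self_add_left, norm_smul,
      Real.norm_of_nonneg hr.le] at hz
    have h4 : ‖toV z‖ ≤ 1 := by nlinarith
    have h5 : |z.re| ≤ ‖toV z‖ := by
      have := norm_le_pi_norm (toV z) 0; rw [toV_apply] at this ⊢; simpa using this
    have h6 : |z.im| ≤ ‖toV z‖ := by
      have := norm_le_pi_norm (toV z) 1; rw [toV_apply] at this ⊢; simpa using this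
    have := Complex.norm_le_abs_re_add_abs_im z
    rw [mem_closedBall_zero_iff]
    linarith
  have s2 : closedBall (0:ℂ) 9 ⊆ T ⁻¹' closedBall x (9 * r) := by
    intro z hz
    rw [mem_closedBall_zero_iff] at hz
    simp only [T, mem_preimage, mem_closedBall, dist_self_add_left, norm_smul,
      Real.norm_of_nonneg hr.le]
    have h4 : ‖toV z‖ ≤ 9 := by
      rw [pi_norm_le_iff_of_nonneg (by norm_num), toV_apply]
      intro i
      fin_cases i
      · exact (Complex.abs_re_le_norm z).trans hz
      · exact (Complex.abs_im_le_norm z).trans hz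
    nlinarith
  rw [← ENNReal.mul_le_mul_iff_right hc0 ENNReal.ofReal_ne_top, hl, mul_left_comm, hr']
  calc _ ≤ _ := lintegral_mono_set s1
    _ ≤ _ := hest2
    _ ≤ _ := by gcongr

lemma local_rigid : ∃ C : ℝ≥0∞, C ≠ ∞ ∧ ∀ (U : Set (Fin 2 → ℝ)) (Φ : (Fin 2 → ℝ) → (Fin 2 → ℝ)),
    IsOpen U → ContDiffOn ℝ 1 Φ U → ∀ x r, 0 < r → closedBall x (9 * r) ⊆ U → ∃ m : ℂ, ‖m‖ = 1 ∧
      ∫⁻ z in closedBall x r, ‖ff Φ z - m‖ₑ ^ (2:ℝ) ≤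
        C * ∫⁻ z in closedBall x (9 * r), ENNReal.ofReal (dv Φ z) ^ (2:ℝ) := by
  obtain ⟨C, hC, H⟩ := local_rigid_global
  refine ⟨C, hC, fun U Φ hU hΦ x r hr hsub => ?_⟩
  obtain ⟨ε, hε, hth⟩ := (isCompact_closedBall x (9 * r)).exists_cthickening_subset_open hU hsub
  rw [cthickening_closedBall hε.le (by positivity)] at hth
  let χ : ContDiffBump x := ⟨9 * r + ε / 2, 9 * r + ε, by positivity, by linarith⟩
  have hts : tsupport χ ⊆ U := by
    rw [χ.tsupport_eq]; exact (closedBall_subset_closedBall (by simp [χ, add_comm])).trans hth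
  let F : (Fin 2 → ℝ) → (Fin 2 → ℝ) := fun y => χ y • Φ y
  have hF : ContDiff ℝ 1 F := by
    rw [contDiff_iff_contDiffAt]
    intro y
    by_cases hy : y ∈ tsupport χ
    · exact χ.contDiffAt.smul (hΦ.contDiffAt (hU.mem_nhds (hts hy)))
    · have h1 := notMem_tsupport_iff_eventuallyEq.1 hy
      have h2 : F =ᶠ[𝓝 y] fun _ => 0 := by
        filter_upwards [h1] with z hz
        simp [F, hz]
      exact contDiffAt_const.congr_of_eventuallyEq h2
  have hFc : HasCompactSupport F := χ.hasCompactSupport.smul_right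
  have hEq : ∀ y ∈ closedBall x (9 * r), fderiv ℝ F y = fderiv ℝ Φ y := by
    intro y hy
    apply Filter.EventuallyEq.fderiv_eq
    have : y ∈ ball x (9 * r + ε / 2) := closedBall_subset_ball (by linarith) hy
    filter_upwards [isOpen_ball.mem_nhds this] with z hz
    simp [F, χ.one_of_mem_closedBall (ball_subset_closedBall hz)]
  obtain ⟨m, hm, hest⟩ := H F hF hFc x r hr
  refine ⟨m, hm, ?_⟩
  have e1 : ∫⁻ z in closedBall x r, ‖ff Φ z - m‖ₑ ^ (2:ℝ) = ∫⁻ z in closedBall x r, ‖ff F z - m‖ₑ ^ (2:ℝ) := by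
    refine setLIntegral_congr_fun measurableSet_closedBall fun y hy => ?_
    simp only [ff, hEq y (closedBall_subset_closedBall (by linarith) hy)]
  have e2 : ∫⁻ z in closedBall x (9 * r), ENNReal.ofReal (dv Φ z) ^ (2:ℝ) =
      ∫⁻ z in closedBall x (9 * r), ENNReal.ofReal (dv F z) ^ (2:ℝ) := by
    refine setLIntegral_congr_fun measurableSet_closedBall fun y hy => ?_
    simp only [dv, ff, gg, hEq y hy]
  rw [e1, e2]
  exact hest

end RPD

namespace RPD
open Set Metric
open scoped ENNReal

lemma map_rigid {p : ℝ} (hp : 2 ≤ p) {Ω : Set V2} (hΩ : IsOpen Ω) (hb : Bornology.IsBounded Ω)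
    (hc : IsConnected Ω) (hsm : HasSmoothBoundary Ω) :
    ∃ C : ℝ≥0∞, C ≠ ∞ ∧ ∀ Φ : V2 → V2, CkCl 1 Ω Φ → ∃ m : ℂ, ‖m‖ = 1 ∧
      ∫⁻ x in Ω, ‖ff Φ x - m‖ₑ ^ p ≤ C * ∫⁻ x in Ω, ENNReal.ofReal (dv Φ x) ^ p := by
  obtain ⟨C₁, hC₁, H1⟩ := local_rigid
  obtain ⟨C₂, hC₂, H2⟩ := interior_Lp hp (Λ := 9) (by norm_num) hC₁
  obtain ⟨C, hC, H3⟩ := global_rigidity (p := p) (Λ := 8 * 9 + 4) (by linarith) (by norm_num) hC₂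
    hΩ hb hc hsm
  refine ⟨C, hC, fun Φ hΦ => ?_⟩
  obtain ⟨U, hU, hcl, hΦU⟩ := hΦ
  have hΦU : ContDiffOn ℝ 1 Φ U := hΦU
  have hfd : ContinuousOn (fderiv ℝ Φ) U := hΦU.continuousOn_fderiv_of_isOpen hU le_rfl
  have cff : ContinuousOn (ff Φ) U := by unfold ff; fun_prop
  have cgg : ContinuousOn (gg Φ) U := by unfold gg; fun_prop
  have cdv : ContinuousOn (dv Φ) U := by unfold dv; fun_prop
  have mfd : ∀ v, Measurable fun y => fderiv ℝ Φ y v := fun v => measurable_fderiv_apply_const ℝ Φ v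
  have mff : Measurable (ff Φ) := by
    unfold ff
    have := mfd (Pi.single 0 1); have := mfd (Pi.single 1 1); fun_prop
  have mgg : Measurable (gg Φ) := by
    unfold gg
    have := mfd (Pi.single 0 1); have := mfd (Pi.single 1 1); fun_prop
  have mdv : Measurable (dv Φ) := by unfold dv; fun_prop
  have hcpt : IsCompact (closure Ω) := hb.isCompact_closure
  obtain ⟨Kf, hKf⟩ := hcpt.exists_bound_of_continuousOn (cff.mono hcl)
  obtain ⟨Kd, hKd⟩ := hcpt.exists_bound_of_continuousOn (cdv.mono hcl)
  set f := Ω.indicator (ff Φ) with hf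
  set d := Ω.indicator (fun x => ENNReal.ofReal (dv Φ x)) with hd
  have hfe : ∀ x ∈ Ω, f x = ff Φ x := fun x hx => indicator_of_mem hx _
  have hde : ∀ x ∈ Ω, d x = ENNReal.ofReal (dv Φ x) := fun x hx => indicator_of_mem hx _
  have hne : Ω.Nonempty := hc.nonempty
  have hKf0 : 0 ≤ Kf := by
    obtain ⟨x, hx⟩ := hne
    exact (norm_nonneg _).trans (hKf x (subset_closure hx))
  have hbf : ∀ x, ‖f x‖ ≤ Kf := fun x => by
    by_cases hx : x ∈ Ω
    · rw [hfe x hx]; exact hKf x (subset_closure hx)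
    · simp [hf, hx, hKf0]
  have hA : Adm 9 C₁ Ω f d := by
    refine ⟨mff.indicator hΩ.measurableSet, ⟨Kf, hbf⟩, ?_, ?_, ⟨ENNReal.ofReal Kd,
      ENNReal.ofReal_ne_top, fun x => ?_⟩, fun x r hr hsub => ?_⟩
    · exact (cff.mono (subset_closure.trans hcl)).congr hfe
    · exact (mdv.ennreal_ofReal).indicator hΩ.measurableSet
    · by_cases hx : x ∈ Ω
      · rw [hde x hx]
        exact ENNReal.ofReal_le_ofReal ((le_abs_self _).trans (hKd x (subset_closure hx)))
      · simp [hd, hx]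
    · obtain ⟨m, hm, hest⟩ := H1 U Φ hU hΦU x r hr (hsub.trans (subset_closure.trans hcl))
      refine ⟨m, hm, ?_⟩
      rw [setLIntegral_congr_fun (g := fun z => ‖ff Φ z - m‖ₑ ^ (2:ℝ)) measurableSet_closedBall
        (fun z hz => by
          simp only [hfe z (hsub (closedBall_subset_closedBall (by linarith) hz))]),
        setLIntegral_congr_fun (f := fun z => d z ^ (2:ℝ))
          (g := fun z => ENNReal.ofReal (dv Φ z) ^ (2:ℝ)) measurableSet_closedBall
        (fun z hz => by simp only [hde z (hsub hz)])]
      exact hest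
  have hAP : AdmP p (8 * 9 + 4) C₂ Ω f d :=
    ⟨hA.mf, hA.bf, hA.md, fun x r hr hsub => H2 Ω f d hΩ hA x r hr hsub⟩
  obtain ⟨m, hm, hest⟩ := H3 f d hAP
  refine ⟨m, hm, ?_⟩
  rw [setLIntegral_congr_fun (g := fun z => ‖ff Φ z - m‖ₑ ^ p) hΩ.measurableSet
        (fun z hz => by simp only [hfe z hz]),
        setLIntegral_congr_fun (f := fun z => d z ^ p)
          (g := fun z => ENNReal.ofReal (dv Φ z) ^ p) hΩ.measurableSet
        (fun z hz => by simp only [hde z hz])] at hest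
  exact hest

lemma ff_re (Φ : V2 → V2) (x : V2) : (ff Φ x).re =
    (fderiv ℝ Φ x (Pi.single 0 1) 0 + fderiv ℝ Φ x (Pi.single 1 1) 1) / 2 := by
  simp [ff, toC_apply]

lemma ff_im (Φ : V2 → V2) (x : V2) : (ff Φ x).im =
    (fderiv ℝ Φ x (Pi.single 0 1) 1 - fderiv ℝ Φ x (Pi.single 1 1) 0) / 2 := by
  simp [ff, toC_apply]

lemma gg_re (Φ : V2 → V2) (x : V2) : (gg Φ x).re =
    (fderiv ℝ Φ x (Pi.single 0 1) 0 - fderiv ℝ Φ x (Pi.single 1 1) 1) / 2 := by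
  simp [gg, toC_apply]; ring

lemma gg_im (Φ : V2 → V2) (x : V2) : (gg Φ x).im =
    (fderiv ℝ Φ x (Pi.single 0 1) 1 + fderiv ℝ Φ x (Pi.single 1 1) 0) / 2 := by
  simp [gg, toC_apply]

lemma frob_entry (M : Mat2) (i j : Fin 2) : |M i j| ≤ frob M := by
  unfold frob
  apply Real.abs_le_sqrt
  simp only [Fin.sum_univ_two]
  fin_cases i <;> fin_cases j <;>
  · simp only [Fin.zero_eta, Fin.mk_one]
    nlinarith [sq_nonneg (M 0 0), sq_nonneg (M 0 1), sq_nonneg (M 1 0), sq_nonneg (M 1 1)]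

lemma scal {F G k u v w : ℝ} (hF0 : 0 ≤ F) (hG0 : 0 ≤ G) (hk : 0 ≤ k) (hk1 : k ≤ 1 / 2)
    (hu : -k ≤ u ∧ u ≤ k) (hv : -k ≤ v ∧ v ≤ k) (hw : -k ≤ w ∧ w ≤ k)
    (hsum : F ^ 2 + G ^ 2 = 1 + (u + w) / 2) (hdif : 0 < F ^ 2 - G ^ 2)
    (hprod : (F * G) ^ 2 = ((u - w) / 4) ^ 2 + (v / 2) ^ 2) : G + |F - 1| ≤ 5 * k := by
  obtain ⟨hu1, hu2⟩ := hu
  obtain ⟨hv1, hv2⟩ := hv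
  obtain ⟨hw1, hw2⟩ := hw
  have hF2 : (1 / 2) ^ 2 ≤ F ^ 2 := by linarith
  have hF : 1 / 2 ≤ F := le_of_sq_le_sq hF2 hF0
  have hFG : F * G ≤ k := by
    have h1 : ((u - w) / 4) ^ 2 ≤ (k / 2) ^ 2 := sq_le_sq' (by linarith) (by linarith)
    have h2 : (v / 2) ^ 2 ≤ (k / 2) ^ 2 := sq_le_sq' (by linarith) (by linarith)
    have h3 : (F * G) ^ 2 ≤ k ^ 2 := by
      rw [hprod]; linarith [sq_nonneg k, show (k / 2) ^ 2 = k ^ 2 / 4 by ring]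
    exact le_of_sq_le_sq h3 hk
  have hG : G ≤ 2 * k := by
    have := mul_le_mul_of_nonneg_right hF hG0
    linarith
  have hG2 : G ^ 2 ≤ 2 * k := by
    have := mul_le_mul hG (show G ≤ 1 by linarith) hG0 (by linarith)
    nlinarith
  have hF1 : |F - 1| ≤ 3 * k := by
    have h4 : |F ^ 2 - 1| ≤ 3 * k := by
      rw [abs_le]; constructor <;> linarith [sq_nonneg G]
    have h5 : |F ^ 2 - 1| = |F - 1| * (F + 1) := by
      rw [show F ^ 2 - 1 = (F - 1) * (F + 1) by ring, abs_mul, abs_of_nonneg (by linarith : 0 ≤ F + 1)]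
    nlinarith [abs_nonneg (F - 1)]
  linarith

lemma dv_le {Φ : V2 → V2} {x : V2} {s : ℝ} (hs : 0 ≤ s) {B : Mat2}
    (hdet : 0 < (Dm Φ x).det) (hsB : s * frob B ≤ 1 / 2) (hpb : pullback2 Φ x = 1 + s • B) :
    dv Φ x ≤ 5 * s * frob B := by
  set n := frob B with hn
  have hn0 : 0 ≤ n := Real.sqrt_nonneg _
  have h00 := congrFun (congrFun hpb 0) 0
  have h11 := congrFun (congrFun hpb 1) 1
  have h01 := congrFun (congrFun hpb 0) 1
  simp only [pullback2, Matrix.of_apply, Fin.sum_univ_two, Matrix.add_apply, Matrix.smul_apply,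
    Matrix.one_apply_eq, smul_eq_mul] at h00 h11 h01
  rw [Matrix.one_apply_ne (by decide)] at h01
  simp only [Dm, Matrix.det_fin_two, Matrix.of_apply] at hdet
  have f2 : ‖ff Φ x‖ ^ 2 = (ff Φ x).re ^ 2 + (ff Φ x).im ^ 2 := by
    rw [← Complex.normSq_eq_norm_sq, Complex.normSq_apply]; ring
  have g2 : ‖gg Φ x‖ ^ 2 = (gg Φ x).re ^ 2 + (gg Φ x).im ^ 2 := by
    rw [← Complex.normSq_eq_norm_sq, Complex.normSq_apply]; ring
  rw [ff_re, ff_im] at f2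
  rw [gg_re, gg_im] at g2
  have b00 := mul_le_mul_of_nonneg_left (frob_entry B 0 0) hs
  have b01 := mul_le_mul_of_nonneg_left (frob_entry B 0 1) hs
  have b11 := mul_le_mul_of_nonneg_left (frob_entry B 1 1) hs
  rw [← hn] at b00 b01 b11
  have a00 : |s * B 0 0| ≤ s * n := by rwa [abs_mul, abs_of_nonneg hs]
  have a01 : |s * B 0 1| ≤ s * n := by rwa [abs_mul, abs_of_nonneg hs]
  have a11 : |s * B 1 1| ≤ s * n := by rwa [abs_mul, abs_of_nonneg hs]
  generalize fderiv ℝ Φ x (Pi.single 0 1) 0 = p0 at *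
  generalize fderiv ℝ Φ x (Pi.single 0 1) 1 = p1 at *
  generalize fderiv ℝ Φ x (Pi.single 1 1) 0 = q0 at *
  generalize fderiv ℝ Φ x (Pi.single 1 1) 1 = q1 at *
  unfold dv
  have hF0 := norm_nonneg (ff Φ x)
  have hG0 := norm_nonneg (gg Φ x)
  generalize ‖ff Φ x‖ = F at *
  generalize ‖gg Φ x‖ = G at *
  generalize s * B 0 0 = u at *
  generalize s * B 0 1 = v at *
  generalize s * B 1 1 = w at *
  have hsn : 0 ≤ s * n := by positivity
  rw [mul_assoc]
  generalize s * n = k at *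
  rw [abs_le] at a00 a01 a11
  have hsum : F ^ 2 + G ^ 2 = 1 + (u + w) / 2 := by linear_combination f2 + g2 + h00 / 2 + h11 / 2
  have hdif : F ^ 2 - G ^ 2 = p0 * q1 - p1 * q0 := by linear_combination f2 - g2
  have hprod : (F * G) ^ 2 = ((u - w) / 4) ^ 2 + (v / 2) ^ 2 := by
    have e1 : u = p0 * p0 + p1 * p1 - 1 := by linarith
    have e2 : w = q0 * q0 + q1 * q1 - 1 := by linarith
    have e3 : v = p0 * q0 + p1 * q1 := by linarith
    rw [mul_pow, f2, g2, e1, e2, e3]; ring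
  exact scal hF0 hG0 hsn hsB a00 a01 a11 hsum (by linarith) hprod

end RPD

namespace RPD
open Set Metric
open scoped ENNReal

def rotM (m : ℂ) : Mat2 := !![m.re, -m.im; m.im, m.re]

lemma rotM_mem {m : ℂ} (hm : ‖m‖ = 1) : rotM m ∈ SO2 := by
  have h : m.re * m.re + m.im * m.im = 1 := by
    rw [← Complex.normSq_apply, Complex.normSq_eq_norm_sq, hm, one_pow]
  refine ⟨?_, ?_⟩
  · ext i j
    fin_cases i <;> fin_cases j <;> simp [rotM, Matrix.mul_apply, Fin.sum_univ_two] <;> linarith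
  · simp [rotM, Matrix.det_fin_two]; linarith

lemma frob_nonneg (M : Mat2) : 0 ≤ frob M := Real.sqrt_nonneg _

lemma frob_smul {c : ℝ} (hc : 0 ≤ c) (M : Mat2) : frob (c • M) = c * frob M := by
  unfold frob
  simp only [Matrix.smul_apply, smul_eq_mul, mul_pow, ← Finset.mul_sum]
  rw [Real.sqrt_mul (by positivity), Real.sqrt_sq hc]

lemma frob_sub_le (Φ : V2 → V2) (x : V2) (m : ℂ) :
    frob (Dm Φ x - rotM m) ≤ 2 * (‖ff Φ x - m‖ + ‖gg Φ x‖) := by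
  unfold frob
  rw [Real.sqrt_le_iff]
  refine ⟨by positivity, ?_⟩
  have f2 : ‖ff Φ x - m‖ ^ 2 = (ff Φ x - m).re ^ 2 + (ff Φ x - m).im ^ 2 := by
    rw [← Complex.normSq_eq_norm_sq, Complex.normSq_apply]; ring
  have g2 : ‖gg Φ x‖ ^ 2 = (gg Φ x).re ^ 2 + (gg Φ x).im ^ 2 := by
    rw [← Complex.normSq_eq_norm_sq, Complex.normSq_apply]; ring
  rw [Complex.sub_re, Complex.sub_im, ff_re, ff_im] at f2
  rw [gg_re, gg_im] at g2
  have hs : ∑ i, ∑ j, ((Dm Φ x - rotM m) i j) ^ 2 = 2 * ‖ff Φ x - m‖ ^ 2 + 2 * ‖gg Φ x‖ ^ 2 := by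
    rw [f2, g2]
    simp [Fin.sum_univ_two, Dm, rotM]
    ring
  rw [hs]
  nlinarith [norm_nonneg (ff Φ x - m), norm_nonneg (gg Φ x),
    mul_nonneg (norm_nonneg (ff Φ x - m)) (norm_nonneg (gg Φ x))]

lemma lpM_eq {p : ℝ} {Ω : Set V2} {M : V2 → Mat2}
    (hM : AEMeasurable (fun x => frob (M x)) (volume.restrict Ω)) (hp : 0 ≤ p) :
    lpM p Ω M = (∫⁻ x in Ω, ENNReal.ofReal (frob (M x)) ^ p).toReal ^ (1 / p) := by
  unfold lpM
  rw [integral_eq_lintegral_of_nonneg_ae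
    (Filter.Eventually.of_forall fun x => Real.rpow_nonneg (frob_nonneg _) _)
    (hM.pow_const p).aestronglyMeasurable]
  congr 3
  funext x
  rw [ENNReal.ofReal_rpow_of_nonneg (frob_nonneg _) hp]

lemma aem_frob {μ : Measure V2} {M : V2 → Mat2} (h : ∀ i j, AEMeasurable (fun x => M x i j) μ) :
    AEMeasurable (fun x => frob (M x)) μ := by
  unfold frob
  simp only [Fin.sum_univ_two]
  have := h 0 0; have := h 0 1; have := h 1 0; have := h 1 1
  fun_prop

lemma final_est {p : ℝ} (hp : 2 ≤ p) {Ω : Set V2} (hΩ : IsOpen Ω) {C : ℝ≥0∞} {t : ℝ} (ht : 0 < t)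
    {Φ w : V2 → V2} {m : ℂ} {B : V2 → Mat2}
    (hm : ∫⁻ x in Ω, ‖ff Φ x - m‖ₑ ^ p ≤ C * ∫⁻ x in Ω, ENNReal.ofReal (dv Φ x) ^ p)
    (hw : ∀ x ∈ Ω, Dm Φ x = rotM m + t ^ 2 • Dm w x)
    (hdv : ∀ x ∈ Ω, dv Φ x ≤ 5 * t ^ 2 * frob (B x)) :
    ∫⁻ x in Ω, ENNReal.ofReal (frob (Dm w x)) ^ p ≤
      (ENNReal.ofReal 20 ^ p * (C + 1)) * ∫⁻ x in Ω, ENNReal.ofReal (frob (B x)) ^ p := by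
  have hp0 : 0 ≤ p := by linarith
  have mfd : ∀ v, Measurable fun y => fderiv ℝ Φ y v := fun v => measurable_fderiv_apply_const ℝ Φ v
  have mff : Measurable (ff Φ) := by
    unfold ff
    have := mfd (Pi.single 0 1); have := mfd (Pi.single 1 1); fun_prop
  have hA : ∀ x ∈ Ω, ENNReal.ofReal (frob (Dm w x)) ^ p ≤ ENNReal.ofReal (4 / t ^ 2) ^ p *
      (‖ff Φ x - m‖ₑ ^ p + ENNReal.ofReal (dv Φ x) ^ p) := by
    intro x hx
    have h1 : t ^ 2 * frob (Dm w x) = frob (Dm Φ x - rotM m) := by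
      rw [hw x hx, add_sub_cancel_left, frob_smul (by positivity)]
    have h2 := frob_sub_le Φ x m
    have h3 : ‖gg Φ x‖ ≤ dv Φ x := by unfold dv; linarith [abs_nonneg (‖ff Φ x‖ - 1)]
    have h4 : frob (Dm w x) ≤ (4 / t ^ 2) * max ‖ff Φ x - m‖ (dv Φ x) := by
      rw [div_mul_eq_mul_div, le_div_iff₀ (by positivity)]
      linarith [le_max_left ‖ff Φ x - m‖ (dv Φ x), le_max_right ‖ff Φ x - m‖ (dv Φ x)]
    calc _ ≤ (ENNReal.ofReal (4 / t ^ 2) * max ‖ff Φ x - m‖ₑ (ENNReal.ofReal (dv Φ x))) ^ p := by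
          gcongr
          rw [← ofReal_norm, ← ENNReal.ofReal_max, ← ENNReal.ofReal_mul (by positivity)]
          exact ENNReal.ofReal_le_ofReal h4
      _ ≤ _ := by
          rw [ENNReal.mul_rpow_of_nonneg _ _ hp0]
          gcongr
          rcases max_choice ‖ff Φ x - m‖ₑ (ENNReal.ofReal (dv Φ x)) with h | h <;> rw [h]
          · exact le_self_add
          · exact le_add_self
  have hB : ∫⁻ x in Ω, ENNReal.ofReal (dv Φ x) ^ p ≤
      ENNReal.ofReal (5 * t ^ 2) ^ p * ∫⁻ x in Ω, ENNReal.ofReal (frob (B x)) ^ p := by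
    rw [← lintegral_const_mul' _ _ (ENNReal.rpow_ne_top_of_nonneg hp0 ENNReal.ofReal_ne_top)]
    refine setLIntegral_mono' hΩ.measurableSet fun x hx => ?_
    rw [← ENNReal.mul_rpow_of_nonneg _ _ hp0, ← ENNReal.ofReal_mul (by positivity)]
    gcongr
    exact hdv x hx
  have hconst : ENNReal.ofReal (4 / t ^ 2) ^ p * ENNReal.ofReal (5 * t ^ 2) ^ p =
      ENNReal.ofReal 20 ^ p := by
    rw [← ENNReal.mul_rpow_of_nonneg _ _ hp0, ← ENNReal.ofReal_mul (by positivity)]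
    congr 2; field_simp; norm_num
  calc _ ≤ ∫⁻ x in Ω, ENNReal.ofReal (4 / t ^ 2) ^ p *
      (‖ff Φ x - m‖ₑ ^ p + ENNReal.ofReal (dv Φ x) ^ p) := setLIntegral_mono' hΩ.measurableSet hA
    _ = ENNReal.ofReal (4 / t ^ 2) ^ p * ((∫⁻ x in Ω, ‖ff Φ x - m‖ₑ ^ p) +
        ∫⁻ x in Ω, ENNReal.ofReal (dv Φ x) ^ p) := by
        rw [lintegral_const_mul' _ _ (ENNReal.rpow_ne_top_of_nonneg hp0 ENNReal.ofReal_ne_top),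
          lintegral_add_left (by fun_prop)]
    _ ≤ ENNReal.ofReal (4 / t ^ 2) ^ p * ((C + 1) * ∫⁻ x in Ω, ENNReal.ofReal (dv Φ x) ^ p) := by
        rw [add_mul, one_mul]; gcongr
    _ ≤ ENNReal.ofReal (4 / t ^ 2) ^ p * ((C + 1) *
        (ENNReal.ofReal (5 * t ^ 2) ^ p * ∫⁻ x in Ω, ENNReal.ofReal (frob (B x)) ^ p)) := by gcongr
    _ = _ := by rw [← hconst]; ring

end RPD

/-- Rigidity for maps whose pullback metric is `t²`-close to the identity:
`∇Φ = R + t² ∇w` with an `L^p` estimate on `∇w`. -/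
theorem rotation_plus_displacement_decomposition
    (Ω : Set V2) (hΩo : IsOpen Ω) (hΩb : Bornology.IsBounded Ω)
    (hΩsc : SimplyConnectedSpace Ω) (hΩsm : HasSmoothBoundary Ω)
    (p : ℝ) (hp : 2 ≤ p) :
    ∃ C > 0, ∀ K > (0:ℝ), ∃ t₁ > (0:ℝ), ∀ t : ℝ, 0 < t → t ≤ t₁ →
      ∀ (Φ : V2 → V2) (B : V2 → Mat2),
        CkCl 1 Ω Φ →
        (∀ x ∈ Ω, 0 < (Dm Φ x).det) →
        (∀ i j, AEMeasurable (fun x => B x i j)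
          (MeasureTheory.volume.restrict Ω)) →
        (∀ x ∈ Ω, (B x).IsSymm) →
        (∀ x ∈ Ω, frob (B x) ≤ K) →
        (∀ x ∈ Ω, pullback2 Φ x = 1 + t ^ 2 • B x) →
        ∃ R ∈ SO2, ∃ w : V2 → V2,
          DifferentiableOn ℝ w Ω ∧
          (∀ x ∈ Ω, Dm Φ x = R + t ^ 2 • Dm w x) ∧
          lpM p Ω (fun x => Dm w x) ≤ C * lpM p Ω B := by
  have hconn : IsConnected Ω := isConnected_iff_connectedSpace.2 inferInstance
  obtain ⟨C, hC, H⟩ := RPD.map_rigid hp hΩo hΩb hconn hΩsm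
  have hp0 : 0 ≤ p := by linarith
  set M : ENNReal := ENNReal.ofReal 20 ^ p * (C + 1) with hM
  have hMtop : M ≠ ⊤ := ENNReal.mul_ne_top
    (ENNReal.rpow_ne_top_of_nonneg hp0 ENNReal.ofReal_ne_top)
    (ENNReal.add_ne_top.2 ⟨hC, ENNReal.one_ne_top⟩)
  have hM0 : M ≠ 0 := by
    refine mul_ne_zero ?_ (by simp)
    rw [Ne, ENNReal.rpow_eq_zero_iff]
    push Not
    exact ⟨fun h => by simp at h, fun h => by simp at h⟩
  refine ⟨M.toReal ^ (1 / p), Real.rpow_pos_of_pos (ENNReal.toReal_pos hM0 hMtop) _, fun K hK => ?_⟩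
  refine ⟨min 1 (1 / (2 * K)), by positivity, fun t ht ht1 Φ B hΦ hdet hBm _ hBK hpb => ?_⟩
  have htK : t ^ 2 * K ≤ 1 / 2 := by
    have h1 : t ≤ 1 := ht1.trans (min_le_left _ _)
    have h2 : t ≤ 1 / (2 * K) := ht1.trans (min_le_right _ _)
    rw [le_div_iff₀ (by positivity)] at h2
    have h3 : t ^ 2 ≤ t := by nlinarith
    have := mul_le_mul_of_nonneg_right h3 hK.le
    linarith
  obtain ⟨m, hm, hest⟩ := H Φ hΦ
  obtain ⟨U, hU, hcl, hΦU⟩ := hΦ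
  have hdiff : ∀ x ∈ Ω, DifferentiableAt ℝ Φ x := fun x hx =>
    (ContDiffOn.differentiableOn (n := 1) hΦU one_ne_zero).differentiableAt
      (hU.mem_nhds (hcl (subset_closure hx)))
  let L : V2 →L[ℝ] V2 := (Matrix.toLin' (RPD.rotM m)).toContinuousLinearMap
  have ht2 : t ^ 2 ≠ 0 := by positivity
  let w : V2 → V2 := fun x => (t ^ 2)⁻¹ • (Φ x - L x)
  have hwd : ∀ x ∈ Ω, HasFDerivAt w ((t ^ 2)⁻¹ • (fderiv ℝ Φ x - L)) x := fun x hx =>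
    ((hdiff x hx).hasFDerivAt.sub L.hasFDerivAt).const_smul (t ^ 2)⁻¹
  have hw : ∀ x ∈ Ω, Dm Φ x = RPD.rotM m + t ^ 2 • Dm w x := by
    intro x hx
    ext i j
    have hL : L (Pi.single j 1) i = RPD.rotM m i j := by simp [L]
    simp [Dm, (hwd x hx).fderiv, hL, ht2]
  refine ⟨RPD.rotM m, RPD.rotM_mem hm, w,
    fun x hx => (hwd x hx).differentiableAt.differentiableWithinAt, hw, ?_⟩
  have hfin := RPD.final_est hp hΩo ht (B := B) hest hw fun x hx =>
    RPD.dv_le (by positivity) (hdet x hx)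
      ((mul_le_mul_of_nonneg_left (hBK x hx) (by positivity)).trans htK) (hpb x hx)
  have hBfin : ∫⁻ x in Ω, ENNReal.ofReal (frob (B x)) ^ p ≠ ⊤ := by
    refine ne_top_of_le_ne_top (b := ∫⁻ x in Ω, ENNReal.ofReal K ^ p) ?_
      (setLIntegral_mono' hΩo.measurableSet fun x hx => ?_)
    · rw [setLIntegral_const]
      exact ENNReal.mul_ne_top (ENNReal.rpow_ne_top_of_nonneg hp0 ENNReal.ofReal_ne_top)
        hΩb.measure_lt_top.ne
    · gcongr; exact hBK x hx
  rw [RPD.lpM_eq (RPD.aem_frob hBm) hp0, RPD.lpM_eq (RPD.aem_frob fun i j => ?_) hp0,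
    ← Real.mul_rpow ENNReal.toReal_nonneg ENNReal.toReal_nonneg, ← ENNReal.toReal_mul]
  · exact Real.rpow_le_rpow ENNReal.toReal_nonneg
      (ENNReal.toReal_mono (ENNReal.mul_ne_top hMtop hBfin) hfin) (by positivity)
  · have := measurable_fderiv_apply_const ℝ w (Pi.single j 1)
    simp only [Dm, Matrix.of_apply]
    exact ((measurable_pi_apply i).comp this).aemeasurable
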